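/- p-¬p-p Lemma: let x₁, ¬x₂, x₃ be occurrences of p, ¬p, p respectively in a formula A of L∧,∨^{¬p}, and y₁, ¬y₂, y₃ occurrences of p, ¬p, p respectively in a formula B of L∧,∨^{¬p}. Suppose ¬x₂ ∨ x₃ or x₃ ∨ ¬x₂ is a subformula occurrence of A, and y₁ ∧ ¬y₂ or ¬y₂ ∧ y₁ is a subformula occurrence of B. Let g₁ : A′ ⊢ A be a Ξ̂∧_{p,C}-term of PN whose head's crown is ¬x₂ ∨ x₃ or x₃ ∨ ¬x₂, let g₂ : B ⊢ B′ be a Θ̂∨_{p,D}-term of PN whose head's crown is y₁ ∧ ¬y₂ or ¬y₂ ∧ y₁, and let f : A ⊢ B be an arrow term of DS^{¬p} such that x_i and y_i are linked in f for i ∈ {1,2,3}. Then g₂ ∘ f ∘ g₁ is equal in PN to an arrow term of DS^{¬p}. -/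

import Mathlib

/-! ### The category Br of Brauerian split equivalences of finite ordinals

An arrow `m ⊢ n` of `Br` is represented as a relation on `ℕ ⊕ ℕ`, where
`Sum.inl i` (with `i < m`) is the source copy `i_s` and `Sum.inr j`
(with `j < n`) is the target copy `j_t`. -/

abbrev GRel : Type := (ℕ ⊕ ℕ) → (ℕ ⊕ ℕ) → Prop

/-- The identity arrow of `Br` on `n`: transversals `{i_s, i_t}` for `i < n`. -/
def gId (n : ℕ) : GRel := fun u v =>
  ∃ i, i < n ∧ (u = Sum.inl i ∨ u = Sum.inr i) ∧ (v = Sum.inl i ∨ v = Sum.inr i)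

/-- The Brauerian split equivalence whose transversals are `{i_s, (φ i)_t}` for `i < m`. -/
def gFun (m : ℕ) (φ : ℕ → ℕ) : GRel := fun u v =>
  ∃ i, i < m ∧ (u = Sum.inl i ∨ u = Sum.inr (φ i)) ∧ (v = Sum.inl i ∨ v = Sum.inr (φ i))

/-- The block transposition exchanging the first `a` and the last `b` elements. -/
def gSwap (a b : ℕ) : GRel :=
  gFun (a + b) (fun i => if i < a then i + b else i - a)

/-- `G Δ̂∧_{B,A}` with `a = GA`, `b = GB`: identity transversals on the stem `A`
together with caps joining the two copies of each letter occurrence of `B` in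
the crown `¬B ∨ B` of the target. -/
def gDelta (a b : ℕ) : GRel := fun u v =>
  (∃ i, i < a ∧ (u = Sum.inl i ∨ u = Sum.inr i) ∧ (v = Sum.inl i ∨ v = Sum.inr i)) ∨
  (∃ j, j < b ∧ (u = Sum.inr (a + j) ∨ u = Sum.inr (a + b + j)) ∧
                (v = Sum.inr (a + j) ∨ v = Sum.inr (a + b + j)))

/-- `G Σ̂∨_{B,A}` with `a = GA`, `b = GB`: identity transversals on the stem `A`
together with cups joining the two copies of each letter occurrence of `B` in
the crown `B ∧ ¬B` of the source. -/
def gSigma (a b : ℕ) : GRel := fun u v =>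
  (∃ i, i < a ∧ (u = Sum.inl (2*b + i) ∨ u = Sum.inr i) ∧
                (v = Sum.inl (2*b + i) ∨ v = Sum.inr i)) ∨
  (∃ j, j < b ∧ (u = Sum.inl j ∨ u = Sum.inl (b + j)) ∧
                (v = Sum.inl j ∨ v = Sum.inl (b + j)))

/-- Composition `P ∗ R` in `Br`: glue along the middle copy and take the
transitive closure, restricted to the outer copies. -/
def gComp (Pr R : GRel) : GRel := fun u v =>
  Relation.TransGen
    (fun x y : ℕ ⊕ ℕ ⊕ ℕ =>
      (∃ x' y', Sum.map id Sum.inl x' = x ∧ Sum.map id Sum.inl y' = y ∧ R x' y') ∨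
      (∃ x' y', Sum.inr x' = x ∧ Sum.inr y' = y ∧ Pr x' y'))
    (Sum.map id Sum.inr u) (Sum.map id Sum.inr v)

/-- Shift a split relation by `a` on the source side and by `d` on the target side. -/
def gShift (a d : ℕ) (R : GRel) : GRel := fun u v =>
  ∃ u' v', R u' v' ∧ u = Sum.map (· + a) (· + d) u' ∧ v = Sum.map (· + a) (· + d) v'

/-- Disjoint union of split relations: `G(f ξ g) = Gf ∪ Gg_{+GD}^{+GA}`. -/
def gPar (a d : ℕ) (R S : GRel) : GRel := fun u v => R u v ∨ gShift a d S u v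
/-! ### The language L∧,∨^{¬p} generated from `P ∪ P¬` (negation applied only to letters) -/

inductive Form (P : Type) : Type
  | pos : P → Form P
  | natom : P → Form P
  | conj : Form P → Form P → Form P
  | disj : Form P → Form P → Form P

infixr:70 " ⋏ " => Form.conj
infixr:66 " ⋎ " => Form.disj

/-- The number of occurrences of letters (elements of `P ∪ P¬`) in a formula. -/
def Form.size {P : Type} : Form P → ℕ
  | .pos _ => 1
  | .natom _ => 1
  | .conj A B => A.size + B.size
  | .disj A B => A.size + B.size
/-! ### Arrow terms of the category PN -/

inductive Term (P : Type) : Form P → Form P → Type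
  | id (A : Form P) : Term P A A
  | comp {A B C : Form P} : Term P B C → Term P A B → Term P A C
  | conj {A B D E : Form P} : Term P A D → Term P B E → Term P (A ⋏ B) (D ⋏ E)
  | disj {A B D E : Form P} : Term P A D → Term P B E → Term P (A ⋎ B) (D ⋎ E)
  | bConjTo (A B C : Form P) : Term P (A ⋏ (B ⋏ C)) ((A ⋏ B) ⋏ C)
  | bConjFrom (A B C : Form P) : Term P ((A ⋏ B) ⋏ C) (A ⋏ (B ⋏ C))
  | bDisjTo (A B C : Form P) : Term P (A ⋎ (B ⋎ C)) ((A ⋎ B) ⋎ C)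
  | bDisjFrom (A B C : Form P) : Term P ((A ⋎ B) ⋎ C) (A ⋎ (B ⋎ C))
  | cConj (A B : Form P) : Term P (A ⋏ B) (B ⋏ A)
  | cDisj (A B : Form P) : Term P (B ⋎ A) (A ⋎ B)
  | d (A B C : Form P) : Term P (A ⋏ (B ⋎ C)) ((A ⋏ B) ⋎ C)
  | delta (p : P) (A : Form P) : Term P A (A ⋏ (Form.natom p ⋎ Form.pos p))
  | sigma (p : P) (A : Form P) : Term P ((Form.pos p ⋏ Form.natom p) ⋎ A) A

infixr:80 " ⬝ " => Term.comp
infixr:70 " ⊼ " => Term.conj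
infixr:66 " ⊽ " => Term.disj

/-- The arrow `d^R_{C,B,A} : (C∨B)∧A ⊢ C∨(B∧A)`. -/
def dR {P : Type} (C B A : Form P) : Term P ((C ⋎ B) ⋏ A) (C ⋎ (B ⋏ A)) :=
  Term.cDisj C (B ⋏ A) ⬝ ((Term.cConj A B ⊽ Term.id C) ⬝
    (Term.d A B C ⬝ ((Term.id A ⊼ Term.cDisj B C) ⬝ Term.cConj (C ⋎ B) A)))

/-- `Σ̂∧_{p,A} = ĉ∧ ∘ Δ̂∧_{p,A} : A ⊢ (¬p∨p)∧A`. -/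
def sigmaConj {P : Type} (p : P) (A : Form P) :
    Term P A ((Form.natom p ⋎ Form.pos p) ⋏ A) :=
  Term.cConj A (Form.natom p ⋎ Form.pos p) ⬝ Term.delta p A

/-- `Δ̂∨_{p,A} = Σ̂∨_{p,A} ∘ ĉ∨ : A∨(p∧¬p) ⊢ A`. -/
def deltaDisj {P : Type} (p : P) (A : Form P) :
    Term P (A ⋎ (Form.pos p ⋏ Form.natom p)) A :=
  Term.sigma p A ⬝ Term.cDisj (Form.pos p ⋏ Form.natom p) A

/-- `Δ̂∧′_{p,A} = (1_A ∧ ĉ∨) ∘ Δ̂∧_{p,A} : A ⊢ A∧(p∨¬p)`. -/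
def delta' {P : Type} (p : P) (A : Form P) :
    Term P A (A ⋏ (Form.pos p ⋎ Form.natom p)) :=
  (Term.id A ⊼ Term.cDisj (Form.pos p) (Form.natom p)) ⬝ Term.delta p A

/-- `Σ̂∨′_{p,A} = Σ̂∨_{p,A} ∘ (ĉ∧ ∨ 1_A) : (¬p∧p)∨A ⊢ A`. -/
def sigma' {P : Type} (p : P) (A : Form P) :
    Term P ((Form.natom p ⋏ Form.pos p) ⋎ A) A :=
  Term.sigma p A ⬝ (Term.cConj (Form.natom p) (Form.pos p) ⊽ Term.id A)

/-- `Σ̂∧′_{p,A} = ĉ∧ ∘ Δ̂∧′_{p,A} : A ⊢ (p∨¬p)∧A`. -/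
def sigmaConj' {P : Type} (p : P) (A : Form P) :
    Term P A ((Form.pos p ⋎ Form.natom p) ⋏ A) :=
  Term.cConj A (Form.pos p ⋎ Form.natom p) ⬝ delta' p A

/-- `Δ̂∨′_{p,A} = Σ̂∨′_{p,A} ∘ ĉ∨ : A∨(¬p∧p) ⊢ A`. -/
def deltaDisj' {P : Type} (p : P) (A : Form P) :
    Term P (A ⋎ (Form.natom p ⋏ Form.pos p)) A :=
  sigma' p A ⬝ Term.cDisj (Form.natom p ⋏ Form.pos p) A
/-! ### The equations of DS, imposed on arrow terms -/

inductive Eqv {P : Type} : ∀ {A B : Form P}, Term P A B → Term P A B → Prop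
  -- equivalence and congruence
  | refl {A B : Form P} (f : Term P A B) : Eqv f f
  | symm {A B : Form P} {f g : Term P A B} : Eqv f g → Eqv g f
  | trans {A B : Form P} {f g h : Term P A B} : Eqv f g → Eqv g h → Eqv f h
  | congComp {A B C : Form P} {g g' : Term P B C} {f f' : Term P A B} :
      Eqv g g' → Eqv f f' → Eqv (g ⬝ f) (g' ⬝ f')
  | congConj {A B D E : Form P} {f f' : Term P A D} {g g' : Term P B E} :
      Eqv f f' → Eqv g g' → Eqv (f ⊼ g) (f' ⊼ g')
  | congDisj {A B D E : Form P} {f f' : Term P A D} {g g' : Term P B E} :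
      Eqv f f' → Eqv g g' → Eqv (f ⊽ g) (f' ⊽ g')
  -- (cat 1), (cat 2)
  | catIdR {A B : Form P} (f : Term P A B) : Eqv (f ⬝ Term.id A) f
  | catIdL {A B : Form P} (f : Term P A B) : Eqv (Term.id B ⬝ f) f
  | catAssoc {A B C D : Form P} (f : Term P A B) (g : Term P B C) (h : Term P C D) :
      Eqv (h ⬝ (g ⬝ f)) ((h ⬝ g) ⬝ f)
  -- bifunctorial equations (ξ 1), (ξ 2)
  | conjOne (A B : Form P) : Eqv (Term.id A ⊼ Term.id B) (Term.id (A ⋏ B))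
  | disjOne (A B : Form P) : Eqv (Term.id A ⊽ Term.id B) (Term.id (A ⋎ B))
  | conjTwo {A₁ B₁ C₁ A₂ B₂ C₂ : Form P} (g₁ : Term P B₁ C₁) (f₁ : Term P A₁ B₁)
      (g₂ : Term P B₂ C₂) (f₂ : Term P A₂ B₂) :
      Eqv ((g₁ ⬝ f₁) ⊼ (g₂ ⬝ f₂)) ((g₁ ⊼ g₂) ⬝ (f₁ ⊼ f₂))
  | disjTwo {A₁ B₁ C₁ A₂ B₂ C₂ : Form P} (g₁ : Term P B₁ C₁) (f₁ : Term P A₁ B₁)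
      (g₂ : Term P B₂ C₂) (f₂ : Term P A₂ B₂) :
      Eqv ((g₁ ⬝ f₁) ⊽ (g₂ ⬝ f₂)) ((g₁ ⊽ g₂) ⬝ (f₁ ⊽ f₂))
  -- naturality equations
  | bConjNat {A B C D E F : Form P} (f : Term P A D) (g : Term P B E) (h : Term P C F) :
      Eqv (((f ⊼ g) ⊼ h) ⬝ Term.bConjTo A B C) (Term.bConjTo D E F ⬝ (f ⊼ (g ⊼ h)))
  | bDisjNat {A B C D E F : Form P} (f : Term P A D) (g : Term P B E) (h : Term P C F) :
      Eqv (((f ⊽ g) ⊽ h) ⬝ Term.bDisjTo A B C) (Term.bDisjTo D E F ⬝ (f ⊽ (g ⊽ h)))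
  | cConjNat {A B D E : Form P} (f : Term P A D) (g : Term P B E) :
      Eqv ((g ⊼ f) ⬝ Term.cConj A B) (Term.cConj D E ⬝ (f ⊼ g))
  | cDisjNat {A B D E : Form P} (f : Term P A D) (g : Term P B E) :
      Eqv ((g ⊽ f) ⬝ Term.cDisj B A) (Term.cDisj E D ⬝ (f ⊽ g))
  | dNat {A B C D E F : Form P} (f : Term P A D) (g : Term P B E) (h : Term P C F) :
      Eqv (((f ⊼ g) ⊽ h) ⬝ Term.d A B C) (Term.d D E F ⬝ (f ⊼ (g ⊽ h)))
  -- (b̂ξ b̂ξ)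
  | bConjIso₁ (A B C : Form P) :
      Eqv (Term.bConjFrom A B C ⬝ Term.bConjTo A B C) (Term.id (A ⋏ (B ⋏ C)))
  | bConjIso₂ (A B C : Form P) :
      Eqv (Term.bConjTo A B C ⬝ Term.bConjFrom A B C) (Term.id ((A ⋏ B) ⋏ C))
  | bDisjIso₁ (A B C : Form P) :
      Eqv (Term.bDisjFrom A B C ⬝ Term.bDisjTo A B C) (Term.id (A ⋎ (B ⋎ C)))
  | bDisjIso₂ (A B C : Form P) :
      Eqv (Term.bDisjTo A B C ⬝ Term.bDisjFrom A B C) (Term.id ((A ⋎ B) ⋎ C))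
  -- (b̂ξ 5)
  | bConjPent (A B C D : Form P) :
      Eqv (Term.bConjFrom A B (C ⋏ D) ⬝ Term.bConjFrom (A ⋏ B) C D)
        ((Term.id A ⊼ Term.bConjFrom B C D) ⬝
          (Term.bConjFrom A (B ⋏ C) D ⬝ (Term.bConjFrom A B C ⊼ Term.id D)))
  | bDisjPent (A B C D : Form P) :
      Eqv (Term.bDisjFrom A B (C ⋎ D) ⬝ Term.bDisjFrom (A ⋎ B) C D)
        ((Term.id A ⊽ Term.bDisjFrom B C D) ⬝
          (Term.bDisjFrom A (B ⋎ C) D ⬝ (Term.bDisjFrom A B C ⊽ Term.id D)))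
  -- (ĉ∧ ĉ∧), (ĉ∨ ĉ∨)
  | cConjIso (A B : Form P) : Eqv (Term.cConj B A ⬝ Term.cConj A B) (Term.id (A ⋏ B))
  | cDisjIso (A B : Form P) : Eqv (Term.cDisj A B ⬝ Term.cDisj B A) (Term.id (A ⋎ B))
  -- (b̂∧ ĉ∧), (b̂∨ ĉ∨)
  | bcConj (A B C : Form P) :
      Eqv ((Term.id B ⊼ Term.cConj C A) ⬝ (Term.bConjFrom B C A ⬝
            (Term.cConj A (B ⋏ C) ⬝ (Term.bConjFrom A B C ⬝ (Term.cConj B A ⊼ Term.id C)))))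
        (Term.bConjFrom B A C)
  | bcDisj (A B C : Form P) :
      Eqv ((Term.id B ⊽ Term.cDisj A C) ⬝ (Term.bDisjFrom B C A ⬝
            (Term.cDisj (B ⋎ C) A ⬝ (Term.bDisjFrom A B C ⬝ (Term.cDisj A B ⊽ Term.id C)))))
        (Term.bDisjFrom B A C)
  -- (d ∧), (d ∨)
  | dConj (A B C D : Form P) :
      Eqv ((Term.bConjFrom A B C ⊽ Term.id D) ⬝ Term.d (A ⋏ B) C D)
        (Term.d A (B ⋏ C) D ⬝ ((Term.id A ⊼ Term.d B C D) ⬝ Term.bConjFrom A B (C ⋎ D)))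
  | dDisj (D C B A : Form P) :
      Eqv (Term.d D C (B ⋎ A) ⬝ (Term.id D ⊼ Term.bDisjFrom C B A))
        (Term.bDisjFrom (D ⋏ C) B A ⬝ ((Term.d D C B ⊽ Term.id A) ⬝ Term.d D (C ⋎ B) A))
  -- (d b̂∧), (d b̂∨)
  | dBConj (A B C D : Form P) :
      Eqv (dR (A ⋏ B) C D ⬝ (Term.d A B C ⊼ Term.id D))
        (Term.d A B (C ⋏ D) ⬝ ((Term.id A ⊼ dR B C D) ⬝ Term.bConjFrom A (B ⋎ C) D))
  | dBDisj (D C B A : Form P) :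
      Eqv ((Term.id D ⊽ Term.d C B A) ⬝ dR D C (B ⋎ A))
        (Term.bDisjFrom D (C ⋏ B) A ⬝ ((dR D C B ⊽ Term.id A) ⬝ Term.d (D ⋎ C) B A))
  -- (Δ̂∧ nat)
  | deltaNat {A D : Form P} (p : P) (f : Term P A D) :
      Eqv ((f ⊼ Term.id (Form.natom p ⋎ Form.pos p)) ⬝ Term.delta p A) (Term.delta p D ⬝ f)
  -- (Σ̂∨ nat)
  | sigmaNat {A D : Form P} (p : P) (f : Term P A D) :
      Eqv (f ⬝ Term.sigma p A) (Term.sigma p D ⬝ (Term.id (Form.pos p ⋏ Form.natom p) ⊽ f))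
  -- (b̂∧ Δ̂∧)
  | bDelta (A B : Form P) (p : P) :
      Eqv (Term.bConjFrom A B (Form.natom p ⋎ Form.pos p) ⬝ Term.delta p (A ⋏ B))
        (Term.id A ⊼ Term.delta p B)
  -- (b̂∨ Σ̂∨)
  | bSigma (p : P) (B A : Form P) :
      Eqv (Term.sigma p (B ⋎ A) ⬝ Term.bDisjFrom (Form.pos p ⋏ Form.natom p) B A)
        (Term.sigma p B ⊽ Term.id A)
  -- (d Σ̂∧)
  | dSigmaConj (p : P) (B C : Form P) :
      Eqv (Term.d (Form.natom p ⋎ Form.pos p) B C ⬝ sigmaConj p (B ⋎ C))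
        (sigmaConj p B ⊽ Term.id C)
  -- (d Δ̂∨)
  | dDeltaDisj (p : P) (C B : Form P) :
      Eqv (deltaDisj p (C ⋏ B) ⬝ Term.d C B (Form.pos p ⋏ Form.natom p))
        (Term.id C ⊼ deltaDisj p B)
  -- (Σ̂∨ Δ̂∧)
  | sigmaDelta (p : P) :
      Eqv (Term.sigma p (Form.pos p) ⬝
            (Term.d (Form.pos p) (Form.natom p) (Form.pos p) ⬝ Term.delta p (Form.pos p)))
        (Term.id (Form.pos p))
  -- (Σ̂∨′ Δ̂∧′)
  | sigmaDelta' (p : P) :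
      Eqv (sigma' p (Form.natom p) ⬝
            (Term.d (Form.natom p) (Form.pos p) (Form.natom p) ⬝ delta' p (Form.natom p)))
        (Term.id (Form.natom p))
/-- The functor `G` from DS to Br on arrow terms. -/
def Term.G {P : Type} : ∀ {A B : Form P}, Term P A B → GRel
  | _, _, .id A => gId A.size
  | _, _, .comp g f => gComp (Term.G g) (Term.G f)
  | _, _, @Term.conj _ A _ D _ f g => gPar A.size D.size (Term.G f) (Term.G g)
  | _, _, @Term.disj _ A _ D _ f g => gPar A.size D.size (Term.G f) (Term.G g)
  | _, _, .bConjTo A B C => gId (A.size + (B.size + C.size))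
  | _, _, .bConjFrom A B C => gId (A.size + B.size + C.size)
  | _, _, .bDisjTo A B C => gId (A.size + (B.size + C.size))
  | _, _, .bDisjFrom A B C => gId (A.size + B.size + C.size)
  | _, _, .cConj A B => gSwap A.size B.size
  | _, _, .cDisj A B => gSwap B.size A.size
  | _, _, .d A B C => gId (A.size + (B.size + C.size))
  | _, _, .delta _ A => gDelta A.size 1
  | _, _, .sigma _ A => gSigma A.size 1
/-! ### Occurrences of letters and subformula occurrences in L∧,∨^{¬p} -/

/-- The letter (element of `P ∪ P¬`, as an atomic formula) at the `(n+1)`-th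
letter-occurrence position of a formula. -/
def Form.letterAt {P : Type} : Form P → ℕ → Option (Form P)
  | .pos p, 0 => some (.pos p)
  | .pos _, _ + 1 => none
  | .natom p, 0 => some (.natom p)
  | .natom _, _ + 1 => none
  | .conj A B, n => if n < A.size then A.letterAt n else B.letterAt (n - A.size)
  | .disj A B, n => if n < A.size then A.letterAt n else B.letterAt (n - A.size)

/-- Directions for addressing subformula occurrences. -/
inductive Dir : Type
  | l
  | r
deriving DecidableEq

/-- The subformula occurrence of a formula at a given position (path). -/
def Form.subAt {P : Type} : Form P → List Dir → Option (Form P)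
  | A, [] => some A
  | .conj A _, .l :: π => A.subAt π
  | .conj _ B, .r :: π => B.subAt π
  | .disj A _, .l :: π => A.subAt π
  | .disj _ B, .r :: π => B.subAt π
  | .pos _, _ :: _ => none
  | .natom _, _ :: _ => none

/-- The number of letter occurrences strictly to the left of the subformula
occurrence at a given position. -/
def Form.offsetAt {P : Type} : Form P → List Dir → ℕ
  | _, [] => 0
  | .conj A _, .l :: π => A.offsetAt π
  | .conj A B, .r :: π => A.size + B.offsetAt π
  | .disj A _, .l :: π => A.offsetAt π
  | .disj A B, .r :: π => A.size + B.offsetAt π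
  | .pos _, _ :: _ => 0
  | .natom _, _ :: _ => 0

/-- The `(n+1)`-th occurrence of a letter in `A` is *linked* in `f : A ⊢ B` to the
`(m+1)`-th occurrence of the same letter in `B` when `{n_s, m_t}` belongs to the
partition corresponding to `Gf`. -/
def Linked {P : Type} {A B : Form P} (f : Term P A B) (n m : ℕ) : Prop :=
  Term.G f (Sum.inl n) (Sum.inr m)

/-- `f` is an arrow term of DS^{¬p}: it contains none of the primitive arrow
terms `Δ̂∧` and `Σ̂∨`. -/
def IsDSTerm {P : Type} : ∀ {A B : Form P}, Term P A B → Prop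
  | _, _, .delta _ _ => False
  | _, _, .sigma _ _ => False
  | _, _, .comp g f => IsDSTerm g ∧ IsDSTerm f
  | _, _, .conj f g => IsDSTerm f ∧ IsDSTerm g
  | _, _, .disj f g => IsDSTerm f ∧ IsDSTerm g
  | _, _, _ => True
/-! ### Ξ̂∧-terms and Θ̂∨-terms, with the positions and the path of the crown -/

/-- `IsXiConjTerm p g kp kn cp` says that `g` is a `Ξ̂∧_{p,B}`-term (a β-term whose
head is one of `Δ̂∧_{p,B}`, `Δ̂∧′_{p,B}`, `Σ̂∧_{p,B}`, `Σ̂∧′_{p,B}`), that within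
the *target* of `g` the occurrence of `p` in the crown of the head has position
`kp` and the occurrence of `¬p` has position `kn` (0-based, among letter
occurrences), and that the crown of the head is the subformula occurrence of the
target of `g` at the path `cp`. -/
inductive IsXiConjTerm {P : Type} (p : P) :
    ∀ {A B : Form P}, Term P A B → ℕ → ℕ → List Dir → Prop
  | delta (B : Form P) :
      IsXiConjTerm p (Term.delta p B) (B.size + 1) B.size [Dir.r]
  | delta' (B : Form P) :
      IsXiConjTerm p (delta' p B) B.size (B.size + 1) [Dir.r]
  | sigmaConj (B : Form P) :
      IsXiConjTerm p (sigmaConj p B) 1 0 [Dir.l]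
  | sigmaConj' (B : Form P) :
      IsXiConjTerm p (sigmaConj' p B) 0 1 [Dir.l]
  | conjL (A : Form P) {C D : Form P} {g : Term P C D} {kp kn : ℕ} {cp : List Dir} :
      IsXiConjTerm p g kp kn cp →
      IsXiConjTerm p (Term.id A ⊼ g) (A.size + kp) (A.size + kn) (Dir.r :: cp)
  | conjR (A : Form P) {C D : Form P} {g : Term P C D} {kp kn : ℕ} {cp : List Dir} :
      IsXiConjTerm p g kp kn cp →
      IsXiConjTerm p (g ⊼ Term.id A) kp kn (Dir.l :: cp)
  | disjL (A : Form P) {C D : Form P} {g : Term P C D} {kp kn : ℕ} {cp : List Dir} :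
      IsXiConjTerm p g kp kn cp →
      IsXiConjTerm p (Term.id A ⊽ g) (A.size + kp) (A.size + kn) (Dir.r :: cp)
  | disjR (A : Form P) {C D : Form P} {g : Term P C D} {kp kn : ℕ} {cp : List Dir} :
      IsXiConjTerm p g kp kn cp →
      IsXiConjTerm p (g ⊽ Term.id A) kp kn (Dir.l :: cp)

/-- `IsThetaDisjTerm p g kp kn cp` says that `g` is a `Θ̂∨_{p,B}`-term (a β-term
whose head is one of `Σ̂∨_{p,B}`, `Σ̂∨′_{p,B}`, `Δ̂∨_{p,B}`, `Δ̂∨′_{p,B}`), that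
within the *source* of `g` the occurrence of `p` in the crown of the head has
position `kp` and the occurrence of `¬p` has position `kn`, and that the crown of
the head is the subformula occurrence of the source of `g` at the path `cp`. -/
inductive IsThetaDisjTerm {P : Type} (p : P) :
    ∀ {A B : Form P}, Term P A B → ℕ → ℕ → List Dir → Prop
  | sigma (B : Form P) :
      IsThetaDisjTerm p (Term.sigma p B) 0 1 [Dir.l]
  | sigma' (B : Form P) :
      IsThetaDisjTerm p (sigma' p B) 1 0 [Dir.l]
  | deltaDisj (B : Form P) :
      IsThetaDisjTerm p (deltaDisj p B) B.size (B.size + 1) [Dir.r]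
  | deltaDisj' (B : Form P) :
      IsThetaDisjTerm p (deltaDisj' p B) (B.size + 1) B.size [Dir.r]
  | conjL (A : Form P) {C D : Form P} {g : Term P C D} {kp kn : ℕ} {cp : List Dir} :
      IsThetaDisjTerm p g kp kn cp →
      IsThetaDisjTerm p (Term.id A ⊼ g) (A.size + kp) (A.size + kn) (Dir.r :: cp)
  | conjR (A : Form P) {C D : Form P} {g : Term P C D} {kp kn : ℕ} {cp : List Dir} :
      IsThetaDisjTerm p g kp kn cp →
      IsThetaDisjTerm p (g ⊼ Term.id A) kp kn (Dir.l :: cp)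
  | disjL (A : Form P) {C D : Form P} {g : Term P C D} {kp kn : ℕ} {cp : List Dir} :
      IsThetaDisjTerm p g kp kn cp →
      IsThetaDisjTerm p (Term.id A ⊽ g) (A.size + kp) (A.size + kn) (Dir.r :: cp)
  | disjR (A : Form P) {C D : Form P} {g : Term P C D} {kp kn : ℕ} {cp : List Dir} :
      IsThetaDisjTerm p g kp kn cp →
      IsThetaDisjTerm p (g ⊽ Term.id A) kp kn (Dir.l :: cp)



namespace PNL

open CategoryTheory

/-! ### PN as a category: arrows are classes of arrow terms modulo `Eqv` -/

section Cat
variable {P : Type}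

instance homSetoid (A B : Form P) : Setoid (Term P A B) where
  r := Eqv
  iseqv := ⟨Eqv.refl, Eqv.symm, Eqv.trans⟩

instance formCat : Category (Form P) where
  Hom A B := Quotient (homSetoid A B)
  id A := Quotient.mk _ (Term.id A)
  comp f g := Quotient.map₂ (fun f g => g ⬝ f) (fun _ _ h₁ _ _ h₂ => Eqv.congComp h₂ h₁) f g
  id_comp f := by
    induction f using Quotient.inductionOn with | _ f => exact Quotient.sound (Eqv.catIdR f)
  comp_id f := by
    induction f using Quotient.inductionOn with | _ f => exact Quotient.sound (Eqv.catIdL f)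
  assoc f g h := by
    induction f using Quotient.inductionOn with | _ f =>
    induction g using Quotient.inductionOn with | _ g =>
    induction h using Quotient.inductionOn with | _ h =>
    exact Quotient.sound (Eqv.catAssoc f g h)

/-- The arrow of PN denoted by an arrow term. -/
def cl {A B : Form P} (f : Term P A B) : A ⟶ B := Quotient.mk (homSetoid A B) f

theorem cl_eq {A B : Form P} {f g : Term P A B} (h : Eqv f g) : cl f = cl g := Quotient.sound h

theorem cl_exact {A B : Form P} {f g : Term P A B} (h : cl f = cl g) : Eqv f g :=
  Quotient.exact h

theorem cl_comp {A B C : Form P} (f : Term P A B) (g : Term P B C) :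
    cl (g ⬝ f) = cl f ≫ cl g := rfl

theorem cl_id (A : Form P) : cl (Term.id A) = 𝟙 A := rfl

theorem cl_ind {A B : Form P} {motive : (A ⟶ B) → Prop} (h : ∀ f, motive (cl f)) (f : A ⟶ B) :
    motive f := Quotient.inductionOn f h

def cm {A B D E : Form P} (f : A ⟶ D) (g : B ⟶ E) : (A ⋏ B) ⟶ (D ⋏ E) :=
  Quotient.map₂ (fun f g => f ⊼ g) (fun _ _ h₁ _ _ h₂ => Eqv.congConj h₁ h₂) f g

def dm {A B D E : Form P} (f : A ⟶ D) (g : B ⟶ E) : (A ⋎ B) ⟶ (D ⋎ E) :=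
  Quotient.map₂ (fun f g => f ⊽ g) (fun _ _ h₁ _ _ h₂ => Eqv.congDisj h₁ h₂) f g

theorem cl_conj {A B D E : Form P} (f : Term P A D) (g : Term P B E) :
    cl (f ⊼ g) = cm (cl f) (cl g) := rfl

theorem cl_disj {A B D E : Form P} (f : Term P A D) (g : Term P B E) :
    cl (f ⊽ g) = dm (cl f) (cl g) := rfl

/-- A symmetric semigroupal (monoidal without unit) structure on formulae. -/
structure Sym (P : Type) (t : Form P → Form P → Form P) where
  m : ∀ {A B D E : Form P}, (A ⟶ D) → (B ⟶ E) → (t A B ⟶ t D E)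
  a : ∀ A B C : Form P, t A (t B C) ⟶ t (t A B) C
  a' : ∀ A B C : Form P, t (t A B) C ⟶ t A (t B C)
  c : ∀ A B : Form P, t A B ⟶ t B A
  m_id : ∀ A B, m (𝟙 A) (𝟙 B) = 𝟙 (t A B)
  m_comp : ∀ {A B D E G H : Form P} (f : A ⟶ D) (g : B ⟶ E) (f' : D ⟶ G) (g' : E ⟶ H),
    m f g ≫ m f' g' = m (f ≫ f') (g ≫ g')
  a_nat : ∀ {A B C D E F : Form P} (f : A ⟶ D) (g : B ⟶ E) (h : C ⟶ F),
    a A B C ≫ m (m f g) h = m f (m g h) ≫ a D E F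
  c_nat : ∀ {A B D E : Form P} (f : A ⟶ D) (g : B ⟶ E), c A B ≫ m g f = m f g ≫ c D E
  aa' : ∀ A B C, a A B C ≫ a' A B C = 𝟙 _
  a'a : ∀ A B C, a' A B C ≫ a A B C = 𝟙 _
  cc : ∀ A B, c A B ≫ c B A = 𝟙 _
  pent' : ∀ A B C D, a' (t A B) C D ≫ a' A B (t C D) =
    m (a' A B C) (𝟙 D) ≫ a' A (t B C) D ≫ m (𝟙 A) (a' B C D)
  hex' : ∀ A B C, m (c B A) (𝟙 C) ≫ a' A B C ≫ c A (t B C) ≫ a' B C A ≫ m (𝟙 B) (c C A) =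
    a' B A C

def conjS (P : Type) : Sym P Form.conj where
  m f g := cm f g
  a A B C := cl (Term.bConjTo A B C)
  a' A B C := cl (Term.bConjFrom A B C)
  c A B := cl (Term.cConj A B)
  m_id A B := cl_eq (Eqv.conjOne A B)
  m_comp f g f' g' := by
    induction f using cl_ind; induction g using cl_ind
    induction f' using cl_ind; induction g' using cl_ind
    exact cl_eq (Eqv.symm (Eqv.conjTwo _ _ _ _))
  a_nat f g h := by
    induction f using cl_ind; induction g using cl_ind; induction h using cl_ind
    exact cl_eq (Eqv.bConjNat _ _ _)
  c_nat f g := by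
    induction f using cl_ind; induction g using cl_ind
    exact cl_eq (Eqv.cConjNat _ _)
  aa' A B C := cl_eq (Eqv.bConjIso₁ A B C)
  a'a A B C := cl_eq (Eqv.bConjIso₂ A B C)
  cc A B := cl_eq (Eqv.cConjIso A B)
  pent' A B C D := by
    simp only [← cl_comp, ← cl_id, ← cl_conj]
    simpa [cl_comp] using cl_eq (Eqv.bConjPent A B C D)
  hex' A B C := by
    simp only [← cl_comp, ← cl_id, ← cl_conj]
    simpa [cl_comp] using cl_eq (Eqv.bcConj A B C)

def disjS (P : Type) : Sym P Form.disj where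
  m f g := dm f g
  a A B C := cl (Term.bDisjTo A B C)
  a' A B C := cl (Term.bDisjFrom A B C)
  c A B := cl (Term.cDisj B A)
  m_id A B := cl_eq (Eqv.disjOne A B)
  m_comp f g f' g' := by
    induction f using cl_ind; induction g using cl_ind
    induction f' using cl_ind; induction g' using cl_ind
    exact cl_eq (Eqv.symm (Eqv.disjTwo _ _ _ _))
  a_nat f g h := by
    induction f using cl_ind; induction g using cl_ind; induction h using cl_ind
    exact cl_eq (Eqv.bDisjNat _ _ _)
  c_nat f g := by
    induction f using cl_ind; induction g using cl_ind
    exact cl_eq (Eqv.cDisjNat _ _)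
  aa' A B C := cl_eq (Eqv.bDisjIso₁ A B C)
  a'a A B C := cl_eq (Eqv.bDisjIso₂ A B C)
  cc A B := cl_eq (Eqv.cDisjIso A B)
  pent' A B C D := by
    simp only [← cl_comp, ← cl_id, ← cl_disj]
    simpa [cl_comp] using cl_eq (Eqv.bDisjPent A B C D)
  hex' A B C := by
    simp only [← cl_comp, ← cl_id, ← cl_disj]
    simpa [cl_comp] using cl_eq (Eqv.bcDisj A B C)

end Cat
end PNL


namespace PNL

open CategoryTheory

section Alg
variable {P : Type}

namespace Sym
variable {t : Form P → Form P → Form P} (S : Sym P t)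

theorem m_left {A B C D : Form P} (f : A ⟶ B) (g : B ⟶ C) :
    S.m (f ≫ g) (𝟙 D) = S.m f (𝟙 D) ≫ S.m g (𝟙 D) := by simp [S.m_comp]

theorem m_right {A B C D : Form P} (f : A ⟶ B) (g : B ⟶ C) :
    S.m (𝟙 D) (f ≫ g) = S.m (𝟙 D) f ≫ S.m (𝟙 D) g := by simp [S.m_comp]

theorem cc_assoc {A B C : Form P} (h : t A B ⟶ C) : S.c A B ≫ S.c B A ≫ h = h := by
  rw [← Category.assoc, S.cc, Category.id_comp]

theorem aa'_assoc {A B C D : Form P} (h : t A (t B C) ⟶ D) : S.a A B C ≫ S.a' A B C ≫ h = h := by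
  rw [← Category.assoc, S.aa', Category.id_comp]

theorem a'a_assoc {A B C D : Form P} (h : t (t A B) C ⟶ D) : S.a' A B C ≫ S.a A B C ≫ h = h := by
  rw [← Category.assoc, S.a'a, Category.id_comp]

theorem cR_cR (A B C : Form P) : S.m (S.c A B) (𝟙 C) ≫ S.m (S.c B A) (𝟙 C) = 𝟙 _ := by
  rw [S.m_comp, S.cc, Category.id_comp, S.m_id]

theorem cL_cL (A B C : Form P) : S.m (𝟙 C) (S.c A B) ≫ S.m (𝟙 C) (S.c B A) = 𝟙 _ := by
  rw [S.m_comp, S.cc, Category.id_comp, S.m_id]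

theorem a'_nat {A B C D E F : Form P} (f : A ⟶ D) (g : B ⟶ E) (h : C ⟶ F) :
    S.a' A B C ≫ S.m f (S.m g h) = S.m (S.m f g) h ≫ S.a' D E F := by
  calc _ = S.a' A B C ≫ (S.m f (S.m g h) ≫ S.a D E F) ≫ S.a' D E F := by
        rw [Category.assoc, S.aa', Category.comp_id]
    _ = _ := by rw [← S.a_nat, Category.assoc, S.a'a_assoc]

theorem pent (A B C D : Form P) :
    S.a A B (t C D) ≫ S.a (t A B) C D =
      S.m (𝟙 A) (S.a B C D) ≫ S.a A (t B C) D ≫ S.m (S.a A B C) (𝟙 D) := by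
  have h := S.pent' A B C D
  have h2 : (S.a A B (t C D) ≫ S.a (t A B) C D) ≫
      (S.a' (t A B) C D ≫ S.a' A B (t C D)) = 𝟙 _ := by
    simp [S.aa', S.aa'_assoc]
  have h3 : (S.m (S.a' A B C) (𝟙 D) ≫ S.a' A (t B C) D ≫ S.m (𝟙 A) (S.a' B C D)) ≫
      (S.m (𝟙 A) (S.a B C D) ≫ S.a A (t B C) D ≫ S.m (S.a A B C) (𝟙 D)) = 𝟙 _ := by
    simp only [Category.assoc]
    rw [← Category.assoc (S.m (𝟙 A) (S.a' B C D)), S.m_comp, S.a'a, Category.id_comp, S.m_id,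
      Category.id_comp, S.a'a_assoc, S.m_comp, S.a'a, Category.id_comp, S.m_id]
  calc _ = (S.a A B (t C D) ≫ S.a (t A B) C D) ≫
      (S.a' (t A B) C D ≫ S.a' A B (t C D)) ≫ _ := by rw [h, h3, Category.comp_id]
    _ = _ := by rw [← Category.assoc, h2, Category.id_comp]

theorem hex (A B C : Form P) : S.a' A B C ≫ S.c A (t B C) ≫ S.a' B C A =
    S.m (S.c A B) (𝟙 C) ≫ S.a' B A C ≫ S.m (𝟙 B) (S.c A C) := by
  rw [← S.hex' A B C]
  simp only [Category.assoc]
  rw [S.cL_cL, Category.comp_id, ← Category.assoc (S.m (S.c A B) (𝟙 C)), S.cR_cR,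
    Category.id_comp]

/-- G1 -/
theorem g1 (A C X : Form P) : S.m (𝟙 A) (S.c C X) ≫ S.a A X C =
    S.a A C X ≫ S.m (S.c A C) (𝟙 X) ≫ S.a' C A X ≫ S.c C (t A X) := by
  have h := S.hex C A X
  have h2 : S.m (S.c A C) (𝟙 X) ≫ (S.a' C A X ≫ S.c C (t A X) ≫ S.a' A X C) ≫ S.a A X C
      = S.m (S.c A C) (𝟙 X) ≫ S.a' C A X ≫ S.c C (t A X) := by
    simp [S.a'a]
  rw [← h2, h]
  simp only [Category.assoc]
  rw [← Category.assoc (S.m (S.c A C) (𝟙 X)), S.cR_cR, Category.id_comp, S.aa'_assoc]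

/-- G2 -/
theorem g2 (B C X : Form P) : S.c (t B C) X ≫ S.a X B C =
    S.m (S.c B C) (𝟙 X) ≫ S.a' C B X ≫ S.m (𝟙 C) (S.c B X) ≫ S.c C (t X B) := by
  have h := S.hex X B C
  have h1 := S.g1 B C X
  have e : S.c (t B C) X ≫ S.a X B C =
      S.a' B C X ≫ S.m (𝟙 B) (S.c C X) ≫ S.a B X C ≫ S.m (S.c B X) (𝟙 C) := by
    have h2 : (S.c (t B C) X ≫ S.a X B C) ≫ (S.a' X B C ≫ S.c X (t B C) ≫ S.a' B C X) =
       S.a' B C X := by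
      simp [S.aa'_assoc, S.cc_assoc]
    rw [← h2, h]
    simp only [Category.assoc]
    rw [← Category.assoc (S.m (𝟙 B) (S.c X C)), S.cL_cL, Category.id_comp, S.a'a_assoc, S.cR_cR,
      Category.comp_id]
  rw [e, reassoc_of% h1, S.a'a_assoc, S.c_nat]

/-- the exchange of the first two of three iso -/
def b (F X W : Form P) : t F (t X W) ⟶ t X (t F W) :=
  S.m (𝟙 F) (S.c X W) ≫ S.a F W X ≫ S.c (t F W) X

theorem b_eq (F X W : Form P) : S.b F X W =
    S.a F X W ≫ S.m (S.c F X) (𝟙 W) ≫ S.a' X F W := by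
  unfold b
  rw [← Category.assoc, S.g1]
  simp [S.cc]

theorem b_b (F X W : Form P) : S.b F X W ≫ S.b X F W = 𝟙 _ := by
  rw [S.b_eq, S.b_eq]
  simp only [Category.assoc]
  rw [S.a'a_assoc, ← Category.assoc (S.m (S.c F X) (𝟙 W)), S.cR_cR, Category.id_comp, S.aa']

/-- T1 -/
theorem t1 (V X G : Form P) :
    S.a V X G ≫ S.m (S.c V X) (𝟙 G) ≫ S.c (t X V) G ≫ S.a G X V =
      S.m (𝟙 V) (S.c X G) ≫ S.c V (t G X) := by
  have h := S.g2 X V G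
  rw [h]
  rw [← Category.assoc (S.m (S.c V X) (𝟙 G)), S.cR_cR, Category.id_comp, S.aa'_assoc]

/-- T2 -/
theorem t2 (G X W : Form P) :
    S.c G (t X W) ≫ S.m (S.c X W) (𝟙 G) ≫ S.a' W X G =
      S.a G X W ≫ S.c (t G X) W ≫ S.m (𝟙 W) (S.c G X) := by
  have h := S.t1 W X G
  have h2 : (S.c G (t X W) ≫ S.m (S.c X W) (𝟙 G) ≫ S.a' W X G) ≫
     (S.a W X G ≫ S.m (S.c W X) (𝟙 G) ≫ S.c (t X W) G ≫ S.a G X W) = S.a G X W := by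
    simp only [Category.assoc]
    rw [S.a'a_assoc, ← Category.assoc (S.m (S.c X W) (𝟙 G)), S.cR_cR, Category.id_comp, S.cc_assoc]
  rw [h] at h2
  rw [← h2]
  simp only [Category.assoc]
  rw [S.cc_assoc, S.cL_cL, Category.comp_id]

end Sym

inductive Kd | con | dis

abbrev op (k : Kd) : Form P → Form P → Form P :=
  match k with
  | .con => Form.conj
  | .dis => Form.disj

def SS (k : Kd) : Sym P (op k) :=
  match k with
  | .con => conjS P
  | .dis => disjS P

/-- Arrows of PN that are denoted by arrow terms of DS. -/
def IsDS {A B : Form P} (f : A ⟶ B) : Prop := ∃ t : Term P A B, IsDSTerm t ∧ cl t = f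

theorem IsDS.id (A : Form P) : IsDS (𝟙 A) := ⟨Term.id A, trivial, rfl⟩

theorem IsDS.comp {A B C : Form P} {f : A ⟶ B} {g : B ⟶ C} (hf : IsDS f) (hg : IsDS g) :
    IsDS (f ≫ g) := by
  obtain ⟨s, hs, rfl⟩ := hf
  obtain ⟨t, ht, rfl⟩ := hg
  exact ⟨t ⬝ s, ⟨ht, hs⟩, rfl⟩

theorem IsDS.m (k : Kd) {A B C D : Form P} {f : A ⟶ B} {g : C ⟶ D} (hf : IsDS f) (hg : IsDS g) :
    IsDS ((SS k).m f g) := by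
  obtain ⟨s, hs, rfl⟩ := hf
  obtain ⟨t, ht, rfl⟩ := hg
  cases k
  · exact ⟨s ⊼ t, ⟨hs, ht⟩, rfl⟩
  · exact ⟨s ⊽ t, ⟨hs, ht⟩, rfl⟩

theorem IsDS.a (k : Kd) (A B C : Form P) : IsDS ((SS k).a A B C) := by
  cases k
  · exact ⟨Term.bConjTo A B C, trivial, rfl⟩
  · exact ⟨Term.bDisjTo A B C, trivial, rfl⟩

theorem IsDS.a' (k : Kd) (A B C : Form P) : IsDS ((SS k).a' A B C) := by
  cases k
  · exact ⟨Term.bConjFrom A B C, trivial, rfl⟩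
  · exact ⟨Term.bDisjFrom A B C, trivial, rfl⟩

theorem IsDS.c (k : Kd) (A B : Form P) : IsDS ((SS k).c A B) := by
  cases k
  · exact ⟨Term.cConj A B, trivial, rfl⟩
  · exact ⟨Term.cDisj B A, trivial, rfl⟩

/-- left layers -/
notation "lm" k:max F:max f:max => Sym.m (SS k) (𝟙 F) f
notation "dj" => Sym.m (SS Kd.dis)
notation "dc" => Sym.c (SS Kd.dis)
notation "da" => Sym.a (SS Kd.dis)
notation "db" => Sym.a' (SS Kd.dis)
notation "cj" => Sym.m (SS Kd.con)
notation "cs" => Sym.c (SS Kd.con)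
notation "ca" => Sym.a (SS Kd.con)
notation "cb" => Sym.a' (SS Kd.con)

/-- the strength of a layer -/
def st (k : Kd) (F X W : Form P) : op k F (X ⋎ W) ⟶ op k F X ⋎ W :=
  match k with
  | .con => cl (Term.d F X W)
  | .dis => da F X W

def st' (k : Kd) (F X W : Form P) : op k F (X ⋎ W) ⟶ X ⋎ op k F W :=
  lm k F (dc X W) ≫ st k F W X ≫ dc (op k F W) X

/-- `d^R` -/
def dr (C B A : Form P) : (C ⋎ B) ⋏ A ⟶ C ⋎ (B ⋏ A) := cl (dR C B A)

theorem IsDS.st (k : Kd) (F X W : Form P) : IsDS (st k F X W) := by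
  cases k
  · exact ⟨Term.d F X W, trivial, rfl⟩
  · exact IsDS.a .dis _ _ _

theorem IsDS.ly (k : Kd) (F : Form P) {X Y : Form P} {f : X ⟶ Y} (h : IsDS f) : IsDS (lm k F f) :=
  IsDS.m k (IsDS.id F) h

theorem IsDS.st' (k : Kd) (F X W : Form P) : IsDS (st' k F X W) :=
  .comp (.ly _ _ (.c .dis _ _)) (.comp (.st _ _ _ _) (.c .dis _ _))

theorem IsDS.dr (C B A : Form P) : IsDS (dr C B A) :=
  ⟨dR C B A, by simp [dR, IsDSTerm], rfl⟩

theorem lm_comp (k : Kd) (F : Form P) {X Y Z : Form P} (f : X ⟶ Y) (g : Y ⟶ Z) :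
    lm k F (f ≫ g) = lm k F f ≫ lm k F g := Sym.m_right _ _ _

theorem lm_id (k : Kd) (F X : Form P) : lm k F (𝟙 X) = 𝟙 _ := (SS k).m_id _ _

theorem st_natF (k : Kd) {F F' X X' W W' : Form P} (e : F ⟶ F') (f : X ⟶ X') (g : W ⟶ W') :
    st k F X W ≫ dj ((SS k).m e f) g = (SS k).m e (dj f g) ≫ st k F' X' W' := by
  cases k
  · induction e using cl_ind; induction f using cl_ind; induction g using cl_ind
    exact cl_eq (Eqv.dNat _ _ _)
  · exact (SS .dis).a_nat _ _ _

theorem st_nat (k : Kd) (F : Form P) {X X' W W' : Form P} (f : X ⟶ X') (g : W ⟶ W') :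
    st k F X W ≫ dj (lm k F f) g = lm k F (dj f g) ≫ st k F X' W' := st_natF k _ _ _

theorem st'_natF (k : Kd) {F F' X X' W W' : Form P} (e : F ⟶ F') (f : X ⟶ X') (g : W ⟶ W') :
    st' k F X W ≫ dj f ((SS k).m e g) = (SS k).m e (dj f g) ≫ st' k F' X' W' := by
  unfold st'
  simp only [Category.assoc]
  rw [(SS .dis).c_nat, ← Category.assoc (st k F W X), st_natF]
  simp only [← Category.assoc]
  rw [(SS k).m_comp, (SS .dis).c_nat, (SS k).m_comp]
  simp

theorem st'_nat (k : Kd) (F : Form P) {X X' W W' : Form P} (f : X ⟶ X') (g : W ⟶ W') :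
    st' k F X W ≫ dj f (lm k F g) = lm k F (dj f g) ≫ st' k F X' W' := st'_natF k _ _ _

/-- strength and associativity -/
theorem st_d6 (k : Kd) (F G X W : Form P) :
    lm k F (da G X W) ≫ st k F (G ⋎ X) W ≫ dj (st k F G X) (𝟙 W) =
      st k F G (X ⋎ W) ≫ da (op k F G) X W := by
  cases k
  · have h := cl_eq (Eqv.dDisj F G X W)
    have h' : lm Kd.con F (db G X W) ≫ st .con F G (X ⋎ W) =
      (st .con F (G ⋎ X) W ≫ dj (st .con F G X) (𝟙 W)) ≫ db (F ⋏ G) X W := h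
    have := congrArg (fun z => lm Kd.con F (da G X W) ≫ z ≫ da (F ⋏ G) X W) h'
    simp only [Category.assoc] at this
    rw [(SS .dis).a'a, ← Category.assoc, ← lm_comp, (SS .dis).aa', lm_id] at this
    simpa using this.symm
  · exact ((SS .dis).pent F G X W).symm

theorem st_dc (k : Kd) (F X W : Form P) : lm k F (dc X W) ≫ st k F W X =
    st' k F X W ≫ dc _ _ := by
  unfold st'; simp [(SS Kd.dis).cc]

theorem st'_dc (k : Kd) (F X W : Form P) : lm k F (dc X W) ≫ st' k F W X =
    st k F X W ≫ dc _ _ := by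
  unfold st'; rw [← Category.assoc, ← lm_comp, (SS Kd.dis).cc, lm_id, Category.id_comp]

theorem e1 (k : Kd) (F G X W : Form P) :
    lm k F (da G X W) ≫ st' k F (G ⋎ X) W =
      st' k F G (X ⋎ W) ≫ dj (𝟙 G) (st' k F X W) ≫ da G X (op k F W) := by
  have h6 := st_d6 k F W X G
  have h6' : st k F (W ⋎ X) G ≫ dj (st k F W X) (𝟙 G) =
      lm k F (db W X G) ≫ st k F W (X ⋎ G) ≫ da (op k F W) X G := by
    rw [← h6, ← Category.assoc (lm k F (_)), ← lm_comp, (SS Kd.dis).a'a, lm_id, Category.id_comp]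
  have hn := (SS Kd.dis).c_nat (st' k F X W) (𝟙 G)
  conv_rhs => rw [st']
  simp only [Category.assoc]
  rw [← Category.assoc (dc _ G), (SS Kd.dis).c_nat]
  conv_rhs => rw [st']
  rw [Sym.m_left, Sym.m_left]
  simp only [Category.assoc]
  rw [← Category.assoc (st k F (X ⋎ W) G), st_nat, Category.assoc, reassoc_of% h6',
    (SS Kd.dis).t1, ← Category.assoc (lm k F (dc G _)), ← lm_comp, ← Category.assoc (lm k F (_)),
    ← lm_comp]
  simp only [Category.assoc]
  rw [(SS Kd.dis).t2, lm_comp, lm_comp]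
  have hs := st_nat k F (𝟙 W) (dc G X)
  rw [lm_id] at hs
  simp only [Category.assoc]
  rw [← reassoc_of% hs, ← Category.assoc (dj (𝟙 _) (dc G X)), (SS Kd.dis).cL_cL, Category.id_comp]
  simp [st']

theorem e4 (k : Kd) (F H X W : Form P) :
    lm k F ((SS Kd.dis).b H X W) ≫ st k F X (H ⋎ W) =
      st' k F H (X ⋎ W) ≫ dj (𝟙 H) (st k F X W) ≫ (SS Kd.dis).b H (op k F X) W := by
  have h1 := e1 k F H W X
  unfold Sym.b
  rw [lm_comp, lm_comp]
  simp only [Category.assoc]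
  rw [st_dc, reassoc_of% h1]
  have hn := st'_nat k F (𝟙 H) (dc X W)
  rw [← reassoc_of% hn]
  simp only [← Category.assoc]
  congr 2
  simp only [Category.assoc]
  rw [← Sym.m_right, ← Sym.m_right, st'_dc]

theorem e5 (k : Kd) (F G X W : Form P) :
    lm k F (da G X W) ≫ st k F (G ⋎ X) W ≫ dj (st' k F G X) (𝟙 W) =
      st' k F G (X ⋎ W) ≫ dj (𝟙 G) (st k F X W) ≫ da G (op k F X) W := by
  have h6 := st_d6 k F X G W
  have h6' : st k F (X ⋎ G) W ≫ dj (st k F X G) (𝟙 W) =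
      lm k F (db X G W) ≫ st k F X (G ⋎ W) ≫ da (op k F X) G W := by
    rw [← h6, ← Category.assoc (lm k F (_)), ← lm_comp, (SS Kd.dis).a'a, lm_id, Category.id_comp]
  have hb : da (op k F X) G W ≫ dj (dc (op k F X) G) (𝟙 W) =
      (SS Kd.dis).b (op k F X) G W ≫ da G (op k F X) W := by
    rw [Sym.b_eq]; simp [(SS Kd.dis).a'a]
  have hb2 : lm k F (da G X W) ≫ lm k F (dj (dc G X) (𝟙 W)) ≫ lm k F (db X G W) =
      lm k F ((SS Kd.dis).b G X W) := by
    rw [Sym.b_eq, lm_comp, lm_comp]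
  have h4 := e4 k F G X W
  conv_lhs => rw [st', Sym.m_left, Sym.m_left]
  rw [← Category.assoc (st k F (G ⋎ X) W), st_nat, Category.assoc, reassoc_of% h6', hb,
    reassoc_of% hb2, reassoc_of% h4]
  have := (SS Kd.dis).b_b G (op k F X) W
  rw [reassoc_of% this]

theorem dConj' (F G X W : Form P) :
    lm Kd.con F (st .con G X W) ≫ st .con F (G ⋏ X) W ≫ dj (ca F G X) (𝟙 W) =
      ca F G (X ⋎ W) ≫ st .con (F ⋏ G) X W := by
  have h : st .con (F ⋏ G) X W ≫ dj (cb F G X) (𝟙 W) =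
    (cb F G (X ⋎ W) ≫ lm Kd.con F (st .con G X W)) ≫ st .con F (G ⋏ X) W := cl_eq (Eqv.dConj F G X W)
  have := congrArg (fun z => ca F G (X ⋎ W) ≫ z ≫ dj (ca F G X) (𝟙 W)) h
  simp only [Category.assoc] at this
  rw [← Sym.m_left, (SS Kd.con).a'a, (SS Kd.con).aa'_assoc, (SS Kd.dis).m_id,
    Category.comp_id] at this
  exact this.symm

theorem dConj'' (F G X W : Form P) :
    st .con (F ⋏ G) X W ≫ dj (cb F G X) (𝟙 W) =
    cb F G (X ⋎ W) ≫ lm Kd.con F (st .con G X W) ≫ st .con F (G ⋏ X) W := by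
  rw [← Category.assoc]
  exact cl_eq (Eqv.dConj F G X W)

theorem dBDisj' (C B X W : Form P) :
    st .con (C ⋎ B) X W ≫ dj (dr C B X) (𝟙 W) =
      dr C B (X ⋎ W) ≫ dj (𝟙 C) (st .con B X W) ≫ da C (B ⋏ X) W := by
  have h : dr C B (X ⋎ W) ≫ dj (𝟙 C) (st .con B X W) =
     (st .con (C ⋎ B) X W ≫ dj (dr C B X) (𝟙 W)) ≫ db C (B ⋏ X) W := cl_eq (Eqv.dBDisj C B X W)
  rw [reassoc_of% h, (SS Kd.dis).a'a]
  simp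

theorem dr_eq (C B A : Form P) : dr C B A =
    cs (C ⋎ B) A ≫ st' .con A C B ≫ dj (𝟙 C) (cs A B) := by
  have h : dr C B A = (((cs (C ⋎ B) A ≫ lm Kd.con A (dc C B)) ≫ st .con A B C) ≫
    dj (cs A B) (𝟙 C)) ≫ dc (B ⋏ A) C := rfl
  rw [h]
  unfold st'
  simp only [Category.assoc]
  rw [(SS Kd.dis).c_nat]

theorem e3 (F H X W : Form P) :
    lm Kd.con F (st' .con H X W) ≫ st .con F X (H ⋏ W) =
      (SS Kd.con).b F H (X ⋎ W) ≫ lm Kd.con H (st .con F X W) ≫ st' .con H (F ⋏ X) W := by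
  have h : dj (𝟙 X) (cs H W) ≫ dj (𝟙 X) (cs W H) = 𝟙 _ := by
    rw [← Sym.m_right, (SS Kd.con).cc, (SS Kd.dis).m_id]
  have h1 : dj (𝟙 (F ⋏ X)) (cs H W) ≫ dj (𝟙 (F ⋏ X)) (cs W H) = 𝟙 _ := by
    rw [← Sym.m_right, (SS Kd.con).cc, (SS Kd.dis).m_id]
  have h2 : st' .con H X W = cs H (X ⋎ W) ≫ dr X W H ≫ dj (𝟙 X) (cs W H) := by
    rw [dr_eq]; simp only [Category.assoc]; rw [h, (SS Kd.con).cc_assoc, Category.comp_id]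
  have h3 : cj (st .con F X W) (𝟙 H) ≫ dr (F ⋏ X) W H =
    (cb F (X ⋎ W) H ≫ lm Kd.con F (dr X W H)) ≫ st .con F X (W ⋏ H) := cl_eq (Eqv.dBConj F X W H)
  have h4 := st_nat .con F (𝟙 X) (cs W H)
  rw [lm_id] at h4
  have h5 : lm Kd.con F (dr X W H) ≫ st .con F X (W ⋏ H) = ca F (X ⋎ W) H ≫
      cj (st .con F X W) (𝟙 H) ≫ dr (F ⋏ X) W H := by
    rw [h3]; simp only [Category.assoc]; rw [(SS Kd.con).aa'_assoc]
  rw [h2, lm_comp, lm_comp]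
  simp only [Category.assoc]
  rw [← h4, reassoc_of% h5, dr_eq]
  simp only [Category.assoc]
  rw [h1, Category.comp_id, ← Category.assoc (cj _ (𝟙 H)), ← (SS Kd.con).c_nat]
  unfold Sym.b
  simp only [Category.assoc]

theorem dr_nat {C C' B B' A A' : Form P} (f : C ⟶ C') (g : B ⟶ B') (h : A ⟶ A') :
    dr C B A ≫ dj f (cj g h) = cj (dj f g) h ≫ dr C' B' A' := by
  rw [dr_eq, dr_eq]
  have h1 := (SS Kd.con).c_nat (dj f g) h
  have h2 := st'_natF .con h f g
  rw [← reassoc_of% h1, ← reassoc_of% h2]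
  simp only [Category.assoc]
  rw [(SS Kd.dis).m_comp, (SS Kd.dis).m_comp, (SS Kd.con).c_nat]
  simp

end Alg
end PNL


namespace PNL

open CategoryTheory

section Caps
variable {P : Type}

structure CapData (P : Type) where
  a : Form P
  b : Form P
  cap : ∀ S : Form P, S ⟶ S ⋏ (a ⋎ b)
  nat : ∀ {S S' : Form P} (f : S ⟶ S'), f ≫ cap S' = cap S ≫ cj f (𝟙 (a ⋎ b))
  bD : ∀ F G : Form P, cap (F ⋏ G) ≫ cb F G (a ⋎ b) = lm Kd.con F (cap G)
  dD : ∀ C B : Form P, cap (C ⋎ B) ≫ dr C B (a ⋎ b) = dj (𝟙 C) (cap B)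

theorem CapData.bD' (D : CapData P) (F G : Form P) :
    lm Kd.con F (D.cap G) ≫ ca F G (D.a ⋎ D.b) = D.cap (F ⋏ G) := by
  rw [← D.bD, Category.assoc, (SS Kd.con).a'a]; exact Category.comp_id _

@[reducible] def CapData.mirror (D : CapData P) : CapData P where
  a := D.b
  b := D.a
  cap S := D.cap S ≫ lm Kd.con S (dc D.a D.b)
  nat f := by
    rw [← Category.assoc, D.nat, Category.assoc, Category.assoc, (SS Kd.con).m_comp,
      (SS Kd.con).m_comp]
    simp
  bD F G := by
    have h := (SS Kd.con).a'_nat (𝟙 F) (𝟙 G) (dc D.a D.b)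
    rw [(SS Kd.con).m_id] at h
    rw [Category.assoc, ← h, ← Category.assoc, D.bD, ← Sym.m_right]
  dD C B := by
    have h := dr_nat (𝟙 C) (𝟙 B) (dc D.a D.b)
    rw [(SS Kd.dis).m_id] at h
    rw [Category.assoc, ← h, ← Category.assoc, D.dD, ← Sym.m_right]

theorem CapData.mirror_mirror (D : CapData P) : D.mirror.mirror = D := by
  cases D with | mk a b cap _ _ _ =>
  unfold CapData.mirror
  congr
  funext S
  change (cap S ≫ lm Kd.con S (dc a b)) ≫ lm Kd.con S (dc b a) = cap S
  rw [Category.assoc, (SS Kd.con).m_comp, (SS Kd.dis).cc, Category.id_comp, (SS Kd.con).m_id]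
  exact Category.comp_id _

structure Layer (P : Type) where
  k : Kd
  F : Form P

@[reducible] def fill : List (Layer P) → Form P → Form P
  | [], X => X
  | l :: Y, X => op l.k l.F (fill Y X)

def fmap : (Y : List (Layer P)) → {X X' : Form P} → (X ⟶ X') → (fill Y X ⟶ fill Y X')
  | [], _, _, f => f
  | l :: Y, _, _, f => lm l.k l.F (fmap Y f)

inductive Cap2 (D : CapData P) : ∀ {T : Form P} (Y Z : List (Layer P)),
    (T ⟶ fill Y D.a ⋎ fill Z D.b) → Prop
  | stemL {T S : Form P} (h : T ⟶ S) (hh : IsDS h) (k : T ⟶ (S ⋏ D.a) ⋎ D.b)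
      (e : k = h ≫ D.cap S ≫ st .con S D.a D.b) : Cap2 D [⟨.con, S⟩] [] k
  | stemR {T S : Form P} (h : T ⟶ S) (hh : IsDS h) (k : T ⟶ D.a ⋎ (S ⋏ D.b))
      (e : k = h ≫ D.cap S ≫ st' .con S D.a D.b) : Cap2 D [] [⟨.con, S⟩] k
  | layL {T T' : Form P} (kd : Kd) (F : Form P) {Y Z : List (Layer P)} (h : T ⟶ op kd F T')
      (hh : IsDS h) (k' : T' ⟶ fill Y D.a ⋎ fill Z D.b) (hk : Cap2 D Y Z k')
      (k : T ⟶ op kd F (fill Y D.a) ⋎ fill Z D.b)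
      (e : k = h ≫ lm kd F k' ≫ st kd F _ _) : Cap2 D (⟨kd, F⟩ :: Y) Z k
  | layR {T T' : Form P} (kd : Kd) (F : Form P) {Y Z : List (Layer P)} (h : T ⟶ op kd F T')
      (hh : IsDS h) (k' : T' ⟶ fill Y D.a ⋎ fill Z D.b) (hk : Cap2 D Y Z k')
      (k : T ⟶ fill Y D.a ⋎ op kd F (fill Z D.b))
      (e : k = h ≫ lm kd F k' ≫ st' kd F _ _) : Cap2 D Y (⟨kd, F⟩ :: Z) k

theorem Cap2.pre {D : CapData P} {T T0 : Form P} {Y Z : List (Layer P)}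
    {k : T ⟶ fill Y D.a ⋎ fill Z D.b} (hk : Cap2 D Y Z k) (h0 : T0 ⟶ T) (hh0 : IsDS h0) :
    Cap2 D Y Z (h0 ≫ k) := by
  cases hk with
  | stemL h hh k e => exact .stemL (h0 ≫ h) (hh0.comp hh) _ ((congrArg (h0 ≫ ·) e).trans (Category.assoc _ _ _).symm)
  | stemR h hh k e => exact .stemR (h0 ≫ h) (hh0.comp hh) _ ((congrArg (h0 ≫ ·) e).trans (Category.assoc _ _ _).symm)
  | layL kd F h hh k' hk' k e => exact .layL kd F (h0 ≫ h) (hh0.comp hh) k' hk' _ ((congrArg (h0 ≫ ·) e).trans (Category.assoc _ _ _).symm)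
  | layR kd F h hh k' hk' k e => exact .layR kd F (h0 ≫ h) (hh0.comp hh) k' hk' _ ((congrArg (h0 ≫ ·) e).trans (Category.assoc _ _ _).symm)

theorem mir_aux1 {T a b : Form P} (kd : Kd) {S : Form P} (h : T ⟶ S) (F : Form P)
    (c : S ⟶ op kd F (a ⋎ b)) : (h ≫ c ≫ st kd F a b) ≫ dc _ _ =
    h ≫ (c ≫ lm kd F (dc a b)) ≫ st' kd F b a := by
  simp only [Category.assoc]; rw [st'_dc]

theorem mir_aux2 {T a b : Form P} (kd : Kd) {S : Form P} (h : T ⟶ S) (F : Form P)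
    (c : S ⟶ op kd F (a ⋎ b)) : (h ≫ c ≫ st' kd F a b) ≫ dc _ _ =
    h ≫ (c ≫ lm kd F (dc a b)) ≫ st kd F b a := by
  simp only [Category.assoc]; rw [st_dc]

theorem mir_aux3 {T a b : Form P} (kd : Kd) {S : Form P} (F : Form P) (h : T ⟶ op kd F S)
    (c : S ⟶ a ⋎ b) : (h ≫ lm kd F c ≫ st kd F a b) ≫ dc _ _ =
    h ≫ lm kd F (c ≫ dc a b) ≫ st' kd F b a := by
  simp only [Category.assoc, lm_comp]; rw [st'_dc]

theorem mir_aux4 {T a b : Form P} (kd : Kd) {S : Form P} (F : Form P) (h : T ⟶ op kd F S)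
    (c : S ⟶ a ⋎ b) : (h ≫ lm kd F c ≫ st' kd F a b) ≫ dc _ _ =
    h ≫ lm kd F (c ≫ dc a b) ≫ st kd F b a := by
  simp only [Category.assoc, lm_comp]; rw [st_dc]

theorem Cap2.mirror {D : CapData P} {T : Form P} {Y Z : List (Layer P)}
    {k : T ⟶ fill Y D.a ⋎ fill Z D.b} (hk : Cap2 D Y Z k) :
    Cap2 D.mirror Z Y (k ≫ dc _ _) := by
  induction hk with
  | stemL h hh k e =>
    rename_i T S
    refine .stemR h hh _ ?_
    rw [e]; exact mir_aux1 Kd.con h S (D.cap S)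
  | stemR h hh k e =>
    rename_i T S
    refine .stemL h hh _ ?_
    rw [e]; exact mir_aux2 Kd.con h S (D.cap S)
  | layL kd F h hh k' hk' k e ih =>
    rename_i T T' Y Z
    refine .layR kd F h hh _ ih _ ?_
    rw [e]; exact mir_aux3 kd F h k' 
  | layR kd F h hh k' hk' k e ih =>
    rename_i T T' Y Z
    refine .layL kd F h hh _ ih _ ?_
    rw [e]; exact mir_aux4 kd F h k' 

theorem Cap2.transport {D D' : CapData P} (hD : D' = D) {T : Form P} {Y Z : List (Layer P)}
    (k' : T ⟶ fill Y D'.a ⋎ fill Z D'.b) (k : T ⟶ fill Y D.a ⋎ fill Z D.b) (hk : HEq k' k)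
    (h : Cap2 D' Y Z k') : Cap2 D Y Z k := by
  subst hD
  obtain rfl := eq_of_heq hk
  exact h

theorem Cap2.unmirror {D : CapData P} {T : Form P} {Y Z : List (Layer P)}
    {k : T ⟶ fill Y D.a ⋎ fill Z D.b} (hk : Cap2 D.mirror Z Y (k ≫ dc _ _)) :
    Cap2 D Y Z k := by
  have h := hk.mirror
  have e : (k ≫ dc (fill Y D.a) (fill Z D.b)) ≫ dc (fill Z D.b) (fill Y D.a) = k := by
    rw [Category.assoc, (SS Kd.dis).cc]; exact Category.comp_id _
  have h' : Cap2 D.mirror.mirror Y Z ((k ≫ dc (fill Y D.a) (fill Z D.b)) ≫ dc (fill Z D.b) (fill Y D.a)) := h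
  exact Cap2.transport D.mirror_mirror _ _ (heq_of_eq e) h'

def InvP (D : CapData P) {T : Form P} : ∀ (Y0 Z : List (Layer P)),
    (T ⟶ fill Y0 D.a ⋎ fill Z D.b) → Prop
  | ⟨.dis, G⟩ :: Y, Z, k => ∃ (T' : Form P) (h : T ⟶ G ⋎ T') (k' : T' ⟶ fill Y D.a ⋎ fill Z D.b),
      IsDS h ∧ Cap2 D Y Z k' ∧ k = h ≫ dj (𝟙 G) k' ≫ da G (fill Y D.a) (fill Z D.b)
  | _, _, _ => True

theorem inv_aux (kd : Kd) (F G : Form P) {T T' T1 Y W : Form P} (h : T ⟶ op kd F T')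
    (h1 : T' ⟶ G ⋎ T1) (k1 : T1 ⟶ Y ⋎ W) :
    h ≫ lm kd F (h1 ≫ dj (𝟙 G) k1 ≫ da G Y W) ≫ st' kd F (G ⋎ Y) W =
    (h ≫ lm kd F h1 ≫ st' kd F G T1) ≫ dj (𝟙 G) (lm kd F k1 ≫ st' kd F Y W) ≫
      da G Y (op kd F W) := by
  have h2 := e1 kd F G Y W
  have h3 := st'_nat kd F (𝟙 G) k1
  rw [lm_comp, lm_comp, Sym.m_right]
  simp only [Category.assoc]
  rw [h2, reassoc_of% h3]

theorem Cap2.invP {D : CapData P} {T : Form P} {Y Z : List (Layer P)}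
    {k : T ⟶ fill Y D.a ⋎ fill Z D.b} (hk : Cap2 D Y Z k) : InvP D Y Z k := by
  induction hk with
  | stemL h hh k e => trivial
  | stemR h hh k e => trivial
  | layL kd F h hh k' hk' k0 e ih =>
    cases kd
    · trivial
    · exact ⟨_, h, k', hh, hk', e⟩
  | layR kd F h hh k' hk' k0 e ih =>
    rename_i T T' Y Z
    rcases Y with _ | ⟨⟨_ | _, G⟩, Y⟩
    · trivial
    · trivial
    · obtain ⟨T1, h1, k1, hh1, hk1, e1'⟩ := ih
      refine ⟨_, h ≫ lm kd F h1 ≫ st' kd F G T1, lm kd F k1 ≫ st' kd F _ _, ?_, ?_, ?_⟩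
      · exact hh.comp ((IsDS.ly kd F hh1).comp (.st' _ _ _ _))
      · exact .layR kd F (𝟙 _) (.id _) k1 hk1 _ (Category.id_comp _).symm
      · rw [e, e1']
        exact inv_aux kd F G h h1 k1

/-- Inversion for a disjunctive outer layer. -/
theorem Cap2.inv {D : CapData P} {T G : Form P} {Y Z : List (Layer P)}
    {k : T ⟶ (G ⋎ fill Y D.a) ⋎ fill Z D.b} (hk : Cap2 D (⟨.dis, G⟩ :: Y) Z k) :
    ∃ (T' : Form P) (h : T ⟶ G ⋎ T') (k' : T' ⟶ fill Y D.a ⋎ fill Z D.b),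
      IsDS h ∧ Cap2 D Y Z k' ∧ k = h ≫ dj (𝟙 G) k' ≫ da G (fill Y D.a) (fill Z D.b) :=
  hk.invP

inductive CtxStep : ∀ (Y Y' : List (Layer P)), (∀ X, fill Y X ⟶ fill Y' X) → Prop
  | assoc (kd : Kd) (F G : Form P) (Y : List (Layer P)) :
      CtxStep (⟨kd, F⟩ :: ⟨kd, G⟩ :: Y) (⟨kd, op kd F G⟩ :: Y) (fun X => (SS kd).a F G (fill Y X))
  | assoc' (kd : Kd) (F G : Form P) (Y : List (Layer P)) :
      CtxStep (⟨kd, op kd F G⟩ :: Y) (⟨kd, F⟩ :: ⟨kd, G⟩ :: Y) (fun X => (SS kd).a' F G (fill Y X))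
  | dd (F G : Form P) (Y : List (Layer P)) :
      CtxStep (⟨.con, F⟩ :: ⟨.dis, G⟩ :: Y) (⟨.dis, G⟩ :: ⟨.con, F⟩ :: Y)
        (fun X => st' .con F G (fill Y X))
  | d6 (F G : Form P) (Y : List (Layer P)) :
      CtxStep (⟨.con, F⟩ :: ⟨.dis, G⟩ :: Y) (⟨.dis, F ⋏ G⟩ :: Y)
        (fun X => st .con F G (fill Y X))
  | dr (C B : Form P) (Y : List (Layer P)) :
      CtxStep (⟨.con, C ⋎ B⟩ :: Y) (⟨.dis, C⟩ :: ⟨.con, B⟩ :: Y) (fun X => dr C B (fill Y X))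
  | side (kd : Kd) {F F' : Form P} (e : F ⟶ F') (he : IsDS e) (Y : List (Layer P)) :
      CtxStep (⟨kd, F⟩ :: Y) (⟨kd, F'⟩ :: Y) (fun X => (SS kd).m e (𝟙 (fill Y X)))
  | cong (kd : Kd) (F : Form P) {Y Y' : List (Layer P)} {s : ∀ X, fill Y X ⟶ fill Y' X} :
      CtxStep Y Y' s → CtxStep (⟨kd, F⟩ :: Y) (⟨kd, F⟩ :: Y') (fun X => lm kd F (s X))

theorem CtxStep.nat {Y Y' : List (Layer P)} {s : ∀ X, fill Y X ⟶ fill Y' X} (h : CtxStep Y Y' s)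
    {X X' : Form P} (f : X ⟶ X') : s X ≫ fmap Y' f = fmap Y f ≫ s X' := by
  induction h with
  | assoc kd F G Y =>
    have := (SS kd).a_nat (𝟙 F) (𝟙 G) (fmap Y f)
    rw [(SS kd).m_id] at this
    exact this
  | assoc' kd F G Y =>
    have := (SS kd).a'_nat (𝟙 F) (𝟙 G) (fmap Y f)
    rw [(SS kd).m_id] at this
    exact this
  | dd F G Y => exact st'_nat _ _ _ _
  | d6 F G Y =>
    have := st_nat .con F (𝟙 G) (fmap Y f)
    rw [(SS Kd.con).m_id] at this
    exact this
  | dr C B Y =>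
    have := dr_nat (𝟙 C) (𝟙 B) (fmap Y f)
    rw [(SS Kd.dis).m_id] at this
    exact this
  | side kd e he Y =>
    exact ((SS kd).m_comp _ _ _ _).trans (Eq.trans (by simp) ((SS kd).m_comp _ _ _ _).symm)
  | cong kd F _ ih =>
    have := congrArg (fun z => lm kd F z) ih
    exact (lm_comp _ _ _ _).symm.trans (this.trans (lm_comp _ _ _ _))

inductive Cap2L (D : CapData P) : ∀ {T : Form P} (Y Z : List (Layer P)),
    (T ⟶ fill Y D.a ⋎ fill Z D.b) → Prop
  | stemL {T S : Form P} (h : T ⟶ S) (hh : IsDS h) (k : T ⟶ (S ⋏ D.a) ⋎ D.b)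
      (e : k = h ≫ D.cap S ≫ st .con S D.a D.b) : Cap2L D [⟨.con, S⟩] [] k
  | layL {T T' : Form P} (kd : Kd) (F : Form P) {Y Z : List (Layer P)} (h : T ⟶ op kd F T')
      (hh : IsDS h) (k' : T' ⟶ fill Y D.a ⋎ fill Z D.b) (hk : Cap2 D Y Z k')
      (k : T ⟶ op kd F (fill Y D.a) ⋎ fill Z D.b)
      (e : k = h ≫ lm kd F k' ≫ st kd F _ _) : Cap2L D (⟨kd, F⟩ :: Y) Z k

theorem step_aux1 {T a a' b : Form P} (kd : Kd) {S : Form P} (F : Form P) (h : T ⟶ op kd F S)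
    (c : S ⟶ a ⋎ b) (s : a ⟶ a') : (h ≫ lm kd F c ≫ st' kd F a b) ≫ dj s (𝟙 _) =
    h ≫ lm kd F (c ≫ dj s (𝟙 _)) ≫ st' kd F a' b := by
  have h3 := st'_nat kd F s (𝟙 b)
  rw [lm_comp]
  simp only [Category.assoc]
  rw [← h3, lm_id]

theorem Cap2.stepAux {D : CapData P} {Y Y' : List (Layer P)} (s : ∀ X, fill Y X ⟶ fill Y' X)
    (hne : Y ≠ [])
    (H : ∀ {T : Form P} {Z : List (Layer P)} (k : T ⟶ fill Y D.a ⋎ fill Z D.b), Cap2L D Y Z k →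
      Cap2 D Y' Z (k ≫ dj (s D.a) (𝟙 (fill Z D.b))))
    {T : Form P} {Z : List (Layer P)} {k : T ⟶ fill Y D.a ⋎ fill Z D.b} (hk : Cap2 D Y Z k) :
    Cap2 D Y' Z (k ≫ dj (s D.a) (𝟙 (fill Z D.b))) := by
  induction hk with
  | stemL h hh k e => exact H (Z := []) k (.stemL h hh k e)
  | stemR h hh k e => exact absurd rfl hne
  | layL kd F h hh k' hk' k e ih => exact H k (.layL kd F h hh k' hk' k e)
  | layR kd F h hh k' hk' k e ih =>
    rename_i T T' Y Z
    refine .layR kd F h hh _ (ih s hne H) _ ?_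
    rw [e]; exact step_aux1 kd F h k' (s D.a)

end Caps
end PNL


namespace PNL

open CategoryTheory

section Steps
variable {P : Type}

theorem Sym.b_nat {t : Form P → Form P → Form P} (S : Sym P t) {F F' X X' W W' : Form P}
    (e : F ⟶ F') (f : X ⟶ X') (g : W ⟶ W') :
    S.b F X W ≫ S.m f (S.m e g) = S.m e (S.m f g) ≫ S.b F' X' W' := by
  unfold Sym.b
  have h1 := S.c_nat (S.m e g) f
  have h2 := S.a_nat e g f
  simp only [Category.assoc]
  rw [h1, reassoc_of% h2, ← Category.assoc, ← Category.assoc (S.m e (S.m f g)), S.m_comp, S.m_comp,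
    S.c_nat]
  simp

/-- swapping a conjunctive layer with another layer -/
def sw (m : Kd) (F H T : Form P) : F ⋏ op m H T ⟶ op m H (F ⋏ T) :=
  match m with
  | .con => (SS Kd.con).b F H T
  | .dis => st' .con F H T

theorem IsDS.sw (m : Kd) (F H T : Form P) : IsDS (sw m F H T) := by
  cases m
  · exact (IsDS.ly .con F (.c .con _ _)).comp ((IsDS.a .con _ _ _).comp (.c .con _ _))
  · exact .st' _ _ _ _

theorem sw_nat (m : Kd) (F H : Form P) {T T' : Form P} (k : T ⟶ T') :
    sw m F H T ≫ lm m H (lm Kd.con F k) = lm Kd.con F (lm m H k) ≫ sw m F H T' := by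
  cases m
  · exact (SS Kd.con).b_nat _ _ _
  · exact st'_nat _ _ _ _

theorem e34 (m : Kd) (F H X W : Form P) :
    lm Kd.con F (st' m H X W) ≫ st .con F X (op m H W) =
      sw m F H (X ⋎ W) ≫ lm m H (st .con F X W) ≫ st' m H (F ⋏ X) W := by
  cases m
  · exact e3 F H X W
  · exact e4 .con F H X W

theorem peel_aux (m : Kd) (F H : Form P) {T T1 X X' W : Form P} (h : T ⟶ op m H T1)
    (k1 : T1 ⟶ X ⋎ W) (A : F ⋏ X ⟶ X') :
    lm Kd.con F (h ≫ lm m H k1 ≫ st' m H X W) ≫ st .con F X (op m H W) ≫ dj A (𝟙 _) =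
    (lm Kd.con F h ≫ sw m F H T1) ≫ lm m H (lm Kd.con F k1 ≫ st .con F X W ≫ dj A (𝟙 W)) ≫
      st' m H X' W := by
  have h1 := e34 m F H X W
  have h2 := sw_nat m F H k1
  have h3 := st'_nat m H A (𝟙 W)
  rw [lm_comp, lm_comp, lm_comp, lm_comp]
  simp only [Category.assoc]
  rw [reassoc_of% h2, reassoc_of% h1, ← h3, lm_id]

def PeelP (D : CapData P) (F : Form P) {T : Form P} : ∀ (Y0 Z : List (Layer P)),
    (T ⟶ fill Y0 D.a ⋎ fill Z D.b) → Prop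
  | ⟨.con, G⟩ :: Y, Z, k => Cap2 D (⟨.con, F ⋏ G⟩ :: Y) Z
      (lm Kd.con F k ≫ st .con F (G ⋏ fill Y D.a) (fill Z D.b) ≫
        dj (ca F G (fill Y D.a)) (𝟙 (fill Z D.b)))
  | _, _, _ => True

theorem peel_aux2 (F G : Form P) {T T1 X W : Form P} (h : T ⟶ G ⋏ T1) (k1 : T1 ⟶ X ⋎ W) :
    lm Kd.con F (h ≫ lm Kd.con G k1 ≫ st .con G X W) ≫ st .con F (G ⋏ X) W ≫
      dj (ca F G X) (𝟙 W) =
    (lm Kd.con F h ≫ ca F G T1) ≫ lm Kd.con (F ⋏ G) k1 ≫ st .con (F ⋏ G) X W := by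
  have h1 := dConj' F G X W
  have h2 := (SS Kd.con).a_nat (𝟙 F) (𝟙 G) k1
  rw [(SS Kd.con).m_id] at h2
  rw [lm_comp, lm_comp]
  simp only [Category.assoc]
  rw [h1, reassoc_of% h2]

theorem peel_aux3 (F G : Form P) (D : CapData P) {T : Form P} (h : T ⟶ G) :
    lm Kd.con F (h ≫ D.cap G ≫ st .con G D.a D.b) ≫ st .con F (G ⋏ D.a) D.b ≫
      dj (ca F G D.a) (𝟙 D.b) =
    lm Kd.con F h ≫ D.cap (F ⋏ G) ≫ st .con (F ⋏ G) D.a D.b := by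
  have h1 := dConj' F G D.a D.b
  have h2 := D.bD' F G
  rw [lm_comp, lm_comp]
  simp only [Category.assoc]
  rw [h1, reassoc_of% h2]

theorem Cap2.peelP {D : CapData P} (F : Form P) {T : Form P} {Y Z : List (Layer P)}
    {k : T ⟶ fill Y D.a ⋎ fill Z D.b} (hk : Cap2 D Y Z k) : PeelP D F Y Z k := by
  induction hk with
  | stemL h hh k e => exact .stemL (lm Kd.con F h) (.ly _ _ hh) _ (by rw [e]; exact peel_aux3 F _ D h)
  | stemR h hh k e => trivial
  | layL kd G h hh k' hk' k0 e ih =>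
    cases kd
    · exact .layL .con _ (lm Kd.con F h ≫ ca F G _) ((IsDS.ly .con _ hh).comp (.a .con _ _ _)) k' hk' _
        (by rw [e]; exact peel_aux2 F G h k')
    · trivial
  | layR kd H h hh k' hk' k0 e ih =>
    rename_i T T' Y Z
    rcases Y with _ | ⟨⟨_ | _, G⟩, Y⟩
    · trivial
    · exact .layR kd H (lm Kd.con F h ≫ sw kd F H _) ((IsDS.ly .con _ hh).comp (.sw _ _ _ _)) _ ih _
        (by rw [e]; exact peel_aux kd F H h k' _)
    · trivial

theorem asd_aux (F G : Form P) {T T' T1 X W : Form P} (h : T ⟶ F ⋎ T') (h1 : T' ⟶ G ⋎ T1)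
    (k1 : T1 ⟶ X ⋎ W) :
    (h ≫ lm Kd.dis F (h1 ≫ dj (𝟙 G) k1 ≫ da G X W) ≫ st .dis F (G ⋎ X) W) ≫
      dj (da F G X) (𝟙 W) =
    (h ≫ dj (𝟙 F) h1 ≫ da F G T1) ≫ lm Kd.dis (F ⋎ G) k1 ≫ st .dis (F ⋎ G) X W := by
  have h2 := (SS Kd.dis).pent F G X W
  have h3 := (SS Kd.dis).a_nat (𝟙 F) (𝟙 G) k1
  rw [(SS Kd.dis).m_id] at h3
  rw [lm_comp, lm_comp]
  simp only [Category.assoc]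
  rw [reassoc_of% h3]
  exact congrArg (fun z => h ≫ dj (𝟙 F) h1 ≫ dj (𝟙 F) (dj (𝟙 G) k1) ≫ z) h2.symm

theorem as'_aux (kd : Kd) (F G : Form P) {T T' X W : Form P} (h : T ⟶ op kd (op kd F G) T')
    (k1 : T' ⟶ X ⋎ W) :
    (h ≫ lm kd (op kd F G) k1 ≫ st kd (op kd F G) X W) ≫ dj ((SS kd).a' F G X) (𝟙 W) =
    (h ≫ (SS kd).a' F G T') ≫ lm kd F (lm kd G k1 ≫ st kd G X W) ≫ st kd F (op kd G X) W := by
  have h2 : st kd (op kd F G) X W ≫ dj ((SS kd).a' F G X) (𝟙 W) =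
    (SS kd).a' F G (X ⋎ W) ≫ lm kd F (st kd G X W) ≫ st kd F (op kd G X) W := by
    cases kd
    · exact dConj'' F G X W
    · have h2 := (SS Kd.dis).pent F G X W
      have : db F G (X ⋎ W) ≫ lm Kd.dis F (da G X W) ≫ da F (G ⋎ X) W =
         da (F ⋎ G) X W ≫ dj (db F G X) (𝟙 W) := by
        have h3 := congrArg (fun z => db F G (X ⋎ W) ≫ z ≫ dj (db F G X) (𝟙 W)) h2
        simp only [Category.assoc] at h3
        rw [(SS Kd.dis).a'a_assoc, ← Sym.m_left, (SS Kd.dis).aa', (SS Kd.dis).m_id] at h3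
        rw [h3]; simp
      exact this.symm
  have h3 := (SS kd).a'_nat (𝟙 F) (𝟙 G) k1
  rw [(SS kd).m_id] at h3
  rw [lm_comp]
  simp only [Category.assoc]
  rw [h2, reassoc_of% h3]

theorem as'_aux2 (F G : Form P) (D : CapData P) {T : Form P} (h : T ⟶ F ⋏ G) :
    (h ≫ D.cap (F ⋏ G) ≫ st .con (F ⋏ G) D.a D.b) ≫ dj (cb F G D.a) (𝟙 D.b) =
    h ≫ lm Kd.con F (D.cap G ≫ st .con G D.a D.b) ≫ st .con F (G ⋏ D.a) D.b := by
  have h2 := dConj'' F G D.a D.b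
  have h3 := D.bD F G
  rw [lm_comp, ← h3]
  simp only [Category.assoc]
  rw [h2]

theorem dd_aux (F G : Form P) {T T' T1 X W : Form P} (h : T ⟶ F ⋏ T') (h1 : T' ⟶ G ⋎ T1)
    (k1 : T1 ⟶ X ⋎ W) :
    (h ≫ lm Kd.con F (h1 ≫ dj (𝟙 G) k1 ≫ da G X W) ≫ st .con F (G ⋎ X) W) ≫
      dj (st' .con F G X) (𝟙 W) =
    (h ≫ lm Kd.con F h1 ≫ st' .con F G T1) ≫
      lm Kd.dis G (lm Kd.con F k1 ≫ st .con F X W) ≫ st .dis G (F ⋏ X) W := by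
  have h2 := e5 .con F G X W
  have h3 := st'_nat .con F (𝟙 G) k1
  rw [lm_comp, lm_comp, lm_comp]
  simp only [Category.assoc]
  rw [h2, reassoc_of% h3]
  rfl

theorem d6_aux (F G : Form P) {T T' T1 X W : Form P} (h : T ⟶ F ⋏ T') (h1 : T' ⟶ G ⋎ T1)
    (k1 : T1 ⟶ X ⋎ W) :
    (h ≫ lm Kd.con F (h1 ≫ dj (𝟙 G) k1 ≫ da G X W) ≫ st .con F (G ⋎ X) W) ≫
      dj (st .con F G X) (𝟙 W) =
    (h ≫ lm Kd.con F h1 ≫ st .con F G T1) ≫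
      lm Kd.dis (F ⋏ G) k1 ≫ st .dis (F ⋏ G) X W := by
  have h2 := st_d6 .con F G X W
  have h3 := st_nat .con F (𝟙 G) k1
  rw [lm_id] at h3
  rw [lm_comp, lm_comp]
  simp only [Category.assoc]
  rw [h2, reassoc_of% h3]
  rfl

theorem dr_aux (C B : Form P) {T T' X W : Form P} (h : T ⟶ (C ⋎ B) ⋏ T') (k1 : T' ⟶ X ⋎ W) :
    (h ≫ lm Kd.con (C ⋎ B) k1 ≫ st .con (C ⋎ B) X W) ≫ dj (dr C B X) (𝟙 W) =
    (h ≫ dr C B T') ≫ lm Kd.dis C (lm Kd.con B k1 ≫ st .con B X W) ≫ st .dis C (B ⋏ X) W := by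
  have h2 := dBDisj' C B X W
  have h3 := dr_nat (𝟙 C) (𝟙 B) k1
  rw [(SS Kd.dis).m_id] at h3
  rw [lm_comp]
  simp only [Category.assoc]
  rw [h2, reassoc_of% h3]
  rfl

theorem dr_aux2 (D : CapData P) (C B : Form P) {T : Form P} (h : T ⟶ C ⋎ B) :
    (h ≫ D.cap (C ⋎ B) ≫ st .con (C ⋎ B) D.a D.b) ≫ dj (dr C B D.a) (𝟙 D.b) =
    h ≫ lm Kd.dis C (D.cap B ≫ st .con B D.a D.b) ≫ st .dis C (B ⋏ D.a) D.b := by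
  have h2 := dBDisj' C B D.a D.b
  have h3 := D.dD C B
  rw [lm_comp]
  simp only [Category.assoc]
  rw [h2, reassoc_of% h3]
  rfl

theorem side_aux (kd : Kd) {F F' : Form P} (e : F ⟶ F') {T T' X W : Form P} (h : T ⟶ op kd F T')
    (k1 : T' ⟶ X ⋎ W) :
    (h ≫ lm kd F k1 ≫ st kd F X W) ≫ dj ((SS kd).m e (𝟙 X)) (𝟙 W) =
    (h ≫ (SS kd).m e (𝟙 T')) ≫ lm kd F' k1 ≫ st kd F' X W := by
  have h2 := st_natF kd e (𝟙 X) (𝟙 W)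
  rw [(SS Kd.dis).m_id] at h2
  have h3 : (SS kd).m e (𝟙 T') ≫ lm kd F' k1 = lm kd F k1 ≫ (SS kd).m e (𝟙 (X ⋎ W)) := by
    rw [(SS kd).m_comp, (SS kd).m_comp]; simp
  simp only [Category.assoc]
  rw [reassoc_of% h3, h2]

theorem side_aux2 (D : CapData P) {F F' : Form P} (e : F ⟶ F') {T : Form P} (h : T ⟶ F) :
    (h ≫ D.cap F ≫ st .con F D.a D.b) ≫ dj ((SS Kd.con).m e (𝟙 D.a)) (𝟙 D.b) =
    (h ≫ e) ≫ D.cap F' ≫ st .con F' D.a D.b := by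
  have h2 := st_natF .con e (𝟙 D.a) (𝟙 D.b)
  rw [(SS Kd.dis).m_id] at h2
  have h3 := D.nat e
  simp only [Category.assoc]
  rw [reassoc_of% h3, h2]

theorem cong_aux (kd : Kd) (F : Form P) {T T' X X' W : Form P} (s : X ⟶ X') (h : T ⟶ op kd F T')
    (k1 : T' ⟶ X ⋎ W) :
    (h ≫ lm kd F k1 ≫ st kd F X W) ≫ dj (lm kd F s) (𝟙 W) =
    h ≫ lm kd F (k1 ≫ dj s (𝟙 W)) ≫ st kd F X' W := by
  have h2 := st_nat kd F s (𝟙 W)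
  rw [lm_comp]
  simp only [Category.assoc]
  rw [h2]

theorem Cap2.step {D : CapData P} {Y Y' : List (Layer P)} {s : ∀ X, fill Y X ⟶ fill Y' X}
    (hs : CtxStep Y Y' s)
    {T : Form P} {Z : List (Layer P)} {k : T ⟶ fill Y D.a ⋎ fill Z D.b} (hk : Cap2 D Y Z k) :
    Cap2 D Y' Z (k ≫ dj (s D.a) (𝟙 (fill Z D.b))) := by
  induction hs generalizing T Z with
  | assoc kd F G Y =>
    refine Cap2.stepAux (Y' := ⟨kd, op kd F G⟩ :: Y) (fun X => (SS kd).a F G (fill Y X)) (by simp) ?_ hk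
    intro T Z k hk
    cases hk with
    | layL _ _ h hh k' hk' _ e =>
      cases kd
      · have := (hk'.peelP F).pre h hh
        rw [e]
        simpa only [Category.assoc] using this
      · obtain ⟨T1, h1, k1, hh1, hk1, e1⟩ := hk'.inv
        refine .layL .dis _ (h ≫ dj (𝟙 F) h1 ≫ da F G T1) ?_ k1 hk1 _ ?_
        · exact hh.comp ((IsDS.ly .dis _ hh1).comp (.a .dis _ _ _))
        · rw [e, e1]; exact asd_aux F G h h1 k1
  | assoc' kd F G Y =>
    refine Cap2.stepAux (Y' := ⟨kd, F⟩ :: ⟨kd, G⟩ :: Y) (fun X => (SS kd).a' F G (fill Y X)) (by simp) ?_ hk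
    intro T Z k hk
    cases kd
    · cases hk with
      | stemL h hh _ e =>
        refine .layL .con F (Y := [⟨.con, G⟩]) (Z := []) h hh (D.cap G ≫ st .con G D.a D.b)
          (.stemL (𝟙 _) (.id _) _ (Category.id_comp _).symm) _ ?_
        rw [e]; exact as'_aux2 F G D h
      | layL _ _ h hh k' hk' _ e =>
        refine .layL .con F (Y := ⟨.con, G⟩ :: Y) (h ≫ (SS Kd.con).a' F G _) (hh.comp (.a' .con _ _ _))
          (lm Kd.con G k' ≫ st .con G _ _)
          (.layL .con G (𝟙 _) (.id _) k' hk' _ (Category.id_comp _).symm) _ ?_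
        rw [e]; exact as'_aux .con F G h k'
    · cases hk with
      | layL _ _ h hh k' hk' _ e =>
        refine .layL .dis F (Y := ⟨.dis, G⟩ :: Y) (h ≫ (SS Kd.dis).a' F G _) (hh.comp (.a' .dis _ _ _))
          (lm Kd.dis G k' ≫ st .dis G _ _)
          (.layL .dis G (𝟙 _) (.id _) k' hk' _ (Category.id_comp _).symm) _ ?_
        rw [e]; exact as'_aux .dis F G h k'
  | dd F G Y =>
    refine Cap2.stepAux (Y' := ⟨.dis, G⟩ :: ⟨.con, F⟩ :: Y) (fun X => st' .con F G (fill Y X)) (by simp) ?_ hk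
    intro T Z k hk
    cases hk with
    | layL _ _ h hh k' hk' _ e =>
      obtain ⟨T1, h1, k1, hh1, hk1, e1⟩ := hk'.inv
      refine .layL .dis _ (h ≫ lm Kd.con F h1 ≫ st' .con F G T1) ?_ (lm Kd.con F k1 ≫ st .con F _ _)
        (.layL .con F (𝟙 _) (.id _) k1 hk1 _ (Category.id_comp _).symm) _ ?_
      · exact hh.comp ((IsDS.ly .con _ hh1).comp (.st' .con _ _ _))
      · rw [e, e1]; exact dd_aux F G h h1 k1
  | d6 F G Y =>
    refine Cap2.stepAux (Y' := ⟨.dis, F ⋏ G⟩ :: Y) (fun X => st .con F G (fill Y X)) (by simp) ?_ hk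
    intro T Z k hk
    cases hk with
    | layL _ _ h hh k' hk' _ e =>
      obtain ⟨T1, h1, k1, hh1, hk1, e1⟩ := hk'.inv
      refine .layL .dis _ (h ≫ lm Kd.con F h1 ≫ st .con F G T1) ?_ k1 hk1 _ ?_
      · exact hh.comp ((IsDS.ly .con _ hh1).comp (.st .con _ _ _))
      · rw [e, e1]; exact d6_aux F G h h1 k1
  | dr C B Y =>
    refine Cap2.stepAux (Y' := ⟨.dis, C⟩ :: ⟨.con, B⟩ :: Y) (fun X => PNL.dr C B (fill Y X)) (by simp) ?_ hk
    intro T Z k hk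
    cases hk with
    | stemL h hh _ e =>
      refine .layL .dis C (Y := [⟨.con, B⟩]) (Z := []) h hh (D.cap B ≫ st .con B D.a D.b)
        (.stemL (𝟙 _) (.id _) _ (Category.id_comp _).symm) _ ?_
      rw [e]; exact dr_aux2 D C B h
    | layL _ _ h hh k' hk' _ e =>
      refine .layL .dis C (h ≫ PNL.dr C B _) (hh.comp (.dr _ _ _))
        (lm Kd.con B k' ≫ st .con B _ _)
        (.layL .con B (𝟙 _) (.id _) k' hk' _ (Category.id_comp _).symm) _ ?_
      rw [e]; exact dr_aux C B h k'
  | side kd e he Y =>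
    refine Cap2.stepAux (Y' := ⟨kd, _⟩ :: Y) (fun X => (SS kd).m e (𝟙 (fill Y X))) (by simp) ?_ hk
    intro T Z k hk
    cases hk with
    | stemL h hh _ e1 =>
      refine .stemL (h ≫ e) (hh.comp he) _ ?_
      rw [e1]; exact side_aux2 D e h
    | layL _ _ h hh k' hk' _ e1 =>
      refine .layL kd _ (h ≫ (SS kd).m e (𝟙 _)) (hh.comp (.m kd he (.id _))) k' hk' _ ?_
      rw [e1]; exact side_aux kd e h k'
  | cong kd F hs ih =>
    rename_i Y1 Y1' s
    refine Cap2.stepAux (Y' := ⟨kd, F⟩ :: Y1') (fun X => lm kd F (s X)) (by simp) ?_ hk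
    intro T Z k hk
    cases hk with
    | stemL h hh _ e1 => cases hs
    | layL _ _ h hh k' hk' _ e1 =>
      refine .layL kd F h hh _ (ih hk') _ ?_
      rw [e1]; exact cong_aux kd F _ h k'

theorem Cap2.stepR {D : CapData P} {Z Z' : List (Layer P)} {s : ∀ X, fill Z X ⟶ fill Z' X}
    (hs : CtxStep Z Z' s)
    {T : Form P} {Y : List (Layer P)} {k : T ⟶ fill Y D.a ⋎ fill Z D.b} (hk : Cap2 D Y Z k) :
    Cap2 D Y Z' (k ≫ dj (𝟙 (fill Y D.a)) (s D.b)) := by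
  refine Cap2.unmirror ?_
  have h := hk.mirror.step hs
  have e : (k ≫ dc (fill Y D.a) (fill Z D.b)) ≫ dj (s D.b) (𝟙 (fill Y D.a)) =
    (k ≫ dj (𝟙 (fill Y D.a)) (s D.b)) ≫ dc _ _ := by
    simp only [Category.assoc]; rw [(SS Kd.dis).c_nat]
  rw [← e]
  exact h

theorem Cap2.invR {D : CapData P} {T G : Form P} {Y Z : List (Layer P)}
    {k : T ⟶ fill Y D.a ⋎ (G ⋎ fill Z D.b)} (hk : Cap2 D Y (⟨.dis, G⟩ :: Z) k) :
    ∃ (T' : Form P) (h : T ⟶ G ⋎ T') (k' : T' ⟶ fill Y D.a ⋎ fill Z D.b),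
      IsDS h ∧ Cap2 D Y Z k' ∧ k = h ≫ dj (𝟙 G) k' ≫ st' .dis G (fill Y D.a) (fill Z D.b) := by
  have hm : Cap2 D.mirror (⟨.dis, G⟩ :: Z) Y (k ≫ dc _ _) := hk.mirror
  obtain ⟨T', h, k', hh, hk', e⟩ := hm.inv
  refine ⟨T', h, k' ≫ dc (fill Z D.b) (fill Y D.a), hh, Cap2.unmirror ?_, ?_⟩
  · have e : (k' ≫ dc (fill Z D.b) (fill Y D.a)) ≫ dc (fill Y D.a) (fill Z D.b) = k' := by
      rw [Category.assoc, (SS Kd.dis).cc]; exact Category.comp_id _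
    rw [e]; exact hk'
  · have e2 : k = (k ≫ dc (fill Y D.a) (G ⋎ fill Z D.b)) ≫ dc (G ⋎ fill Z D.b) (fill Y D.a) := by
      rw [Category.assoc, (SS Kd.dis).cc]; exact (Category.comp_id _).symm
    refine e2.trans ?_
    have h3 := mir_aux3 .dis G h k'
    rw [e]
    exact h3

end Steps
end PNL


namespace PNL

open CategoryTheory

section CapSteps
variable {P : Type}

inductive Cap (D : CapData P) : ∀ {T : Form P} (N Y Z : List (Layer P)),
    (T ⟶ fill N (fill Y D.a ⋎ fill Z D.b)) → Prop
  | split {T : Form P} {Y Z : List (Layer P)} (k : T ⟶ fill Y D.a ⋎ fill Z D.b)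
      (hk : Cap2 D Y Z k) : Cap D [] Y Z k
  | stem {T S : Form P} (h : T ⟶ S) (hh : IsDS h) (k : T ⟶ S ⋏ (D.a ⋎ D.b))
      (e : k = h ≫ D.cap S) : Cap D [⟨.con, S⟩] [] [] k
  | lay {T T' : Form P} (kd : Kd) (F : Form P) {N Y Z : List (Layer P)} (h : T ⟶ op kd F T')
      (hh : IsDS h) (k' : T' ⟶ fill N (fill Y D.a ⋎ fill Z D.b)) (hk : Cap D N Y Z k')
      (k : T ⟶ op kd F (fill N (fill Y D.a ⋎ fill Z D.b)))
      (e : k = h ≫ lm kd F k') : Cap D (⟨kd, F⟩ :: N) Y Z k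

theorem n_as (kd : Kd) (F G : Form P) {T T' T1 X : Form P} (h : T ⟶ op kd F T')
    (h1 : T' ⟶ op kd G T1) (k1 : T1 ⟶ X) :
    (h ≫ lm kd F (h1 ≫ lm kd G k1)) ≫ (SS kd).a F G X =
    (h ≫ lm kd F h1 ≫ (SS kd).a F G T1) ≫ lm kd (op kd F G) k1 := by
  have h2 := (SS kd).a_nat (𝟙 F) (𝟙 G) k1
  rw [(SS kd).m_id] at h2
  rw [lm_comp]
  simp only [Category.assoc]
  rw [h2]

theorem n_as' (kd : Kd) (F G : Form P) {T T1 X : Form P} (h : T ⟶ op kd (op kd F G) T1)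
    (k1 : T1 ⟶ X) :
    (h ≫ lm kd (op kd F G) k1) ≫ (SS kd).a' F G X =
    (h ≫ (SS kd).a' F G T1) ≫ lm kd F (lm kd G k1) := by
  have h2 := (SS kd).a'_nat (𝟙 F) (𝟙 G) k1
  rw [(SS kd).m_id] at h2
  simp only [Category.assoc]
  rw [h2]

theorem n_dd (F G : Form P) {T T' T1 X : Form P} (h : T ⟶ F ⋏ T')
    (h1 : T' ⟶ G ⋎ T1) (k1 : T1 ⟶ X) :
    (h ≫ lm Kd.con F (h1 ≫ lm Kd.dis G k1)) ≫ st' .con F G X =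
    (h ≫ lm Kd.con F h1 ≫ st' .con F G T1) ≫ lm Kd.dis G (lm Kd.con F k1) := by
  have h3 := st'_nat .con F (𝟙 G) k1
  rw [lm_comp]
  simp only [Category.assoc]
  rw [← h3]

theorem n_d6 (F G : Form P) {T T' T1 X : Form P} (h : T ⟶ F ⋏ T')
    (h1 : T' ⟶ G ⋎ T1) (k1 : T1 ⟶ X) :
    (h ≫ lm Kd.con F (h1 ≫ lm Kd.dis G k1)) ≫ st .con F G X =
    (h ≫ lm Kd.con F h1 ≫ st .con F G T1) ≫ lm Kd.dis (F ⋏ G) k1 := by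
  have h3 := st_nat .con F (𝟙 G) k1
  rw [lm_id] at h3
  rw [lm_comp]
  simp only [Category.assoc]
  rw [← h3]

theorem n_dr (C B : Form P) {T T' X : Form P} (h : T ⟶ (C ⋎ B) ⋏ T') (k1 : T' ⟶ X) :
    (h ≫ lm Kd.con (C ⋎ B) k1) ≫ dr C B X =
    (h ≫ dr C B T') ≫ lm Kd.dis C (lm Kd.con B k1) := by
  have h3 := dr_nat (𝟙 C) (𝟙 B) k1
  rw [(SS Kd.dis).m_id] at h3
  simp only [Category.assoc]
  rw [h3]

theorem n_side (kd : Kd) {F F' : Form P} (e : F ⟶ F') {T T' X : Form P} (h : T ⟶ op kd F T')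
    (k1 : T' ⟶ X) :
    (h ≫ lm kd F k1) ≫ (SS kd).m e (𝟙 X) = (h ≫ (SS kd).m e (𝟙 T')) ≫ lm kd F' k1 := by
  simp only [Category.assoc, (SS kd).m_comp]
  simp

theorem Cap.stepN {D : CapData P} {N N' : List (Layer P)} {s : ∀ X, fill N X ⟶ fill N' X}
    (hs : CtxStep N N' s) {T : Form P} {Y Z : List (Layer P)}
    {k : T ⟶ fill N (fill Y D.a ⋎ fill Z D.b)} (hk : Cap D N Y Z k) :
    Cap D N' Y Z (k ≫ s _) := by
  induction hs generalizing T with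
  | assoc kd F G N =>
    cases hk with
    | lay _ _ h hh k' hk' _ e =>
      cases kd
      · cases hk' with
        | stem h1 hh1 _ e1 =>
          refine .stem (h ≫ lm Kd.con F h1) (hh.comp (.ly .con _ hh1)) _ ?_
          rw [e, e1, lm_comp]
          simp only [Category.assoc]
          rw [← D.bD' F G]
        | lay _ _ h1 hh1 k1 hk1 _ e1 =>
          refine .lay .con (F ⋏ G) (h ≫ lm Kd.con F h1 ≫ (SS Kd.con).a F G _)
            (hh.comp ((IsDS.ly .con _ hh1).comp (.a .con _ _ _))) k1 hk1 _ ?_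
          rw [e, e1]; exact n_as .con F G h h1 k1
      · cases hk' with
        | lay _ _ h1 hh1 k1 hk1 _ e1 =>
          refine .lay .dis (F ⋎ G) (h ≫ lm Kd.dis F h1 ≫ (SS Kd.dis).a F G _)
            (hh.comp ((IsDS.ly .dis _ hh1).comp (.a .dis _ _ _))) k1 hk1 _ ?_
          rw [e, e1]; exact n_as .dis F G h h1 k1
  | assoc' kd F G N =>
    cases kd
    · cases hk with
      | stem h hh _ e =>
        refine .lay .con F (N := [⟨.con, G⟩]) (Y := []) (Z := []) h hh (D.cap G)
          (.stem (𝟙 _) (.id _) _ (Category.id_comp _).symm) _ ?_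
        rw [e, Category.assoc]; exact congrArg (h ≫ ·) (D.bD F G)
      | lay _ _ h hh k' hk' _ e =>
        refine .lay .con F (N := ⟨.con, G⟩ :: N) (h ≫ (SS Kd.con).a' F G _) (hh.comp (.a' .con _ _ _))
          (lm Kd.con G k') (.lay .con G (𝟙 _) (.id _) k' hk' _ (Category.id_comp _).symm) _ ?_
        rw [e]; exact n_as' .con F G h k'
    · cases hk with
      | lay _ _ h hh k' hk' _ e =>
        refine .lay .dis F (N := ⟨.dis, G⟩ :: N) (h ≫ (SS Kd.dis).a' F G _) (hh.comp (.a' .dis _ _ _))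
          (lm Kd.dis G k') (.lay .dis G (𝟙 _) (.id _) k' hk' _ (Category.id_comp _).symm) _ ?_
        rw [e]; exact n_as' .dis F G h k'
  | dd F G N =>
    cases hk with
    | lay _ _ h hh k' hk' _ e =>
      cases hk' with
      | lay _ _ h1 hh1 k1 hk1 _ e1 =>
        refine .lay .dis G (N := ⟨.con, F⟩ :: N) (h ≫ lm Kd.con F h1 ≫ st' .con F G _)
            (hh.comp ((IsDS.ly .con _ hh1).comp (.st' .con _ _ _)))
          (lm Kd.con F k1) (.lay .con F (𝟙 _) (.id _) k1 hk1 _ (Category.id_comp _).symm) _ ?_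
        rw [e, e1]; exact n_dd F G h h1 k1
  | d6 F G N =>
    cases hk with
    | lay _ _ h hh k' hk' _ e =>
      cases hk' with
      | lay _ _ h1 hh1 k1 hk1 _ e1 =>
        refine .lay .dis (F ⋏ G) (h ≫ lm Kd.con F h1 ≫ st .con F G _)
            (hh.comp ((IsDS.ly .con _ hh1).comp (.st .con _ _ _))) k1 hk1 _ ?_
        rw [e, e1]; exact n_d6 F G h h1 k1
  | dr C B N =>
    cases hk with
    | stem h hh _ e =>
      refine .lay .dis C (N := [⟨.con, B⟩]) (Y := []) (Z := []) h hh (D.cap B)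
          (.stem (𝟙 _) (.id _) _ (Category.id_comp _).symm) _ ?_
      rw [e, Category.assoc]; exact congrArg (h ≫ ·) (D.dD C B)
    | lay _ _ h hh k' hk' _ e =>
      refine .lay .dis C (N := ⟨.con, B⟩ :: N) (h ≫ PNL.dr C B _) (hh.comp (.dr _ _ _))
        (lm Kd.con B k') (.lay .con B (𝟙 _) (.id _) k' hk' _ (Category.id_comp _).symm) _ ?_
      rw [e]; exact n_dr C B h k'
  | side kd e he N =>
    cases hk with
    | stem h hh _ e1 =>
      refine .stem (h ≫ e) (hh.comp he) _ ?_
      rw [e1, Category.assoc, Category.assoc, D.nat]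
    | lay _ _ h hh k' hk' _ e1 =>
      refine .lay kd _ (h ≫ (SS kd).m e (𝟙 _)) (hh.comp (.m kd he (.id _))) k' hk' _ ?_
      rw [e1]; exact n_side kd e h k'
  | cong kd F hs ih =>
    cases hk with
    | stem h hh _ e1 => cases hs
    | lay _ _ h hh k' hk' _ e1 =>
      refine .lay kd F h hh _ (ih hk') _ ?_
      rw [e1, lm_comp, Category.assoc]

inductive Step3 (a b : Form P) : ∀ (N Y Z N' Y' Z' : List (Layer P)),
    (fill N (fill Y a ⋎ fill Z b) ⟶ fill N' (fill Y' a ⋎ fill Z' b)) → Prop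
  | nctx {N N' : List (Layer P)} {s : ∀ X, fill N X ⟶ fill N' X} (hs : CtxStep N N' s)
      (Y Z : List (Layer P)) : Step3 a b N Y Z N' Y Z (s (fill Y a ⋎ fill Z b))
  | yctx {Y Y' : List (Layer P)} {s : ∀ X, fill Y X ⟶ fill Y' X} (hs : CtxStep Y Y' s)
      (Z : List (Layer P)) : Step3 a b [] Y Z [] Y' Z (dj (s a) (𝟙 (fill Z b)))
  | zctx {Z Z' : List (Layer P)} {s : ∀ X, fill Z X ⟶ fill Z' X} (hs : CtxStep Z Z' s)
      (Y : List (Layer P)) : Step3 a b [] Y Z [] Y Z' (dj (𝟙 (fill Y a)) (s b))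
  | layY (kd : Kd) (F : Form P) (Y Z : List (Layer P)) :
      Step3 a b [⟨kd, F⟩] Y Z [] (⟨kd, F⟩ :: Y) Z (st kd F (fill Y a) (fill Z b))
  | layZ (kd : Kd) (F : Form P) (Y Z : List (Layer P)) :
      Step3 a b [⟨kd, F⟩] Y Z [] Y (⟨kd, F⟩ :: Z) (st' kd F (fill Y a) (fill Z b))
  | unY (F : Form P) (Y Z : List (Layer P)) :
      Step3 a b [] (⟨.dis, F⟩ :: Y) Z [⟨.dis, F⟩] Y Z (db F (fill Y a) (fill Z b))
  | unZ (F : Form P) (Y Z : List (Layer P)) :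
      Step3 a b [] Y (⟨.dis, F⟩ :: Z) [⟨.dis, F⟩] Y Z ((SS Kd.dis).b (fill Y a) F (fill Z b))
  | cong (kd : Kd) (F : Form P) {N Y Z N' Y' Z' : List (Layer P)}
      {σ : fill N (fill Y a ⋎ fill Z b) ⟶ fill N' (fill Y' a ⋎ fill Z' b)}
      (hσ : Step3 a b N Y Z N' Y' Z' σ) :
      Step3 a b (⟨kd, F⟩ :: N) Y Z (⟨kd, F⟩ :: N') Y' Z' (lm kd F σ)

theorem unY_aux {T T' F X W : Form P} (h : T ⟶ F ⋎ T') (k : T' ⟶ X ⋎ W) :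
    (h ≫ dj (𝟙 F) k ≫ da F X W) ≫ db F X W = h ≫ dj (𝟙 F) k := by
  simp only [Category.assoc]
  rw [(SS Kd.dis).aa']; simp

theorem unZ_aux {T T' F X W : Form P} (h : T ⟶ F ⋎ T') (k : T' ⟶ X ⋎ W) :
    (h ≫ dj (𝟙 F) k ≫ st' .dis F X W) ≫ (SS Kd.dis).b X F W = h ≫ dj (𝟙 F) k := by
  simp only [Category.assoc]
  have : st' .dis F X W ≫ (SS Kd.dis).b X F W = 𝟙 _ := (SS Kd.dis).b_b F X W
  rw [this]; simp

theorem Cap.step3 {D : CapData P} {N Y Z N' Y' Z' : List (Layer P)}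
    {σ : fill N (fill Y D.a ⋎ fill Z D.b) ⟶ fill N' (fill Y' D.a ⋎ fill Z' D.b)}
    (hs : Step3 D.a D.b N Y Z N' Y' Z' σ) {T : Form P}
    {k : T ⟶ fill N (fill Y D.a ⋎ fill Z D.b)} (hk : Cap D N Y Z k) :
    Cap D N' Y' Z' (k ≫ σ) := by
  induction hs generalizing T with
  | nctx hs Y Z => exact hk.stepN hs
  | yctx hs Z =>
    cases hk with
    | split _ hk => exact .split _ (hk.step hs)
  | zctx hs Y =>
    cases hk with
    | split _ hk => exact .split _ (hk.stepR hs)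
  | layY kd F Y Z =>
    cases hk with
    | stem h hh _ e => exact .split _ (.stemL h hh _ (by rw [e]; exact Category.assoc _ _ _))
    | lay _ _ h hh k' hk' _ e =>
      cases hk' with
      | split _ hk' => exact .split _ (.layL kd F h hh k' hk' _ (by rw [e]; exact Category.assoc _ _ _))
  | layZ kd F Y Z =>
    cases hk with
    | stem h hh _ e => exact .split _ (.stemR h hh _ (by rw [e]; exact Category.assoc _ _ _))
    | lay _ _ h hh k' hk' _ e =>
      cases hk' with
      | split _ hk' => exact .split _ (.layR kd F h hh k' hk' _ (by rw [e]; exact Category.assoc _ _ _))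
  | unY F Y Z =>
    cases hk with
    | split _ hk =>
      obtain ⟨T', h, k', hh, hk', e⟩ := hk.inv
      refine .lay .dis F (N := []) h hh k' (.split _ hk') _ ?_
      rw [e]; exact unY_aux h k'
  | unZ F Y Z =>
    cases hk with
    | split _ hk =>
      obtain ⟨T', h, k', hh, hk', e⟩ := hk.invR
      refine .lay .dis F (N := []) h hh k' (.split _ hk') _ ?_
      rw [e]; exact unZ_aux h k'
  | cong kd F hs ih =>
    cases hk with
    | stem h hh _ e1 =>
      cases hs with
      | nctx hs => cases hs
      | yctx hs => cases hs
      | zctx hs => cases hs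
    | lay _ _ h hh k' hk' _ e1 =>
      refine .lay kd F h hh _ (ih hk') _ ?_
      rw [e1, lm_comp, Category.assoc]

inductive CtxChain : ∀ (Y Y' : List (Layer P)), (∀ X, fill Y X ⟶ fill Y' X) → Prop
  | refl (Y : List (Layer P)) : CtxChain Y Y (fun X => 𝟙 (fill Y X))
  | step {Y Y' : List (Layer P)} {s : ∀ X, fill Y X ⟶ fill Y' X} (hs : CtxStep Y Y' s) :
      CtxChain Y Y' s
  | trans {Y Y' Y'' : List (Layer P)} {s : ∀ X, fill Y X ⟶ fill Y' X}
      {t : ∀ X, fill Y' X ⟶ fill Y'' X} (hs : CtxChain Y Y' s) (ht : CtxChain Y' Y'' t) :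
      CtxChain Y Y'' (fun X => s X ≫ t X)

theorem CtxChain.cong (kd : Kd) (F : Form P) {Y Y' : List (Layer P)}
    {s : ∀ X, fill Y X ⟶ fill Y' X} (hs : CtxChain Y Y' s) :
    CtxChain (⟨kd, F⟩ :: Y) (⟨kd, F⟩ :: Y') (fun X => lm kd F (s X)) := by
  induction hs with
  | refl Y =>
    have : (fun X => lm kd F (𝟙 (fill Y X))) = fun X => 𝟙 (fill (⟨kd, F⟩ :: Y) X) := by
      funext X; exact lm_id _ _ _
    rw [this]; exact .refl _
  | step hs => exact .step (.cong kd F hs)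
  | trans hs ht ih1 ih2 =>
    have := CtxChain.trans ih1 ih2
    convert this using 2
    exact lm_comp _ _ _ _

theorem CtxChain.nat {Y Y' : List (Layer P)} {s : ∀ X, fill Y X ⟶ fill Y' X} (h : CtxChain Y Y' s)
    {X X' : Form P} (f : X ⟶ X') : s X ≫ fmap Y' f = fmap Y f ≫ s X' := by
  induction h with
  | refl Y => simp
  | step hs => exact hs.nat f
  | trans _ _ ih1 ih2 => rw [Category.assoc, ih2, ← Category.assoc, ih1, Category.assoc]

inductive Chain3 (a b : Form P) : ∀ (N Y Z N' Y' Z' : List (Layer P)),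
    (fill N (fill Y a ⋎ fill Z b) ⟶ fill N' (fill Y' a ⋎ fill Z' b)) → Prop
  | refl (N Y Z : List (Layer P)) : Chain3 a b N Y Z N Y Z (𝟙 _)
  | step {N Y Z N' Y' Z' : List (Layer P)}
      {σ : fill N (fill Y a ⋎ fill Z b) ⟶ fill N' (fill Y' a ⋎ fill Z' b)}
      (hσ : Step3 a b N Y Z N' Y' Z' σ) : Chain3 a b N Y Z N' Y' Z' σ
  | trans {N Y Z N' Y' Z' N'' Y'' Z'' : List (Layer P)}
      {σ : fill N (fill Y a ⋎ fill Z b) ⟶ fill N' (fill Y' a ⋎ fill Z' b)}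
      {τ : fill N' (fill Y' a ⋎ fill Z' b) ⟶ fill N'' (fill Y'' a ⋎ fill Z'' b)}
      (hσ : Chain3 a b N Y Z N' Y' Z' σ) (hτ : Chain3 a b N' Y' Z' N'' Y'' Z'' τ) :
      Chain3 a b N Y Z N'' Y'' Z'' (σ ≫ τ)

theorem Cap.chain3 {D : CapData P} {N Y Z N' Y' Z' : List (Layer P)}
    {σ : fill N (fill Y D.a ⋎ fill Z D.b) ⟶ fill N' (fill Y' D.a ⋎ fill Z' D.b)}
    (hs : Chain3 D.a D.b N Y Z N' Y' Z' σ) {T : Form P}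
    {k : T ⟶ fill N (fill Y D.a ⋎ fill Z D.b)} (hk : Cap D N Y Z k) :
    Cap D N' Y' Z' (k ≫ σ) := by
  induction hs with
  | refl => rw [Category.comp_id]; exact hk
  | step hs => exact hk.step3 hs
  | trans _ _ ih1 ih2 => rw [← Category.assoc]; exact ih2 (ih1 hk)

theorem Chain3.cong {a b : Form P} (kd : Kd) (F : Form P) {N Y Z N' Y' Z' : List (Layer P)}
    {σ : fill N (fill Y a ⋎ fill Z b) ⟶ fill N' (fill Y' a ⋎ fill Z' b)}
    (hσ : Chain3 a b N Y Z N' Y' Z' σ) :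
    Chain3 a b (⟨kd, F⟩ :: N) Y Z (⟨kd, F⟩ :: N') Y' Z' (lm kd F σ) := by
  induction hσ with
  | refl N Y Z =>
    have : lm kd F (𝟙 (fill N (fill Y a ⋎ fill Z b))) = 𝟙 _ := lm_id _ _ _
    rw [this]; exact .refl _ _ _
  | step hs => exact .step (.cong kd F hs)
  | trans _ _ ih1 ih2 => rw [lm_comp]; exact .trans ih1 ih2

theorem Chain3.nctx {a b : Form P} {N N' : List (Layer P)} {s : ∀ X, fill N X ⟶ fill N' X}
    (hs : CtxChain N N' s)
    (Y Z : List (Layer P)) : Chain3 a b N Y Z N' Y Z (s (fill Y a ⋎ fill Z b)) := by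
  induction hs with
  | refl N => exact .refl _ _ _
  | step hs => exact .step (.nctx hs _ _)
  | trans _ _ ih1 ih2 => exact .trans ih1 ih2

theorem Chain3.yctx {a b : Form P} {Y Y' : List (Layer P)} {s : ∀ X, fill Y X ⟶ fill Y' X}
    (hs : CtxChain Y Y' s)
    (Z : List (Layer P)) : Chain3 a b [] Y Z [] Y' Z (dj (s a) (𝟙 (fill Z b))) := by
  induction hs with
  | refl Y => rw [(SS Kd.dis).m_id]; exact .refl [] _ _
  | step hs => exact .step (.yctx hs _)
  | trans _ _ ih1 ih2 => rw [Sym.m_left]; exact .trans ih1 ih2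

theorem Chain3.zctx {a b : Form P} {Z Z' : List (Layer P)} {s : ∀ X, fill Z X ⟶ fill Z' X}
    (hs : CtxChain Z Z' s)
    (Y : List (Layer P)) : Chain3 a b [] Y Z [] Y Z' (dj (𝟙 (fill Y a)) (s b)) := by
  induction hs with
  | refl Y => rw [(SS Kd.dis).m_id]; exact .refl [] _ _
  | step hs => exact .step (.zctx hs _)
  | trans _ _ ih1 ih2 => rw [Sym.m_right]; exact .trans ih1 ih2

theorem un_dc (F X W : Form P) :
    dc (F ⋎ X) W ≫ (SS Kd.dis).b W F X = db F X W ≫ lm Kd.dis F (dc X W) := by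
  have h : lm Kd.dis F (dc X W) ≫ (SS Kd.dis).b F W X = da F X W ≫ dc _ _ := st'_dc .dis F X W
  have h2 := congrArg (fun z => db F X W ≫ z ≫ (SS Kd.dis).b W F X) h
  simp only [Category.assoc] at h2
  rw [(SS Kd.dis).b_b, (SS Kd.dis).a'a_assoc, Category.comp_id] at h2
  exact h2.symm

theorem un_dc' (F X W : Form P) :
    dc W (F ⋎ X) ≫ db F X W = (SS Kd.dis).b W F X ≫ lm Kd.dis F (dc W X) := by
  have h := un_dc F X W
  have h2 := congrArg (fun z => dc W (F ⋎ X) ≫ z ≫ lm Kd.dis F (dc W X)) h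
  simp only [Category.assoc] at h2
  rw [(SS Kd.dis).cc_assoc, ← lm_comp, (SS Kd.dis).cc, lm_id, Category.comp_id] at h2
  exact h2.symm

theorem Step3.mirror {a b : Form P} {N Y Z N' Y' Z' : List (Layer P)}
    {σ : fill N (fill Y a ⋎ fill Z b) ⟶ fill N' (fill Y' a ⋎ fill Z' b)}
    (hσ : Step3 a b N Y Z N' Y' Z' σ) :
    ∃ τ : fill N (fill Z b ⋎ fill Y a) ⟶ fill N' (fill Z' b ⋎ fill Y' a),
      Step3 b a N Z Y N' Z' Y' τ ∧ fmap N (dc _ _) ≫ τ = σ ≫ fmap N' (dc _ _) := by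
  induction hσ with
  | nctx hs Y Z => exact ⟨_, .nctx hs Z Y, (hs.nat _).symm⟩
  | yctx hs Z => exact ⟨_, .zctx hs Z, ((SS Kd.dis).c_nat _ _)⟩
  | zctx hs Y => exact ⟨_, .yctx hs Y, ((SS Kd.dis).c_nat _ _)⟩
  | layY kd F Y Z => exact ⟨_, .layZ kd F Z Y, st'_dc kd F _ _⟩
  | layZ kd F Y Z => exact ⟨_, .layY kd F Z Y, st_dc kd F _ _⟩
  | unY F Y Z => exact ⟨_, .unZ F Z Y, un_dc F _ _⟩
  | unZ F Y Z => exact ⟨_, .unY F Z Y, un_dc' F _ _⟩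
  | cong kd F _ ih =>
    obtain ⟨τ, h, e⟩ := ih
    refine ⟨_, .cong kd F h, ?_⟩
    have := congrArg (fun z => lm kd F z) e
    exact (lm_comp _ _ _ _).symm.trans (this.trans (lm_comp _ _ _ _))

theorem Chain3.mirror {a b : Form P} {N Y Z N' Y' Z' : List (Layer P)}
    {σ : fill N (fill Y a ⋎ fill Z b) ⟶ fill N' (fill Y' a ⋎ fill Z' b)}
    (hσ : Chain3 a b N Y Z N' Y' Z' σ) :
    ∃ τ : fill N (fill Z b ⋎ fill Y a) ⟶ fill N' (fill Z' b ⋎ fill Y' a),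
      Chain3 b a N Z Y N' Z' Y' τ ∧ fmap N (dc _ _) ≫ τ = σ ≫ fmap N' (dc _ _) := by
  induction hσ with
  | refl => exact ⟨_, .refl _ _ _, by simp⟩
  | step hs =>
    obtain ⟨τ, h, e⟩ := hs.mirror
    exact ⟨τ, .step h, e⟩
  | trans _ _ ih1 ih2 =>
    obtain ⟨τ, h, e⟩ := ih1
    obtain ⟨τ2, h2, e2⟩ := ih2
    exact ⟨_, .trans h h2, by rw [← Category.assoc, e, Category.assoc, e2, Category.assoc]⟩

end CapSteps
end PNL


namespace PNL

open CategoryTheory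

section Presentations
variable {P : Type}

inductive Pres {X : Form P} (R : ∀ M : Form P, (X ⟶ M) → Prop) :
    ∀ (Y : List (Layer P)) (M : Form P), (fill Y X ⟶ M) → Prop
  | base (M : Form P) (φ : X ⟶ M) (h : R M φ) : Pres R [] M φ
  | conL (F : Form P) {Y : List (Layer P)} {M : Form P} {φ : fill Y X ⟶ M} (h : Pres R Y M φ)
      (ψ : F ⋏ fill Y X ⟶ F ⋏ M) (e : ψ = lm Kd.con F φ) : Pres R (⟨.con, F⟩ :: Y) (F ⋏ M) ψ
  | conR (F : Form P) {Y : List (Layer P)} {M : Form P} {φ : fill Y X ⟶ M} (h : Pres R Y M φ)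
      (ψ : F ⋏ fill Y X ⟶ M ⋏ F) (e : ψ = lm Kd.con F φ ≫ cs F M) :
      Pres R (⟨.con, F⟩ :: Y) (M ⋏ F) ψ
  | disL (F : Form P) {Y : List (Layer P)} {M : Form P} {φ : fill Y X ⟶ M} (h : Pres R Y M φ)
      (ψ : F ⋎ fill Y X ⟶ F ⋎ M) (e : ψ = lm Kd.dis F φ) : Pres R (⟨.dis, F⟩ :: Y) (F ⋎ M) ψ
  | disR (F : Form P) {Y : List (Layer P)} {M : Form P} {φ : fill Y X ⟶ M} (h : Pres R Y M φ)
      (ψ : F ⋎ fill Y X ⟶ M ⋎ F) (e : ψ = lm Kd.dis F φ ≫ dc F M) :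
      Pres R (⟨.dis, F⟩ :: Y) (M ⋎ F) ψ

variable {X : Form P} {R : ∀ M : Form P, (X ⟶ M) → Prop}

theorem Pres.L (kd : Kd) (F : Form P) {Y : List (Layer P)} {M : Form P} {φ : fill Y X ⟶ M}
    (h : Pres R Y M φ) : Pres R (⟨kd, F⟩ :: Y) (op kd F M) (lm kd F φ) := by
  cases kd
  · exact .conL F h _ rfl
  · exact .disL F h _ rfl

theorem Pres.Rt (kd : Kd) (F : Form P) {Y : List (Layer P)} {M : Form P} {φ : fill Y X ⟶ M}
    (h : Pres R Y M φ) : Pres R (⟨kd, F⟩ :: Y) (op kd M F) (lm kd F φ ≫ (SS kd).c F M) := by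
  cases kd
  · exact .conR F h _ rfl
  · exact .disR F h _ rfl

theorem Pres.inv (kd : Kd) {A B : Form P} (C : ∀ Y : List (Layer P), (fill Y X ⟶ op kd A B) → Prop)
    (Hb : ∀ φ, R (op kd A B) φ → C [] φ)
    (HL : ∀ Y φ, Pres R Y B φ → C (⟨kd, A⟩ :: Y) (lm kd A φ))
    (HR : ∀ Y φ, Pres R Y A φ → C (⟨kd, B⟩ :: Y) (lm kd B φ ≫ (SS kd).c B A))
    {Y : List (Layer P)} {φ : fill Y X ⟶ op kd A B} (h : Pres R Y (op kd A B) φ) : C Y φ := by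
  cases kd
  · cases h with
    | base _ _ h => exact Hb _ h
    | conL _ h _ e => rw [e]; exact HL _ _ h
    | conR _ h _ e => rw [e]; exact HR _ _ h
  · cases h with
    | base _ _ h => exact Hb _ h
    | disL _ h _ e => rw [e]; exact HL _ _ h
    | disR _ h _ e => rw [e]; exact HR _ _ h

def Adv (R : ∀ M : Form P, (X ⟶ M) → Prop) (Y : List (Layer P)) {M M' : Form P}
    (φ : fill Y X ⟶ M) (f : M ⟶ M') : Prop :=
  ∃ (Y' : List (Layer P)) (φ' : fill Y' X ⟶ M') (s : ∀ X, fill Y X ⟶ fill Y' X),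
    CtxChain Y Y' s ∧ Pres R Y' M' φ' ∧ φ ≫ f = s X ≫ φ'

theorem qa1 (kd : Kd) (A B : Form P) {Z C : Form P} (φ : Z ⟶ C) :
    lm kd A (lm kd B φ) ≫ (SS kd).a A B C = (SS kd).a A B Z ≫ lm kd (op kd A B) φ := by
  have h2 := (SS kd).a_nat (𝟙 A) (𝟙 B) φ
  rw [(SS kd).m_id] at h2
  exact h2.symm

theorem qa2 (kd : Kd) (A C : Form P) {Z B : Form P} (φ : Z ⟶ B) :
    lm kd A (lm kd C φ ≫ (SS kd).c C B) ≫ (SS kd).a A B C =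
      ((SS kd).a A C Z ≫ (SS kd).m ((SS kd).c A C) (𝟙 Z) ≫ (SS kd).a' C A Z) ≫
        lm kd C (lm kd A φ) ≫ (SS kd).c C (op kd A B) := by
  have h := (SS kd).g1 A C B
  have h2 := (SS kd).b_nat (𝟙 A) (𝟙 C) φ
  rw [Sym.b_eq, Sym.b_eq] at h2
  have h3 := congrArg (fun z => z ≫ (SS kd).c C (op kd A B)) h2
  rw [lm_comp]
  simp only [Category.assoc] at h3 ⊢
  exact (congrArg (fun z => lm kd A (lm kd C φ) ≫ z) h).trans h3.symm

theorem qa3 (kd : Kd) (B C : Form P) {Z A : Form P} (φ : Z ⟶ A) :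
    (lm kd (op kd B C) φ ≫ (SS kd).c (op kd B C) A) ≫ (SS kd).a A B C =
      ((SS kd).m ((SS kd).c B C) (𝟙 Z) ≫ (SS kd).a' C B Z) ≫
        lm kd C (lm kd B φ ≫ (SS kd).c B A) ≫ (SS kd).c C (op kd A B) := by
  have h := (SS kd).g2 B C A
  have h2 := (SS kd).a'_nat (𝟙 C) (𝟙 B) φ
  rw [(SS kd).m_id] at h2
  rw [lm_comp]
  simp only [Category.assoc]
  have hx : (SS kd).m ((SS kd).c B C) (𝟙 Z) ≫ lm kd (op kd C B) φ =
      lm kd (op kd B C) φ ≫ (SS kd).m ((SS kd).c B C) (𝟙 A) := by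
    rw [(SS kd).m_comp, (SS kd).m_comp]; simp
  rw [reassoc_of% h2, reassoc_of% hx, h]

theorem ca'_eq (kd : Kd) (A B C : Form P) :
    (SS kd).c C (op kd A B) ≫ (SS kd).a' A B C =
      (SS kd).b C A B ≫ (SS kd).m (𝟙 A) ((SS kd).c C B) := by
  have h := (SS kd).g1 A C B
  have hb := (SS kd).b_eq A C B
  have h2 := congrArg (fun z => (SS kd).b C A B ≫ z ≫ (SS kd).a' A B C) h
  have h3 : (SS kd).a A C B ≫ (SS kd).m ((SS kd).c A C) (𝟙 B) ≫ (SS kd).a' C A B ≫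
      (SS kd).c C (op kd A B) = (SS kd).b A C B ≫ (SS kd).c C (op kd A B) := by
    rw [hb]; simp only [Category.assoc]
  rw [h3] at h2
  have h4 := (SS kd).b_b C A B
  simp only [Category.assoc] at h2
  rw [reassoc_of% h4, (SS kd).aa', Category.comp_id] at h2
  exact h2.symm

theorem qa'1 (kd : Kd) (A B : Form P) {Z C : Form P} (φ : Z ⟶ C) :
    lm kd (op kd A B) φ ≫ (SS kd).a' A B C = (SS kd).a' A B Z ≫ lm kd A (lm kd B φ) := by
  have h2 := (SS kd).a'_nat (𝟙 A) (𝟙 B) φ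
  rw [(SS kd).m_id] at h2
  exact h2.symm

theorem qa'2 (kd : Kd) (A C : Form P) {Z B : Form P} (φ : Z ⟶ B) :
    (lm kd C (lm kd A φ) ≫ (SS kd).c C (op kd A B)) ≫ (SS kd).a' A B C =
      ((SS kd).a C A Z ≫ (SS kd).m ((SS kd).c C A) (𝟙 Z) ≫ (SS kd).a' A C Z) ≫
        lm kd A (lm kd C φ ≫ (SS kd).c C B) := by
  have h2 := (SS kd).b_nat (𝟙 C) (𝟙 A) φ
  rw [Category.assoc, ca'_eq, lm_comp, ← Sym.b_eq, ← reassoc_of% h2]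

theorem qa'3 (kd : Kd) (B C : Form P) {Z A : Form P} (φ : Z ⟶ A) :
    (lm kd C (lm kd B φ ≫ (SS kd).c B A) ≫ (SS kd).c C (op kd A B)) ≫ (SS kd).a' A B C =
      ((SS kd).a C B Z ≫ (SS kd).m ((SS kd).c C B) (𝟙 Z)) ≫
      lm kd (op kd B C) φ ≫ (SS kd).c (op kd B C) A := by
  have h := qa3 kd B C φ
  have h2 := congrArg (fun z => ((SS kd).a C B Z ≫ (SS kd).m ((SS kd).c C B) (𝟙 Z)) ≫
    z ≫ (SS kd).a' A B C) h
  simp only [Category.assoc] at h2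
  rw [(SS kd).aa', Category.comp_id, ← Category.assoc ((SS kd).m ((SS kd).c C B) (𝟙 Z)) ((SS kd).m ((SS kd).c B C) (𝟙 Z)), (SS kd).cR_cR,
    Category.id_comp, (SS kd).aa'_assoc] at h2
  simp only [Category.assoc]
  exact h2.symm

theorem qc (kd : Kd) (B : Form P) {Z A : Form P} (φ : Z ⟶ A) :
    (lm kd B φ ≫ (SS kd).c B A) ≫ (SS kd).c A B = 𝟙 _ ≫ lm kd B φ := by
  rw [Category.assoc, (SS kd).cc]; simp

theorem qd1 (A B : Form P) {Z C : Form P} (φ : Z ⟶ C) :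
    lm Kd.con A (lm Kd.dis B φ) ≫ st .con A B C = st .con A B Z ≫ lm Kd.dis (A ⋏ B) φ := by
  have h3 := st_nat .con A (𝟙 B) φ
  rw [lm_id] at h3
  exact h3.symm

theorem qd2 (A C : Form P) {Z B : Form P} (φ : Z ⟶ B) :
    lm Kd.con A (lm Kd.dis C φ ≫ dc C B) ≫ st .con A B C =
      st' .con A C Z ≫ lm Kd.dis C (lm Kd.con A φ) ≫ dc C (A ⋏ B) := by
  have h3 := st'_nat .con A (𝟙 C) φ
  rw [lm_comp, Category.assoc, st_dc, reassoc_of% h3]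

theorem qd3 (B C : Form P) {Z A : Form P} (φ : Z ⟶ A) :
    (lm Kd.con (B ⋎ C) φ ≫ cs (B ⋎ C) A) ≫ st .con A B C =
      (cj (dc B C) (𝟙 Z) ≫ dr C B Z) ≫ lm Kd.dis C (lm Kd.con B φ ≫ cs B A) ≫ dc C (A ⋏ B) := by
  have h3 := dr_nat (𝟙 C) (𝟙 B) φ
  rw [(SS Kd.dis).m_id] at h3
  have h4 : cs (B ⋎ C) A ≫ st .con A B C = cj (dc B C) (𝟙 A) ≫ dr C B A ≫ lm Kd.dis C (cs B A) ≫
      dc C (A ⋏ B) := by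
    rw [dr_eq]
    simp only [Category.assoc]
    have h5 : lm Kd.dis C (cs A B) ≫ lm Kd.dis C (cs B A) = 𝟙 _ := by
      rw [← lm_comp, (SS Kd.con).cc, lm_id]
    rw [reassoc_of% h5, ← st_dc, ← Category.assoc (cj _ _), ← (SS Kd.con).c_nat]
    have h6 : lm Kd.con A (dc B C) ≫ lm Kd.con A (dc C B) = 𝟙 _ := by
      rw [← lm_comp, (SS Kd.dis).cc, lm_id]
    simp only [Category.assoc]
    rw [reassoc_of% h6]
  rw [Category.assoc, h4, lm_comp]
  simp only [Category.assoc]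
  have hx : cj (dc B C) (𝟙 Z) ≫ lm Kd.con (C ⋎ B) φ =
      lm Kd.con (B ⋎ C) φ ≫ cj (dc B C) (𝟙 A) := by
    rw [(SS Kd.con).m_comp, (SS Kd.con).m_comp]; simp
  rw [reassoc_of% h3, reassoc_of% hx]

section prims
variable {R : ∀ M : Form P, (X ⟶ M) → Prop}

theorem Pres.a_cases (kd : Kd) {A B C : Form P}
    (Q : ∀ Y : List (Layer P), (fill Y X ⟶ op kd A (op kd B C)) → Prop)
    (H0 : ∀ φ, R (op kd A (op kd B C)) φ → Q [] φ)
    (H1 : ∀ φ, R (op kd B C) φ → Q [⟨kd, A⟩] (lm kd A φ))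
    (H : ∀ Y φ, Adv R Y φ ((SS kd).a A B C) → Q Y φ)
    {Y : List (Layer P)} {φ : fill Y X ⟶ op kd A (op kd B C)}
    (h : Pres R Y (op kd A (op kd B C)) φ) : Q Y φ := by
  refine h.inv kd Q H0 ?_ ?_
  · intro Y φ h
    refine h.inv kd (fun Y φ => Q (⟨kd, A⟩ :: Y) (lm kd A φ)) H1 ?_ ?_
    · intro Y φ h
      exact H _ _ ⟨_, _, _, .step (.assoc kd A B Y), h.L kd _, qa1 kd A B φ⟩
    · intro Y φ h
      exact H _ _ ⟨_, _, _, .trans (.step (.assoc kd A C Y))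
        (.trans (.step (.side kd _ (.c kd A C) _)) (.step (.assoc' kd C A Y))), (h.L kd A).Rt kd C,
        qa2 kd A C φ⟩
  · intro Y φ h
    exact H _ _ ⟨_, _, _, .trans (.step (.side kd _ (.c kd B C) Y)) (.step (.assoc' kd C B Y)),
      (h.Rt kd B).Rt kd C, qa3 kd B C φ⟩

theorem Pres.a'_cases (kd : Kd) {A B C : Form P}
    (Q : ∀ Y : List (Layer P), (fill Y X ⟶ op kd (op kd A B) C) → Prop)
    (H0 : ∀ φ, R (op kd (op kd A B) C) φ → Q [] φ)
    (H1 : ∀ φ, R (op kd A B) φ → Q [⟨kd, C⟩] (lm kd C φ ≫ (SS kd).c C (op kd A B)))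
    (H : ∀ Y φ, Adv R Y φ ((SS kd).a' A B C) → Q Y φ)
    {Y : List (Layer P)} {φ : fill Y X ⟶ op kd (op kd A B) C}
    (h : Pres R Y (op kd (op kd A B) C) φ) : Q Y φ := by
  refine h.inv kd Q H0 ?_ ?_
  · intro Y φ h
    exact H _ _ ⟨_, _, _, .step (.assoc' kd A B Y), (h.L kd B).L kd A, qa'1 kd A B φ⟩
  · intro Y φ h
    refine h.inv kd (fun Y φ => Q (⟨kd, C⟩ :: Y) (lm kd C φ ≫ (SS kd).c C (op kd A B))) H1 ?_ ?_
    · intro Y φ h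
      exact H _ _ ⟨_, _, _, .trans (.step (.assoc kd C A Y))
        (.trans (.step (.side kd _ (.c kd C A) _)) (.step (.assoc' kd A C Y))), (h.Rt kd C).L kd A,
        qa'2 kd A C φ⟩
    · intro Y φ h
      exact H _ _ ⟨_, _, _, .trans (.step (.assoc kd C B Y)) (.step (.side kd _ (.c kd C B) Y)),
        h.Rt kd (op kd B C), qa'3 kd B C φ⟩

theorem Pres.c_cases (kd : Kd) {A B : Form P}
    (Q : ∀ Y : List (Layer P), (fill Y X ⟶ op kd A B) → Prop)
    (H0 : ∀ φ, R (op kd A B) φ → Q [] φ)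
    (H : ∀ Y φ, Adv R Y φ ((SS kd).c A B) → Q Y φ)
    {Y : List (Layer P)} {φ : fill Y X ⟶ op kd A B}
    (h : Pres R Y (op kd A B) φ) : Q Y φ := by
  refine h.inv kd Q H0 ?_ ?_
  · intro Y φ h
    exact H _ _ ⟨_, _, _, .refl _, h.Rt kd A, (Category.id_comp _).symm⟩
  · intro Y φ h
    exact H _ _ ⟨_, _, _, .refl _, h.L kd B, qc kd B φ⟩

theorem Pres.d_cases {A B C : Form P}
    (Q : ∀ Y : List (Layer P), (fill Y X ⟶ A ⋏ (B ⋎ C)) → Prop)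
    (H0 : ∀ φ, R (A ⋏ (B ⋎ C)) φ → Q [] φ)
    (H1 : ∀ φ, R (B ⋎ C) φ → Q [⟨.con, A⟩] (lm Kd.con A φ))
    (H : ∀ Y φ, Adv R Y φ (st .con A B C) → Q Y φ)
    {Y : List (Layer P)} {φ : fill Y X ⟶ A ⋏ (B ⋎ C)}
    (h : Pres R Y (A ⋏ (B ⋎ C)) φ) : Q Y φ := by
  refine h.inv .con Q H0 ?_ ?_
  · intro Y φ h
    refine h.inv .dis (fun Y φ => Q (⟨.con, A⟩ :: Y) (lm Kd.con A φ)) H1 ?_ ?_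
    · intro Y φ h
      exact H _ _ ⟨_, _, _, .step (.d6 A B Y), h.L .dis _, qd1 A B φ⟩
    · intro Y φ h
      exact H _ _ ⟨_, _, _, .step (.dd A C Y), (h.L .con A).Rt .dis C, qd2 A C φ⟩
  · intro Y φ h
    exact H _ _ ⟨_, _, _, .trans (.step (.side .con _ (.c .dis B C) Y)) (.step (.dr C B Y)),
      (h.Rt .con B).Rt .dis C, qd3 B C φ⟩

end prims

theorem Adv.id {Y : List (Layer P)} {M : Form P} {φ : fill Y X ⟶ M} (h : Pres R Y M φ) :
    Adv R Y φ (𝟙 M) := ⟨_, _, _, .refl _, h, by simp⟩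

theorem cgL (kd : Kd) {A A' B B' Z Z' : Form P} (φ : Z ⟶ B) (f : A ⟶ A') (g : B ⟶ B') (s : Z ⟶ Z')
    (φ' : Z' ⟶ B') (h : φ ≫ g = s ≫ φ') :
    lm kd A φ ≫ (SS kd).m f g = ((SS kd).m f (𝟙 Z) ≫ lm kd A' s) ≫ lm kd A' φ' := by
  rw [Category.assoc, ← lm_comp, ← h, (SS kd).m_comp, (SS kd).m_comp]; simp

theorem cgR (kd : Kd) {A A' B B' Z Z' : Form P} (φ : Z ⟶ A) (f : A ⟶ A') (g : B ⟶ B') (s : Z ⟶ Z')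
    (φ' : Z' ⟶ A') (h : φ ≫ f = s ≫ φ') :
    (lm kd B φ ≫ (SS kd).c B A) ≫ (SS kd).m f g =
      ((SS kd).m g (𝟙 Z) ≫ lm kd B' s) ≫ lm kd B' φ' ≫ (SS kd).c B' A' := by
  rw [Category.assoc, (SS kd).c_nat, ← Category.assoc, cgL kd φ g f s φ' h]
  simp only [Category.assoc]

theorem Adv.mL (kd : Kd) {A A' B B' : Form P} {Y : List (Layer P)} {φ : fill Y X ⟶ B}
    {f : A ⟶ A'} (hf : IsDS f) {g : B ⟶ B'} (h : Adv R Y φ g) :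
    Adv R (⟨kd, A⟩ :: Y) (lm kd A φ) ((SS kd).m f g) := by
  obtain ⟨Y', φ', s, hs, hp, e⟩ := h
  exact ⟨_, _, _, .trans (.step (.side kd f hf Y)) (hs.cong kd A'), hp.L kd A', cgL kd φ f g (s X) φ' e⟩

theorem Adv.mR (kd : Kd) {A A' B B' : Form P} {Y : List (Layer P)} {φ : fill Y X ⟶ A}
    {f : A ⟶ A'} {g : B ⟶ B'} (hg : IsDS g) (h : Adv R Y φ f) :
    Adv R (⟨kd, B⟩ :: Y) (lm kd B φ ≫ (SS kd).c B A) ((SS kd).m f g) := by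
  obtain ⟨Y', φ', s, hs, hp, e⟩ := h
  exact ⟨_, _, _, .trans (.step (.side kd g hg Y)) (hs.cong kd B'), hp.Rt kd B', cgR kd φ f g (s X) φ' e⟩

/-- presentations around an atom -/
inductive R1 (X : Form P) : ∀ M : Form P, (X ⟶ M) → Prop
  | mk : R1 X X (𝟙 X)

def Atomic (X : Form P) : Prop := ∀ (kd : Kd) (A B : Form P), X ≠ op kd A B

theorem Atomic.pos (p : P) : Atomic (Form.pos p) := by
  intro kd A B h; cases kd <;> cases h

theorem Atomic.natom (p : P) : Atomic (Form.natom p) := by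
  intro kd A B h; cases kd <;> cases h

theorem R1.not {X : Form P} (hX : Atomic X) {kd : Kd} {A B : Form P} {φ : X ⟶ op kd A B}
    (h : R1 X _ φ) : False := by
  generalize hM : op kd A B = M at φ h
  cases h
  exact hX kd A B hM.symm

theorem pres1 {X : Form P} (hX : Atomic X) {M M' : Form P} (f : Term P M M') (hf : IsDSTerm f)
    {Y : List (Layer P)} {φ : fill Y X ⟶ M} (h : Pres (R1 X) Y M φ) : Adv (R1 X) Y φ (cl f) := by
  induction f generalizing Y with
  | id A => exact Adv.id h
  | comp g f ihg ihf =>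
    obtain ⟨Y', φ', s, hs, hp, e⟩ := ihf hf.2 h
    obtain ⟨Y2, φ2, s2, hs2, hp2, e2⟩ := ihg hf.1 hp
    refine ⟨_, _, _, hs.trans hs2, hp2, ?_⟩
    change φ ≫ (cl f ≫ cl g) = _
    rw [← Category.assoc, e, Category.assoc, e2, Category.assoc]
  | conj f g ihf ihg =>
    refine h.inv .con (fun Y φ => Adv (R1 X) Y φ ((SS Kd.con).m (cl f) (cl g)))
      (fun φ h => (R1.not hX (kd := .con) h).elim) ?_ ?_
    · intro Y φ h; exact (ihg hf.2 h).mL .con ⟨f, hf.1, rfl⟩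
    · intro Y φ h; exact (ihf hf.1 h).mR .con ⟨g, hf.2, rfl⟩
  | disj f g ihf ihg =>
    refine h.inv .dis (fun Y φ => Adv (R1 X) Y φ ((SS Kd.dis).m (cl f) (cl g)))
      (fun φ h => (R1.not hX (kd := .dis) h).elim) ?_ ?_
    · intro Y φ h; exact (ihg hf.2 h).mL .dis ⟨f, hf.1, rfl⟩
    · intro Y φ h; exact (ihf hf.1 h).mR .dis ⟨g, hf.2, rfl⟩
  | bConjTo A B C =>
    exact h.a_cases .con (fun Y φ => Adv (R1 X) Y φ _)
      (fun φ h => (R1.not hX (kd := .con) h).elim) (fun φ h => (R1.not hX (kd := .con) h).elim)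
      (fun Y φ h => h)
  | bConjFrom A B C =>
    exact h.a'_cases .con (fun Y φ => Adv (R1 X) Y φ _)
      (fun φ h => (R1.not hX (kd := .con) h).elim) (fun φ h => (R1.not hX (kd := .con) h).elim)
      (fun Y φ h => h)
  | bDisjTo A B C =>
    exact h.a_cases .dis (fun Y φ => Adv (R1 X) Y φ _)
      (fun φ h => (R1.not hX (kd := .dis) h).elim) (fun φ h => (R1.not hX (kd := .dis) h).elim)
      (fun Y φ h => h)
  | bDisjFrom A B C =>
    exact h.a'_cases .dis (fun Y φ => Adv (R1 X) Y φ _)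
      (fun φ h => (R1.not hX (kd := .dis) h).elim) (fun φ h => (R1.not hX (kd := .dis) h).elim)
      (fun Y φ h => h)
  | cConj A B =>
    exact h.c_cases .con (fun Y φ => Adv (R1 X) Y φ _)
      (fun φ h => (R1.not hX (kd := .con) h).elim) (fun Y φ h => h)
  | cDisj A B =>
    exact h.c_cases .dis (fun Y φ => Adv (R1 X) Y φ _)
      (fun φ h => (R1.not hX (kd := .dis) h).elim) (fun Y φ h => h)
  | d A B C =>
    exact h.d_cases (fun Y φ => Adv (R1 X) Y φ _)
      (fun φ h => (R1.not hX (kd := .con) h).elim) (fun φ h => (R1.not hX (kd := .dis) h).elim)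
      (fun Y φ h => h)
  | delta => exact hf.elim
  | sigma => exact hf.elim

end Presentations
end PNL


namespace PNL

open CategoryTheory

section Pres2
variable {P : Type}

inductive R2 (a b : Form P) (Y Z : List (Layer P)) :
    ∀ M : Form P, (fill Y a ⋎ fill Z b ⟶ M) → Prop
  | lca {M1 M2 : Form P} {φ1 : fill Y a ⟶ M1} {φ2 : fill Z b ⟶ M2}
      (h1 : Pres (R1 a) Y M1 φ1) (h2 : Pres (R1 b) Z M2 φ2) (ψ : fill Y a ⋎ fill Z b ⟶ M1 ⋎ M2)
      (e : ψ = dj φ1 φ2) : R2 a b Y Z (M1 ⋎ M2) ψ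
  | lca' {M1 M2 : Form P} {φ1 : fill Y a ⟶ M1} {φ2 : fill Z b ⟶ M2}
      (h1 : Pres (R1 a) Y M1 φ1) (h2 : Pres (R1 b) Z M2 φ2) (ψ : fill Y a ⋎ fill Z b ⟶ M2 ⋎ M1)
      (e : ψ = dj φ1 φ2 ≫ dc M1 M2) : R2 a b Y Z (M2 ⋎ M1) ψ

def Adv3 (a b : Form P) (N Y Z : List (Layer P)) {M M' : Form P}
    (ψ : fill N (fill Y a ⋎ fill Z b) ⟶ M) (f : M ⟶ M') : Prop :=
  ∃ (N' Y' Z' : List (Layer P)) (ψ' : fill N' (fill Y' a ⋎ fill Z' b) ⟶ M')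
    (σ : fill N (fill Y a ⋎ fill Z b) ⟶ fill N' (fill Y' a ⋎ fill Z' b)),
    Chain3 a b N Y Z N' Y' Z' σ ∧ Pres (R2 a b Y' Z') N' M' ψ' ∧ ψ ≫ f = σ ≫ ψ'

theorem R2.mirror {a b : Form P} {Y Z : List (Layer P)} {M : Form P}
    {ψ : fill Y a ⋎ fill Z b ⟶ M} (h : R2 a b Y Z M ψ) : R2 b a Z Y M (dc _ _ ≫ ψ) := by
  cases h with
  | lca h1 h2 _ e => exact .lca' h2 h1 _ (by rw [e]; exact (SS Kd.dis).c_nat _ _)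
  | lca' h1 h2 _ e =>
    refine .lca h2 h1 _ ?_
    rw [e, ← Category.assoc, (SS Kd.dis).c_nat, Category.assoc, (SS Kd.dis).cc, Category.comp_id]

theorem Pres.pre {X X' : Form P} {R : ∀ M : Form P, (X ⟶ M) → Prop}
    {R' : ∀ M : Form P, (X' ⟶ M) → Prop} (u : X' ⟶ X) (H : ∀ M φ, R M φ → R' M (u ≫ φ))
    {N : List (Layer P)} {M : Form P} {φ : fill N X ⟶ M} (h : Pres R N M φ) :
    Pres R' N M (fmap N u ≫ φ) := by
  induction h with
  | base _ _ h => exact .base _ _ (H _ _ h)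
  | conL F h _ e ih => exact .conL F ih _ (by rw [e, lm_comp]; rfl)
  | conR F h _ e ih => exact .conR F ih _ (by rw [e, lm_comp, Category.assoc]; rfl)
  | disL F h _ e ih => exact .disL F ih _ (by rw [e, lm_comp]; rfl)
  | disR F h _ e ih => exact .disR F ih _ (by rw [e, lm_comp, Category.assoc]; rfl)

theorem fmap_comp (N : List (Layer P)) {X X' X'' : Form P} (f : X ⟶ X') (g : X' ⟶ X'') :
    fmap N (f ≫ g) = fmap N f ≫ fmap N g := by
  induction N with
  | nil => rfl
  | cons l N ih => exact (congrArg _ ih).trans (lm_comp _ _ _ _)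

theorem fmap_id (N : List (Layer P)) (X : Form P) : fmap N (𝟙 X) = 𝟙 _ := by
  induction N with
  | nil => rfl
  | cons l N ih => exact (congrArg _ ih).trans (lm_id _ _ _)

theorem fmap_dc (N : List (Layer P)) (X W : Form P) :
    fmap N (dc X W) ≫ fmap N (dc W X) = 𝟙 _ := by
  rw [← fmap_comp, (SS Kd.dis).cc, fmap_id]

theorem Adv3.mirror {a b : Form P} {N Y Z : List (Layer P)} {M M' : Form P}
    {ψ : fill N (fill Y a ⋎ fill Z b) ⟶ M} {f : M ⟶ M'}
    (h : Adv3 b a N Z Y (fmap N (dc _ _) ≫ ψ) f) : Adv3 a b N Y Z ψ f := by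
  obtain ⟨N', Z', Y', ψ', σ, hσ, hp, e⟩ := h
  obtain ⟨τ, hτ, e'⟩ := hσ.mirror
  refine ⟨N', Y', Z', fmap N' (dc _ _) ≫ ψ', τ, hτ, hp.pre _ (fun M φ h => h.mirror), ?_⟩
  have h1 := fmap_dc N (fill Y a) (fill Z b)
  have h2 := fmap_dc N' (fill Z' b) (fill Y' a)
  calc ψ ≫ f = fmap N (dc _ _) ≫ (fmap N (dc _ _) ≫ ψ) ≫ f := by
        rw [Category.assoc, ← Category.assoc, h1, Category.id_comp]
    _ = fmap N (dc _ _) ≫ (σ ≫ fmap N' (dc _ _)) ≫ fmap N' (dc _ _) ≫ ψ' := by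
        rw [e, Category.assoc]
        rw [← Category.assoc (fmap N' _) (fmap N' _), h2, Category.id_comp]
    _ = _ := by
        rw [← e', Category.assoc, ← Category.assoc, h1, Category.id_comp]

theorem Adv.to3 {a b : Form P} {N Y Z : List (Layer P)} {M M' : Form P}
    {ψ : fill N (fill Y a ⋎ fill Z b) ⟶ M} {f : M ⟶ M'} (h : Adv (R2 a b Y Z) N ψ f) :
    Adv3 a b N Y Z ψ f := by
  obtain ⟨N', φ', s, hs, hp, e⟩ := h
  exact ⟨N', Y, Z, φ', _, .nctx hs Y Z, hp, e⟩

theorem Adv3.mL {a b : Form P} (kd : Kd) {A A' B B' : Form P} {N Y Z : List (Layer P)}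
    {φ : fill N (fill Y a ⋎ fill Z b) ⟶ B}
    {f : A ⟶ A'} (hf : IsDS f) {g : B ⟶ B'} (h : Adv3 a b N Y Z φ g) :
    Adv3 a b (⟨kd, A⟩ :: N) Y Z (lm kd A φ) ((SS kd).m f g) := by
  obtain ⟨N', Y', Z', φ', s, hs, hp, e⟩ := h
  exact ⟨_, _, _, _, _, .trans (.step (.nctx (.side kd f hf N) Y Z)) (hs.cong kd A'), hp.L kd A',
    cgL kd φ f g s φ' e⟩

theorem Adv3.mR {a b : Form P} (kd : Kd) {A A' B B' : Form P} {N Y Z : List (Layer P)}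
    {φ : fill N (fill Y a ⋎ fill Z b) ⟶ A}
    {f : A ⟶ A'} {g : B ⟶ B'} (hg : IsDS g) (h : Adv3 a b N Y Z φ f) :
    Adv3 a b (⟨kd, B⟩ :: N) Y Z (lm kd B φ ≫ (SS kd).c B A) ((SS kd).m f g) := by
  obtain ⟨N', Y', Z', φ', s, hs, hp, e⟩ := h
  exact ⟨_, _, _, _, _, .trans (.step (.nctx (.side kd g hg N) Y Z)) (hs.cong kd B'), hp.Rt kd B',
    cgR kd φ f g s φ' e⟩

theorem R2.inv {a b : Form P} {Y Z : List (Layer P)} {A B : Form P}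
    {ψ : fill Y a ⋎ fill Z b ⟶ A ⋎ B} (h : R2 a b Y Z (A ⋎ B) ψ) :
    (∃ φ1 φ2, Pres (R1 a) Y A φ1 ∧ Pres (R1 b) Z B φ2 ∧ ψ = dj φ1 φ2) ∨
    (∃ φ1 φ2, Pres (R1 a) Y B φ1 ∧ Pres (R1 b) Z A φ2 ∧ ψ = dj φ1 φ2 ≫ dc B A) := by
  cases h with
  | lca h1 h2 _ e => exact .inl ⟨_, _, h1, h2, e⟩
  | lca' h1 h2 _ e => exact .inr ⟨_, _, h1, h2, e⟩

theorem R2.not {a b : Form P} {Y Z : List (Layer P)} {A B : Form P}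
    {ψ : fill Y a ⋎ fill Z b ⟶ A ⋏ B} (h : R2 a b Y Z (A ⋏ B) ψ) : False := by
  cases h

theorem R2.wlog {A B M' M'' : Form P} {N : List (Layer P)}
    (W : ∀ X, (X ⟶ A ⋎ B) → (fill N X ⟶ M'))
    (hW : ∀ X X' (u : X' ⟶ X) φ, W X' (u ≫ φ) = fmap N u ≫ W X φ) (f : M' ⟶ M'')
    (H : ∀ a b Y Z (φ1 : fill Y a ⟶ A) (φ2 : fill Z b ⟶ B), Atomic a → Atomic b →
      Pres (R1 a) Y A φ1 → Pres (R1 b) Z B φ2 → Adv3 a b N Y Z (W _ (dj φ1 φ2)) f)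
    {a b : Form P} (ha : Atomic a) (hb : Atomic b) {Y Z : List (Layer P)}
    {ψ : fill Y a ⋎ fill Z b ⟶ A ⋎ B} (h : R2 a b Y Z (A ⋎ B) ψ) : Adv3 a b N Y Z (W _ ψ) f := by
  rcases h.inv with ⟨φ1, φ2, h1, h2, e⟩ | ⟨φ1, φ2, h1, h2, e⟩
  · rw [e]; exact H _ _ _ _ _ _ ha hb h1 h2
  · apply Adv3.mirror
    rw [← hW, e, ← Category.assoc, (SS Kd.dis).c_nat, Category.assoc, (SS Kd.dis).cc,
      Category.comp_id]
    exact H _ _ _ _ _ _ hb ha h2 h1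

theorem r_a1 {A B C U V : Form P} (φ1 : U ⟶ A) (φ2 : V ⟶ C) :
    dj φ1 (lm Kd.dis B φ2) ≫ da A B C =
      ((SS Kd.dis).b U B V ≫ da B U V) ≫ dj (lm Kd.dis B φ1 ≫ dc B A) φ2 := by
  have h := (SS Kd.dis).a_nat φ1 (𝟙 B) φ2
  rw [Sym.b_eq]
  simp only [Category.assoc]
  rw [(SS Kd.dis).a'a_assoc, (SS Kd.dis).m_comp, Category.id_comp, ← (SS Kd.dis).c_nat,
    (SS Kd.dis).cc_assoc]
  exact h.symm

theorem r_a2 {A B C U V : Form P} (φ1 : U ⟶ A) (φ2 : V ⟶ B) :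
    dj φ1 (lm Kd.dis C φ2 ≫ dc C B) ≫ da A B C =
      (SS Kd.dis).b U C V ≫ lm Kd.dis C (dj φ1 φ2) ≫ dc C (A ⋎ B) := by
  have h := (SS Kd.dis).b_nat φ1 (𝟙 C) φ2
  have h1 : dj φ1 (lm Kd.dis C φ2 ≫ dc C B) = dj φ1 (lm Kd.dis C φ2) ≫ lm Kd.dis A (dc C B) := by
    rw [(SS Kd.dis).m_comp, Category.comp_id]
  rw [← Category.assoc, h, h1]
  unfold Sym.b
  simp only [Category.assoc]
  rw [(SS Kd.dis).cc, Category.comp_id]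

theorem r_a'1 {A B C U V : Form P} (φ1 : U ⟶ B) (φ2 : V ⟶ C) :
    dj (lm Kd.dis A φ1) φ2 ≫ db A B C = db A U V ≫ lm Kd.dis A (dj φ1 φ2) :=
  ((SS Kd.dis).a'_nat (𝟙 A) φ1 φ2).symm

theorem r_a'2 {A B C U V : Form P} (φ1 : U ⟶ A) (φ2 : V ⟶ C) :
    dj (lm Kd.dis B φ1 ≫ dc B A) φ2 ≫ db A B C =
      (db B U V ≫ st' .dis B U V) ≫ dj φ1 (lm Kd.dis B φ2) := by
  change _ = (db B U V ≫ (SS Kd.dis).b B U V) ≫ _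
  have h := (SS Kd.dis).a'_nat φ1 (𝟙 B) φ2
  rw [Sym.b_eq]
  simp only [Category.assoc]
  rw [(SS Kd.dis).a'a_assoc, h, ← Category.assoc, (SS Kd.dis).m_comp, Category.id_comp,
    (SS Kd.dis).c_nat]

theorem r_a'3 {A B C U V : Form P} (φ1 : U ⟶ A) (φ2 : V ⟶ B) :
    (lm Kd.dis C (dj φ1 φ2) ≫ dc C (A ⋎ B)) ≫ db A B C =
      st' .dis C U V ≫ dj φ1 (lm Kd.dis C φ2 ≫ dc C B) := by
  change _ = (SS Kd.dis).b C U V ≫ _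
  have h := (SS Kd.dis).b_nat (𝟙 C) φ1 φ2
  have h1 : dj φ1 (lm Kd.dis C φ2 ≫ dc C B) = dj φ1 (lm Kd.dis C φ2) ≫ lm Kd.dis A (dc C B) := by
    rw [(SS Kd.dis).m_comp, Category.comp_id]
  have h2 := ca'_eq .dis A B C
  rw [Category.assoc, h2, h1, ← Category.assoc, ← Category.assoc, h]

theorem base_da {A B C : Form P} {a b : Form P} (ha : Atomic a) (hb : Atomic b)
    {Y Z : List (Layer P)} {ψ : fill Y a ⋎ fill Z b ⟶ A ⋎ (B ⋎ C)}
    (h : R2 a b Y Z _ ψ) : Adv3 a b [] Y Z ψ (da A B C) := by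
  refine R2.wlog (N := []) (fun X φ => φ) (fun _ _ _ _ => rfl) (da A B C) ?_ ha hb h
  intro a b Y Z φ1 φ2 ha hb h1 h2
  refine h2.inv .dis (fun Z φ2 => Adv3 a b [] Y Z (dj φ1 φ2) (da A B C))
    (fun φ h => (R1.not hb (kd := .dis) h).elim) ?_ ?_
  · intro Z φ2 h2
    exact ⟨_, _, _, _, _, .trans (.step (.unZ B Y Z)) (.step (.layY .dis B Y Z)),
      .base _ _ (.lca (h1.Rt .dis B) h2 _ rfl), r_a1 φ1 φ2⟩
  · intro Z φ2 h2
    exact ⟨_, _, _, _, _, .step (.unZ C Y Z),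
      Pres.Rt .dis C (.base _ _ (.lca h1 h2 _ rfl)), r_a2 φ1 φ2⟩

theorem base_da1 {A B C : Form P} {a b : Form P} (ha : Atomic a) (hb : Atomic b)
    {Y Z : List (Layer P)} {ψ : fill Y a ⋎ fill Z b ⟶ B ⋎ C}
    (h : R2 a b Y Z _ ψ) : Adv3 a b [⟨.dis, A⟩] Y Z (lm Kd.dis A ψ) (da A B C) := by
  refine R2.wlog (N := [⟨.dis, A⟩]) (fun X φ => lm Kd.dis A φ) (fun _ _ _ _ => lm_comp _ _ _ _)
    (da A B C) ?_ ha hb h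
  intro a b Y Z φ1 φ2 ha hb h1 h2
  exact ⟨_, _, _, _, _, .step (.layY .dis A Y Z),
      .base _ _ (.lca (h1.L .dis A) h2 _ rfl), ((SS Kd.dis).a_nat (𝟙 A) φ1 φ2).symm⟩

theorem base_db {A B C : Form P} {a b : Form P} (ha : Atomic a) (hb : Atomic b)
    {Y Z : List (Layer P)} {ψ : fill Y a ⋎ fill Z b ⟶ (A ⋎ B) ⋎ C}
    (h : R2 a b Y Z _ ψ) : Adv3 a b [] Y Z ψ (db A B C) := by
  refine R2.wlog (N := []) (fun X φ => φ) (fun _ _ _ _ => rfl) (db A B C) ?_ ha hb h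
  intro a b Y Z φ1 φ2 ha hb h1 h2
  refine h1.inv .dis (fun Y φ1 => Adv3 a b [] Y Z (dj φ1 φ2) (db A B C))
    (fun φ h => (R1.not ha (kd := .dis) h).elim) ?_ ?_
  · intro Y φ1 h1
    exact ⟨_, _, _, _, _, .step (.unY A Y Z),
      Pres.L .dis A (.base _ _ (.lca h1 h2 _ rfl)), r_a'1 φ1 φ2⟩
  · intro Y φ1 h1
    exact ⟨_, _, _, _, _, .trans (.step (.unY B Y Z)) (.step (.layZ .dis B Y Z)),
      .base _ _ (.lca h1 (h2.L .dis B) _ rfl), r_a'2 φ1 φ2⟩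

theorem base_db1 {A B C : Form P} {a b : Form P} (ha : Atomic a) (hb : Atomic b)
    {Y Z : List (Layer P)} {ψ : fill Y a ⋎ fill Z b ⟶ A ⋎ B}
    (h : R2 a b Y Z _ ψ) :
    Adv3 a b [⟨.dis, C⟩] Y Z (lm Kd.dis C ψ ≫ dc C (A ⋎ B)) (db A B C) := by
  refine R2.wlog (N := [⟨.dis, C⟩]) (fun X φ => lm Kd.dis C φ ≫ dc C (A ⋎ B))
    (fun _ _ _ _ => by rw [lm_comp, Category.assoc]; rfl) (db A B C) ?_ ha hb h
  intro a b Y Z φ1 φ2 ha hb h1 h2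
  exact ⟨_, _, _, _, _, .step (.layZ .dis C Y Z),
      .base _ _ (.lca h1 (h2.Rt .dis C) _ rfl), r_a'3 φ1 φ2⟩

theorem base_d1 {A B C : Form P} {a b : Form P} (ha : Atomic a) (hb : Atomic b)
    {Y Z : List (Layer P)} {ψ : fill Y a ⋎ fill Z b ⟶ B ⋎ C}
    (h : R2 a b Y Z _ ψ) : Adv3 a b [⟨.con, A⟩] Y Z (lm Kd.con A ψ) (st .con A B C) := by
  refine R2.wlog (N := [⟨.con, A⟩]) (fun X φ => lm Kd.con A φ) (fun _ _ _ _ => lm_comp _ _ _ _)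
    (st .con A B C) ?_ ha hb h
  intro a b Y Z φ1 φ2 ha hb h1 h2
  exact ⟨_, _, _, _, _, .step (.layY .con A Y Z),
      .base _ _ (.lca (h1.L .con A) h2 _ rfl), (st_nat .con A φ1 φ2).symm⟩

theorem base_c {A B : Form P} {a b : Form P} (ha : Atomic a) (hb : Atomic b)
    {Y Z : List (Layer P)} {ψ : fill Y a ⋎ fill Z b ⟶ A ⋎ B}
    (h : R2 a b Y Z _ ψ) : Adv3 a b [] Y Z ψ (dc A B) := by
  refine R2.wlog (N := []) (fun X φ => φ) (fun _ _ _ _ => rfl) (dc A B) ?_ ha hb h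
  intro a b Y Z φ1 φ2 ha hb h1 h2
  exact ⟨[], _, _, _, _, .refl _ _ _, .base _ _ (.lca' h1 h2 _ rfl), (Category.id_comp _).symm⟩

theorem base_m {A B A' B' : Form P} (f : Term P A A') (g : Term P B B') (hf : IsDSTerm f)
    (hg : IsDSTerm g) {a b : Form P} (ha : Atomic a) (hb : Atomic b)
    {Y Z : List (Layer P)} {ψ : fill Y a ⋎ fill Z b ⟶ A ⋎ B}
    (h : R2 a b Y Z _ ψ) : Adv3 a b [] Y Z ψ (dj (cl f) (cl g)) := by
  refine R2.wlog (N := []) (fun X φ => φ) (fun _ _ _ _ => rfl) _ ?_ ha hb h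
  intro a b Y Z φ1 φ2 ha hb h1 h2
  obtain ⟨Y', φ1', s, hs, hp, e⟩ := pres1 ha f hf h1
  obtain ⟨Z', φ2', t, ht, hq, e'⟩ := pres1 hb g hg h2
  refine ⟨[], Y', Z', _, _, .trans (.yctx hs Z) (.zctx ht Y'), .base _ _ (.lca hp hq _ rfl), ?_⟩
  rw [Category.assoc, (SS Kd.dis).m_comp, (SS Kd.dis).m_comp, (SS Kd.dis).m_comp, e, e']
  simp

theorem pres2 {a b : Form P} (ha : Atomic a) (hb : Atomic b) {M M' : Form P} (f : Term P M M')
    (hf : IsDSTerm f) {N Y Z : List (Layer P)} {ψ : fill N (fill Y a ⋎ fill Z b) ⟶ M}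
    (h : Pres (R2 a b Y Z) N M ψ) : Adv3 a b N Y Z ψ (cl f) := by
  induction f generalizing N Y Z with
  | id A => exact (Adv.id h).to3
  | comp g f ihg ihf =>
    obtain ⟨N', Y', Z', φ', s, hs, hp, e⟩ := ihf hf.2 h
    obtain ⟨N2, Y2, Z2, φ2, s2, hs2, hp2, e2⟩ := ihg hf.1 hp
    refine ⟨_, _, _, _, _, hs.trans hs2, hp2, ?_⟩
    change ψ ≫ (cl f ≫ cl g) = _
    rw [← Category.assoc, e, Category.assoc, e2, Category.assoc]
  | conj f g ihf ihg =>
    refine h.inv .con (fun N ψ => Adv3 a b N Y Z ψ ((SS Kd.con).m (cl f) (cl g)))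
      (fun φ h => (R2.not h).elim) ?_ ?_
    · intro N φ h; exact (ihg hf.2 h).mL .con ⟨f, hf.1, rfl⟩
    · intro N φ h; exact (ihf hf.1 h).mR .con ⟨g, hf.2, rfl⟩
  | disj f g ihf ihg =>
    refine h.inv .dis (fun N ψ => Adv3 a b N Y Z ψ ((SS Kd.dis).m (cl f) (cl g)))
      (fun φ h => base_m f g hf.1 hf.2 ha hb h) ?_ ?_
    · intro N φ h; exact (ihg hf.2 h).mL .dis ⟨f, hf.1, rfl⟩
    · intro N φ h; exact (ihf hf.1 h).mR .dis ⟨g, hf.2, rfl⟩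
  | bConjTo A B C =>
    exact h.a_cases .con (fun N ψ => Adv3 a b N Y Z ψ _)
      (fun φ h => (R2.not h).elim) (fun φ h => (R2.not h).elim) (fun Y φ h => h.to3)
  | bConjFrom A B C =>
    exact h.a'_cases .con (fun N ψ => Adv3 a b N Y Z ψ _)
      (fun φ h => (R2.not h).elim) (fun φ h => (R2.not h).elim) (fun Y φ h => h.to3)
  | bDisjTo A B C =>
    exact h.a_cases .dis (fun N ψ => Adv3 a b N Y Z ψ _)
      (fun φ h => base_da ha hb h) (fun φ h => base_da1 ha hb h) (fun Y φ h => h.to3)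
  | bDisjFrom A B C =>
    exact h.a'_cases .dis (fun N ψ => Adv3 a b N Y Z ψ _)
      (fun φ h => base_db ha hb h) (fun φ h => base_db1 ha hb h) (fun Y φ h => h.to3)
  | cConj A B =>
    exact h.c_cases .con (fun N ψ => Adv3 a b N Y Z ψ _)
      (fun φ h => (R2.not h).elim) (fun Y φ h => h.to3)
  | cDisj A B =>
    exact h.c_cases .dis (fun N ψ => Adv3 a b N Y Z ψ _)
      (fun φ h => base_c ha hb h) (fun Y φ h => h.to3)
  | d A B C =>
    exact h.d_cases (fun N ψ => Adv3 a b N Y Z ψ _)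
      (fun φ h => (R2.not h).elim) (fun φ h => base_d1 ha hb h) (fun Y φ h => h.to3)
  | delta => exact hf.elim
  | sigma => exact hf.elim

end Pres2
end PNL


namespace PNL

open CategoryTheory

section Xi
variable {P : Type}

theorem delta_nat (p : P) {S S' : Form P} (f : S ⟶ S') :
    f ≫ cl (Term.delta p S') = cl (Term.delta p S) ≫ cj f (𝟙 (Form.natom p ⋎ Form.pos p)) := by
  induction f using cl_ind
  exact (cl_eq (Eqv.deltaNat p _)).symm

theorem delta_dD (p : P) (C B : Form P) :
    cl (Term.delta p (C ⋎ B)) ≫ dr C B (Form.natom p ⋎ Form.pos p) =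
      dj (𝟙 C) (cl (Term.delta p B)) := by
  have h : (cl (Term.delta p (B ⋎ C)) ≫ cs (B ⋎ C) _) ≫ st .con (Form.natom p ⋎ Form.pos p) B C =
      dj (cl (Term.delta p B) ≫ cs B _) (𝟙 C) := cl_eq (Eqv.dSigmaConj p B C)
  rw [dr_eq]
  unfold st'
  simp only [Category.assoc] at h ⊢
  have h1 := (SS Kd.con).c_nat (dc C B) (𝟙 (Form.natom p ⋎ Form.pos p))
  have h2 := delta_nat p (dc C B)
  have h3 : dc C B ≫ dj (cl (Term.delta p B) ≫ cs B (Form.natom p ⋎ Form.pos p)) (𝟙 C) =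
    dj (𝟙 C) (cl (Term.delta p B) ≫ cs B (Form.natom p ⋎ Form.pos p)) ≫ dc C _ :=
    (SS Kd.dis).c_nat _ _
  rw [reassoc_of% h1, ← reassoc_of% h2, reassoc_of% h, reassoc_of% h3, (SS Kd.dis).cc_assoc,
    (SS Kd.dis).m_comp, Category.assoc, (SS Kd.con).cc, Category.comp_id, Category.comp_id]

@[reducible] def dcap (p : P) : CapData P where
  a := Form.natom p
  b := Form.pos p
  cap S := cl (Term.delta p S)
  nat f := delta_nat p f
  bD F G := cl_eq (Eqv.bDelta F G p)
  dD C B := delta_dD p C B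

def CAP (p : P) {T M : Form P} (g : T ⟶ M) : Prop :=
  ∃ (N Y Z : List (Layer P)) (k : T ⟶ fill N (fill Y (Form.natom p) ⋎ fill Z (Form.pos p)))
    (ψ : fill N (fill Y (Form.natom p) ⋎ fill Z (Form.pos p)) ⟶ M),
    Pres (R2 (Form.natom p) (Form.pos p) Y Z) N M ψ ∧ Cap (dcap p) N Y Z k ∧ g = k ≫ ψ

theorem CAP.post {p : P} {T M M' : Form P} {g : T ⟶ M} (h : CAP p g) {f : M ⟶ M'} (hf : IsDS f) :
    CAP p (g ≫ f) := by
  obtain ⟨N, Y, Z, k, ψ, hp, hk, e⟩ := h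
  obtain ⟨f, hf, rfl⟩ := hf
  obtain ⟨N', Y', Z', ψ', σ, hσ, hp', e'⟩ := pres2 (.natom p) (.pos p) f hf hp
  have hc : Cap (dcap p) N' Y' Z' (k ≫ σ) := Cap.chain3 (D := dcap p) hσ hk
  exact ⟨N', Y', Z', k ≫ σ, ψ', hp', hc, by rw [e, Category.assoc, e', Category.assoc]⟩

theorem CAP.delta (p : P) (B : Form P) : CAP p (cl (Term.delta p B)) := by
  refine ⟨[⟨.con, B⟩], [], [], cl (Term.delta p B), lm Kd.con B (𝟙 _),
    Pres.L .con B (.base _ _ (.lca (.base _ _ .mk) (.base _ _ .mk) _ ?_)),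
    .stem (𝟙 _) (.id _) _ (Category.id_comp _).symm, ?_⟩
  · exact ((SS Kd.dis).m_id _ _).symm
  · rw [lm_id]; exact (Category.comp_id _).symm

theorem CAP.layL {p : P} (kd : Kd) (A : Form P) {T M : Form P} {g : T ⟶ M} (h : CAP p g) :
    CAP p (lm kd A g) := by
  obtain ⟨N, Y, Z, k, ψ, hp, hk, e⟩ := h
  exact ⟨_, _, _, _, _, hp.L kd A, .lay kd A (𝟙 _) (.id _) k hk _ (Category.id_comp _).symm,
    by rw [e]; exact lm_comp _ _ _ _⟩

theorem Cap.pre {D : CapData P} {N Y Z : List (Layer P)} {T T' : Form P}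
    {k : T ⟶ fill N (fill Y D.a ⋎ fill Z D.b)} (hk : Cap D N Y Z k) (f : T' ⟶ T) (hf : IsDS f) :
    Cap D N Y Z (f ≫ k) := by
  cases hk with
  | split _ hk => exact .split _ (hk.pre f hf)
  | stem h hh _ e => exact .stem (f ≫ h) (hf.comp hh) _ (by rw [e]; exact (Category.assoc _ _ _).symm)
  | lay kd F h hh k' hk _ e =>
    exact .lay kd F (f ≫ h) (hf.comp hh) k' hk _ (by rw [e]; exact (Category.assoc _ _ _).symm)

theorem CAP.pre {p : P} {T T' M : Form P} {g : T ⟶ M} (h : CAP p g) {f : T' ⟶ T} (hf : IsDS f) :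
    CAP p (f ≫ g) := by
  obtain ⟨N, Y, Z, k, ψ, hp, hk, e⟩ := h
  refine ⟨N, Y, Z, f ≫ k, ψ, hp, ?_, by rw [e, Category.assoc]⟩
  exact Cap.pre (D := dcap p) hk f hf

theorem CAP.layR {p : P} (kd : Kd) (A : Form P) {T M : Form P} {g : T ⟶ M} (h : CAP p g) :
    CAP p ((SS kd).m g (𝟙 A)) := by
  have h2 := ((h.layL kd A).pre (IsDS.c kd T A)).post (IsDS.c kd A M)
  rw [(SS kd).c_nat, Category.assoc, (SS kd).cc, Category.comp_id] at h2
  exact h2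

theorem CAP.xi {p : P} {T M : Form P} {g : Term P T M} {i j : ℕ} {π : List Dir}
    (h : IsXiConjTerm p g i j π) : CAP p (cl g) := by
  induction h with
  | delta B => exact .delta p B
  | delta' B => exact (CAP.delta p B).post (.m .con (.id _) (.c .dis _ _))
  | sigmaConj B => exact (CAP.delta p B).post (.c .con _ _)
  | sigmaConj' B =>
    exact ((CAP.delta p B).post (.m .con (.id _) (.c .dis _ _))).post (.c .con _ _)
  | conjL A _ ih => exact ih.layL .con A
  | conjR A _ ih => exact ih.layR .con A
  | disjL A _ ih => exact ih.layL .dis A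
  | disjR A _ ih => exact ih.layR .dis A

end Xi
end PNL


namespace PNL

open CategoryTheory

section Snakes
variable {P : Type}

/-- A cap together with a cup satisfying the snake equation. -/
structure Snake (D : CapData P) where
  sig : ∀ W : Form P, (D.b ⋏ D.a) ⋎ W ⟶ W
  snat : ∀ {W W' : Form P} (f : W ⟶ W'), dj (𝟙 (D.b ⋏ D.a)) f ≫ sig W' = sig W ≫ f
  sst : ∀ (kd : Kd) (F W : Form P),
    st' kd F (D.b ⋏ D.a) W ≫ sig (op kd F W) = lm kd F (sig W)
  sda : ∀ B W : Form P, da B (D.b ⋏ D.a) W ≫ dj (dc B (D.b ⋏ D.a) ≫ sig B) (𝟙 W) =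
    lm Kd.dis B (sig W)
  snake : D.cap D.b ≫ st .con D.b D.a D.b ≫ sig D.b = 𝟙 D.b
  ha : Atomic D.a
  hb : Atomic D.b

theorem kill_aux {T T' X : Form P} {EW EFW : Form P} {W : Form P} (kd : Kd) (F : Form P)
    (h : T ⟶ op kd F T') (k : T' ⟶ X ⋎ W) (Θ : X ⋎ W ⟶ EW) (Θ' : X ⋎ op kd F W ⟶ EFW)
    (e : op kd F EW ⟶ EFW) (he : st' kd F X W ≫ Θ' = lm kd F Θ ≫ e) :
    (h ≫ lm kd F k ≫ st' kd F X W) ≫ Θ' = h ≫ lm kd F (k ≫ Θ) ≫ e := by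
  simp only [Category.assoc, he, lm_comp]

theorem killG {D : CapData P} {Y0 : List (Layer P)} (hne : Y0 ≠ []) (E : Form P → Form P)
    (Θ : ∀ W, fill Y0 D.a ⋎ W ⟶ E W)
    (H1 : ∀ kd F W, ∃ e : op kd F (E W) ⟶ E (op kd F W), IsDS e ∧
      st' kd F _ W ≫ Θ (op kd F W) = lm kd F (Θ W) ≫ e)
    (HL : ∀ {T : Form P} {Z : List (Layer P)} (k : T ⟶ fill Y0 D.a ⋎ fill Z D.b),
      Cap2L D Y0 Z k → IsDS (k ≫ Θ (fill Z D.b)))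
    {T : Form P} {Z : List (Layer P)} {k : T ⟶ fill Y0 D.a ⋎ fill Z D.b} (hk : Cap2 D Y0 Z k) :
    IsDS (k ≫ Θ (fill Z D.b)) := by
  induction hk with
  | stemL h hh k e => exact HL (Z := []) k (.stemL h hh k e)
  | stemR h hh k e => exact absurd rfl hne
  | layL kd F h hh k' hk' k e ih => exact HL k (.layL kd F h hh k' hk' k e)
  | layR kd F h hh k' hk' k e ih =>
    rename_i T T' Y Z
    obtain ⟨e', he', ee⟩ := H1 kd F (fill Z D.b)
    have := ih hne Θ H1 HL
    rw [e]
    refine (congrArg IsDS (kill_aux kd F h k' (Θ _) (Θ _) e' ee)).mpr ?_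
    exact hh.comp ((IsDS.ly kd F this).comp he')

variable {D : CapData P} (s : Snake D)

def KP (s : Snake D) {T : Form P} : ∀ (Y Z : List (Layer P)),
    (T ⟶ fill Y D.a ⋎ fill Z D.b) → Prop
  | [], Z, k => IsDS (lm Kd.con D.b k ≫ st .con D.b D.a (fill Z D.b) ≫ s.sig (fill Z D.b))
  | _, _, _ => True

theorem cap_b (D : CapData P) (S F : Form P) : lm Kd.con F (D.cap S) ≫ (SS Kd.con).b F S (D.a ⋎ D.b) =
    cs F S ≫ lm Kd.con S (D.cap F) := by
  have h := D.bD' F S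
  have h2 := D.nat (cs F S)
  have h3 := D.bD S F
  rw [Sym.b_eq, reassoc_of% h, ← reassoc_of% h2, h3]

theorem KP_aux1 (s : Snake D) {T S : Form P} (h : T ⟶ S) :
    lm Kd.con D.b (h ≫ D.cap S ≫ st' .con S D.a D.b) ≫ st .con D.b D.a (S ⋏ D.b) ≫
      s.sig (S ⋏ D.b) = lm Kd.con D.b h ≫ cs D.b S := by
  have h1 := e34 .con D.b S D.a D.b
  have h2 := s.sst .con S D.b
  have h3 := cap_b D S D.b
  have h4 := congrArg (fun z => lm Kd.con S z) s.snake
  rw [lm_comp, lm_comp, lm_id] at h4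
  rw [lm_comp, lm_comp]
  simp only [Category.assoc]
  change _ ≫ _ ≫ lm Kd.con D.b (st' .con S D.a D.b) ≫ st .con D.b D.a (op .con S D.b) ≫ s.sig (op .con S D.b) = _
  rw [reassoc_of% h1, h2]
  change _ ≫ _ ≫ (SS Kd.con).b D.b S (D.a ⋎ D.b) ≫ _ = _
  rw [reassoc_of% h3, h4]
  exact congrArg _ (Category.comp_id _)

theorem KP_aux2 (s : Snake D) {T T' W : Form P} (kd : Kd) (F : Form P) (h : T ⟶ op kd F T')
    (k : T' ⟶ D.a ⋎ W) :
    lm Kd.con D.b (h ≫ lm kd F k ≫ st' kd F D.a W) ≫ st .con D.b D.a (op kd F W) ≫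
      s.sig (op kd F W) = lm Kd.con D.b h ≫ sw kd D.b F T' ≫
        lm kd F (lm Kd.con D.b k ≫ st .con D.b D.a W ≫ s.sig W) := by
  have h1 := e34 kd D.b F D.a W
  have h2 := s.sst kd F W
  have h3 := sw_nat kd D.b F k
  rw [lm_comp, lm_comp, lm_comp, lm_comp]
  simp only [Category.assoc]
  rw [reassoc_of% h1, h2, ← reassoc_of% h3]

theorem Cap2.KP {T : Form P} {Y Z : List (Layer P)} {k : T ⟶ fill Y D.a ⋎ fill Z D.b}
    (hk : Cap2 D Y Z k) : PNL.KP s Y Z k := by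
  induction hk with
  | stemL h hh k e => trivial
  | stemR h hh k e =>
    rename_i T S
    change IsDS (lm Kd.con D.b k ≫ st .con D.b D.a (S ⋏ D.b) ≫ s.sig (S ⋏ D.b))
    rw [e, KP_aux1]
    exact (IsDS.ly _ _ hh).comp (.c .con _ _)
  | layL kd F h hh k' hk' k0 e ih => trivial
  | layR kd F h hh k' hk' k0 e ih =>
    rename_i T T' Y Z
    rcases Y with _ | ⟨_, Y⟩
    · change IsDS (lm Kd.con D.b k0 ≫ st .con D.b D.a (op kd F (fill Z D.b)) ≫
        s.sig (op kd F (fill Z D.b)))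
      have ih' : IsDS (lm Kd.con D.b k' ≫ st .con D.b D.a (fill Z D.b) ≫ s.sig (fill Z D.b)) := ih
      rw [e]
      refine (congrArg IsDS (KP_aux2 s kd F h k')).mpr ?_
      exact (IsDS.ly _ _ hh).comp ((IsDS.sw _ _ _ _).comp (IsDS.ly _ _ ih'))
    · trivial

theorem K_aux (s : Snake D) {T : Form P} (h : T ⟶ D.b) :
    (h ≫ D.cap D.b ≫ st .con D.b D.a D.b) ≫ s.sig D.b = h := by
  simp only [Category.assoc]
  rw [s.snake]; exact Category.comp_id _

theorem Cap2.K {T : Form P} {Z : List (Layer P)} {k : T ⟶ (D.b ⋏ D.a) ⋎ fill Z D.b}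
    (hk : Cap2 D [⟨.con, D.b⟩] Z k) : IsDS (k ≫ s.sig (fill Z D.b)) := by
  refine killG (Y0 := [⟨.con, D.b⟩]) (by simp) (fun W => W) (fun W => s.sig W) ?_ ?_ hk
  · intro kd F W
    exact ⟨𝟙 _, .id _, (s.sst kd F W).trans (Category.comp_id _).symm⟩
  · intro T Z k hk
    cases hk with
    | stemL h hh k e =>
      rw [e]
      exact (congrArg IsDS (K_aux s h)).mpr hh
    | layL kd F h hh k' hk' k e =>
      rw [e]
      have : IsDS (lm Kd.con D.b k' ≫ st .con D.b D.a (fill Z D.b) ≫ s.sig (fill Z D.b)) := hk'.KP s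
      have h2 := hh.comp this
      simp only [Category.assoc]
      exact h2

end Snakes
end PNL


namespace PNL

open CategoryTheory

section Final
variable {P : Type}

open Classical in
/-- The number of occurrences of the atom `a`. -/
noncomputable def cnt (a : Form P) : Form P → ℕ
  | .pos q => if Form.pos q = a then 1 else 0
  | .natom q => if Form.natom q = a then 1 else 0
  | .conj A B => cnt a A + cnt a B
  | .disj A B => cnt a A + cnt a B

theorem cnt_op (a : Form P) (kd : Kd) (A B : Form P) : cnt a (op kd A B) = cnt a A + cnt a B := by
  cases kd <;> rfl

theorem cnt_self {a : Form P} (ha : Atomic a) : cnt a a = 1 := by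
  cases a with
  | pos q => simp [cnt]
  | natom q => simp [cnt]
  | conj A B => exact absurd rfl (ha .con A B)
  | disj A B => exact absurd rfl (ha .dis A B)

theorem cnt_ds (a : Form P) {A B : Form P} (f : Term P A B) (hf : IsDSTerm f) : cnt a A = cnt a B := by
  induction f with
  | comp g f ihg ihf => exact (ihf hf.2).trans (ihg hf.1)
  | conj f g ihf ihg => simp only [cnt, ihf hf.1, ihg hf.2]
  | disj f g ihf ihg => simp only [cnt, ihf hf.1, ihg hf.2]
  | delta => exact hf.elim
  | sigma => exact hf.elim
  | _ => simp only [cnt] <;> omega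

theorem Pres.cnt_pos {X : Form P} {R : ∀ M : Form P, (X ⟶ M) → Prop} {a : Form P}
    (H : ∀ M φ, R M φ → 1 ≤ cnt a M) {Y : List (Layer P)} {M : Form P} {φ : fill Y X ⟶ M}
    (h : Pres R Y M φ) : 1 ≤ cnt a M := by
  induction h with
  | base _ _ h => exact H _ _ h
  | conL F h _ e ih => simp only [cnt]; omega
  | conR F h _ e ih => simp only [cnt]; omega
  | disL F h _ e ih => simp only [cnt]; omega
  | disR F h _ e ih => simp only [cnt]; omega

theorem Pres.isDS {X : Form P} {R : ∀ M : Form P, (X ⟶ M) → Prop}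
    (H : ∀ M φ, R M φ → IsDS φ) {Y : List (Layer P)} {M : Form P} {φ : fill Y X ⟶ M}
    (h : Pres R Y M φ) : IsDS φ := by
  induction h with
  | base _ _ h => exact H _ _ h
  | conL F h _ e ih => rw [e]; exact .ly _ _ ih
  | conR F h _ e ih => rw [e]; exact (IsDS.ly _ _ ih).comp (.c .con _ _)
  | disL F h _ e ih => rw [e]; exact .ly _ _ ih
  | disR F h _ e ih => rw [e]; exact (IsDS.ly _ _ ih).comp (.c .dis _ _)

theorem R1.isDS {X M : Form P} {φ : X ⟶ M} (h : R1 X M φ) : IsDS φ := by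
  cases h; exact .id _

theorem Pres.cnt1 {a : Form P} (ha : Atomic a) {Y : List (Layer P)} {M : Form P} {φ : fill Y a ⟶ M}
    (h : Pres (R1 a) Y M φ) : 1 ≤ cnt a M :=
  h.cnt_pos (fun _ _ h => by cases h; exact (cnt_self ha).ge)

theorem R2.cnt {a b : Form P} (ha : Atomic a) {Y Z : List (Layer P)} {M : Form P}
    {ψ : fill Y a ⋎ fill Z b ⟶ M} (h : R2 a b Y Z M ψ) : 1 ≤ PNL.cnt a M := by
  cases h with
  | lca h1 h2 _ e => have := h1.cnt1 ha; simp only [PNL.cnt]; omega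
  | lca' h1 h2 _ e => have := h1.cnt1 ha; simp only [PNL.cnt]; omega

theorem Pres.cnt2 {a b : Form P} (ha : Atomic a) {N Y Z : List (Layer P)} {M : Form P}
    {ψ : fill N (fill Y a ⋎ fill Z b) ⟶ M} (h : Pres (R2 a b Y Z) N M ψ) : 1 ≤ cnt a M :=
  h.cnt_pos (fun _ _ h => h.cnt ha)

theorem Pres.inv1 {a : Form P} (ha : Atomic a) (C : ∀ Y : List (Layer P), (fill Y a ⟶ a) → Prop)
    (H : C [] (𝟙 a)) {Y : List (Layer P)} {φ : fill Y a ⟶ a} (h : Pres (R1 a) Y a φ) : C Y φ := by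
  cases a with
  | pos q => cases h with | base _ _ h => cases h; exact H
  | natom q => cases h with | base _ _ h => cases h; exact H
  | conj A B => exact absurd rfl (ha .con A B)
  | disj A B => exact absurd rfl (ha .dis A B)

theorem Pres.not2 {a b : Form P} {N Y Z : List (Layer P)} {M : Form P} (hM : Atomic M)
    {ψ : fill N (fill Y a ⋎ fill Z b) ⟶ M} (h : Pres (R2 a b Y Z) N M ψ) : False := by
  cases h with
  | base _ _ h =>
    cases h with
    | lca => exact hM .dis _ _ rfl
    | lca' => exact hM .dis _ _ rfl
  | conL => exact hM .con _ _ rfl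
  | conR => exact hM .con _ _ rfl
  | disL => exact hM .dis _ _ rfl
  | disR => exact hM .dis _ _ rfl

variable {D : CapData P}

def F1 (D : CapData P) {M M' : Form P} (g : M ⟶ M') : Prop :=
  ∀ (Y : List (Layer P)) (φ : fill Y D.a ⟶ M), Pres (R1 D.a) Y M φ →
    ∀ (T : Form P) (Z : List (Layer P)) (k : T ⟶ fill Y D.a ⋎ fill Z D.b), Cap2 D Y Z k →
      IsDS (k ≫ dj (φ ≫ g) (𝟙 (fill Z D.b)))

def FG (D : CapData P) {M M' : Form P} (g : M ⟶ M') : Prop :=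
  ∀ (N Y Z : List (Layer P)) (ψ : fill N (fill Y D.a ⋎ fill Z D.b) ⟶ M),
    Pres (R2 D.a D.b Y Z) N M ψ →
    ∀ (T : Form P) (k : T ⟶ fill N (fill Y D.a ⋎ fill Z D.b)), Cap D N Y Z k →
      IsDS (k ≫ ψ ≫ g)

theorem Cap.toCap2 {Y Z : List (Layer P)} {T : Form P} {k : T ⟶ fill Y D.a ⋎ fill Z D.b}
    (h : Cap D [] Y Z k) : Cap2 D Y Z k := by
  cases h with
  | split _ h => exact h

theorem f1_aux {T X X' M W : Form P} (k : T ⟶ X ⋎ W) (s : X ⟶ X') (φ : X' ⟶ M) :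
    k ≫ dj (s ≫ φ) (𝟙 W) = (k ≫ dj s (𝟙 W)) ≫ dj φ (𝟙 W) := by
  rw [Sym.m_left, Category.assoc]

theorem F1.pre (ha : Atomic D.a) {M0 M M' : Form P} {u : M0 ⟶ M} (hu : IsDS u) {g : M ⟶ M'}
    (h : F1 D g) : F1 D (u ≫ g) := by
  intro Y φ hp T Z k hk
  obtain ⟨f, hf, rfl⟩ := hu
  obtain ⟨Y', φ', s, hs, hp', e⟩ := pres1 ha f hf hp
  have hc := Cap.toCap2 (Cap.chain3 (D := D) (Chain3.yctx hs Z) (Cap.split k hk))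
  have := h Y' φ' hp' _ Z _ hc
  rw [← Category.assoc, e, Category.assoc, f1_aux]
  exact this

theorem F1.post {M M' M'' : Form P} {u : M' ⟶ M''} (hu : IsDS u) {g : M ⟶ M'}
    (h : F1 D g) : F1 D (g ≫ u) := by
  intro Y φ hp T Z k hk
  have := h Y φ hp T Z k hk
  rw [← Category.assoc, f1_aux]
  exact this.comp (.m .dis hu (.id _))

theorem FG.pre (ha : Atomic D.a) (hb : Atomic D.b) {M0 M M' : Form P} {u : M0 ⟶ M} (hu : IsDS u)
    {g : M ⟶ M'} (h : FG D g) : FG D (u ≫ g) := by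
  intro N Y Z ψ hp T k hk
  obtain ⟨f, hf, rfl⟩ := hu
  obtain ⟨N', Y', Z', ψ', σ, hσ, hp', e⟩ := pres2 ha hb f hf hp
  have hc := Cap.chain3 (D := D) hσ hk
  have := h N' Y' Z' ψ' hp' _ _ hc
  rw [← Category.assoc ψ, e, Category.assoc, ← Category.assoc k]
  exact this

theorem FG.post {M M' M'' : Form P} {u : M' ⟶ M''} (hu : IsDS u) {g : M ⟶ M'}
    (h : FG D g) : FG D (g ≫ u) := by
  intro N Y Z ψ hp T k hk
  have := (h N Y Z ψ hp T k hk).comp hu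
  simp only [Category.assoc] at this
  exact this

theorem lay_aux {T T' X M W : Form P} (kd : Kd) (A : Form P) (h : T ⟶ op kd A T')
    (k : T' ⟶ X ⋎ W) (θ : X ⟶ M) :
    (h ≫ lm kd A k ≫ st kd A X W) ≫ dj (lm kd A θ) (𝟙 W) =
      h ≫ lm kd A (k ≫ dj θ (𝟙 W)) ≫ st kd A M W := by
  have h1 := st_nat kd A θ (𝟙 W)
  simp only [Category.assoc, lm_comp, h1]

theorem F1.lay (ha : Atomic D.a) (kd : Kd) (A : Form P) (hA : cnt D.a A = 0) {M M' : Form P}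
    (hM : M ≠ D.a) {g : M ⟶ M'} (h : F1 D g) : F1 D (lm kd A g) := by
  intro Y φ hp
  refine hp.inv kd (fun Y φ => ∀ (T : Form P) (Z : List (Layer P))
    (k : T ⟶ fill Y D.a ⋎ fill Z D.b), Cap2 D Y Z k →
      IsDS (k ≫ dj (φ ≫ lm kd A g) (𝟙 (fill Z D.b)))) ?_ ?_ ?_
  · intro φ hr
    exact (hr.not ha).elim
  · intro Y φ hp T Z k hk
    have hne : Y ≠ [] := by
      rintro rfl
      cases hp with
      | base _ _ h => cases h; exact hM rfl
    have e0 : lm kd A φ ≫ lm kd A g = lm kd A (φ ≫ g) := (lm_comp _ _ _ _).symm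
    refine (congrArg (fun z => IsDS (k ≫ dj z (𝟙 (fill Z D.b)))) e0).mpr ?_
    refine killG (Y0 := ⟨kd, A⟩ :: Y) (by simp) (fun W => op kd A M' ⋎ W)
      (fun W => dj (lm kd A (φ ≫ g)) (𝟙 W)) ?_ ?_ hk
    · intro kd' F W
      refine ⟨st' kd' F _ W, .st' _ _ _ _, ?_⟩
      have := st'_nat kd' F (lm kd A (φ ≫ g)) (𝟙 W)
      rw [lm_id] at this
      exact this
    · intro T Z k hk
      cases hk with
      | stemL h' hh k e => exact absurd rfl hne
      | layL kd F h' hh k' hk' k e =>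
        rw [e]
        refine (congrArg IsDS (lay_aux kd A h' k' (φ ≫ g))).mpr ?_
        exact hh.comp ((IsDS.ly _ _ (h Y φ hp _ Z k' hk')).comp (.st _ _ _ _))
  · intro Y φ hp
    have := hp.cnt1 ha
    omega

theorem fglay_aux {T X M M' A W : Form P} (k : T ⟶ X ⋎ W) (φ1 : X ⟶ M) (φ2 : W ⟶ A)
    (g : M ⟶ M') : k ≫ (dj φ1 φ2 ≫ dc M A) ≫ lm Kd.dis A g =
      (k ≫ dj (φ1 ≫ g) (𝟙 W)) ≫ dj (𝟙 M') φ2 ≫ dc M' A := by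
  have h := (SS Kd.dis).c_nat (𝟙 A) g
  have h1 : dc M A ≫ lm Kd.dis A g = dj g (𝟙 A) ≫ dc M' A := (SS Kd.dis).c_nat g (𝟙 A)
  simp only [Category.assoc]
  rw [h1, ← Category.assoc (dj φ1 φ2), ← Category.assoc (dj (φ1 ≫ g) (𝟙 W)), (SS Kd.dis).m_comp,
    (SS Kd.dis).m_comp, Category.comp_id, Category.comp_id, Category.id_comp]

theorem FG.lay (ha : Atomic D.a) (kd : Kd) (A : Form P) (hA : cnt D.a A = 0) {M M' : Form P}
    (hM : M ≠ D.a ⋎ D.b) (hM' : M ≠ D.b ⋎ D.a) {g : M ⟶ M'} (h1 : F1 D g) (h : FG D g) :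
    FG D (lm kd A g) := by
  intro N Y Z ψ hp
  refine hp.inv kd (fun N ψ => ∀ (T : Form P)
    (k : T ⟶ fill N (fill Y D.a ⋎ fill Z D.b)), Cap D N Y Z k →
      IsDS (k ≫ ψ ≫ lm kd A g)) ?_ ?_ ?_
  · intro ψ hr T k hk
    cases kd
    · exact hr.not.elim
    · rcases R2.inv hr with ⟨φ1, φ2, hp1, hp2, e⟩ | ⟨φ1, φ2, hp1, hp2, e⟩
      · have := hp1.cnt1 ha
        omega
      · rw [e]
        have := h1 Y φ1 hp1 T Z k hk.toCap2
        refine (congrArg IsDS (fglay_aux k φ1 φ2 g)).mpr ?_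
        exact this.comp ((IsDS.m .dis (.id _) (hp2.isDS (fun _ _ h => h.isDS))).comp (.c .dis _ _))
  · intro N ψ hp T k hk
    cases hk with
    | stem h' hh k e =>
      exfalso
      cases hp with
      | base _ _ h =>
        cases h with
        | lca h3 h4 =>
          cases h3 with
          | base _ _ h3 => cases h4 with | base _ _ h4 => cases h3; cases h4; exact hM rfl
        | lca' h3 h4 =>
          cases h3 with
          | base _ _ h3 => cases h4 with | base _ _ h4 => cases h3; cases h4; exact hM' rfl
    | lay kd F h' hh k' hk' k e =>
      have := h N Y Z ψ hp _ k' hk'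
      rw [e]
      have e1 : (h' ≫ lm kd A k') ≫ lm kd A ψ ≫ lm kd A g = h' ≫ lm kd A (k' ≫ ψ ≫ g) := by
        rw [lm_comp, lm_comp, Category.assoc]
      refine (congrArg IsDS e1).mpr ?_
      exact hh.comp (IsDS.ly _ _ this)
  · intro N ψ hp
    have := hp.cnt2 ha
    omega

theorem head_aux (s : Snake D) {T T' B W : Form P} (h : T ⟶ B ⋎ T') (k : T' ⟶ (D.b ⋏ D.a) ⋎ W) :
    (h ≫ dj (𝟙 B) k ≫ da B (D.b ⋏ D.a) W) ≫
      dj ((lm Kd.dis B (lm Kd.con D.b (𝟙 D.a)) ≫ dc B (D.b ⋏ D.a)) ≫ s.sig B) (𝟙 W) =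
    h ≫ lm Kd.dis B (k ≫ s.sig W) := by
  have h1 := s.sda B W
  rw [lm_id, lm_id, Category.assoc, Category.id_comp]
  simp only [Category.assoc]
  rw [h1, lm_comp]

theorem F1.sig (s : Snake D) (hb : cnt D.a D.b = 0) (B : Form P) (hB : cnt D.a B = 0) :
    F1 D (s.sig B) := by
  intro Y φ hp
  refine hp.inv .dis (fun Y φ => ∀ (T : Form P) (Z : List (Layer P))
    (k : T ⟶ fill Y D.a ⋎ fill Z D.b), Cap2 D Y Z k →
      IsDS (k ≫ dj (φ ≫ s.sig B) (𝟙 (fill Z D.b)))) ?_ ?_ ?_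
  · intro φ hr
    exact (hr.not (kd := .dis) s.ha).elim
  · intro Y φ hp
    have := hp.cnt1 s.ha
    omega
  · intro Y φ hp
    refine hp.inv .con (fun Y φ => ∀ (T : Form P) (Z : List (Layer P))
      (k : T ⟶ fill (⟨.dis, B⟩ :: Y) D.a ⋎ fill Z D.b), Cap2 D (⟨.dis, B⟩ :: Y) Z k →
        IsDS (k ≫ dj ((lm Kd.dis B φ ≫ dc B (D.b ⋏ D.a)) ≫ s.sig B) (𝟙 (fill Z D.b)))) ?_ ?_ ?_
    · intro φ hr
      exact (hr.not (kd := .con) s.ha).elim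
    · intro Y φ hp
      refine hp.inv1 s.ha (fun Y φ => ∀ (T : Form P) (Z : List (Layer P))
        (k : T ⟶ fill (⟨.dis, B⟩ :: ⟨.con, D.b⟩ :: Y) D.a ⋎ fill Z D.b),
          Cap2 D (⟨.dis, B⟩ :: ⟨.con, D.b⟩ :: Y) Z k →
          IsDS (k ≫ dj ((lm Kd.dis B (lm Kd.con D.b φ) ≫ dc B (D.b ⋏ D.a)) ≫ s.sig B)
            (𝟙 (fill Z D.b)))) ?_
      intro T Z k hk
      obtain ⟨T', h, k', hh, hk', e⟩ := hk.inv
      rw [e]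
      refine (congrArg IsDS (head_aux s h k')).mpr ?_
      exact hh.comp (.ly _ _ (hk'.K s))
    · intro Y φ hp
      have := hp.cnt1 s.ha
      omega

theorem fghead_aux (s : Snake D) {T B W : Form P} (k : T ⟶ (D.b ⋏ D.a) ⋎ W) (φ : W ⟶ B) :
    k ≫ dj (lm Kd.con D.b (𝟙 D.a)) φ ≫ s.sig B = (k ≫ s.sig W) ≫ φ := by
  rw [lm_id, s.snat, Category.assoc]

theorem FG.sig (s : Snake D) (hb : cnt D.a D.b = 0) (B : Form P) (hB : cnt D.a B = 0) :
    FG D (s.sig B) := by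
  intro N Y Z ψ hp
  refine hp.inv .dis (fun N ψ => ∀ (T : Form P)
    (k : T ⟶ fill N (fill Y D.a ⋎ fill Z D.b)), Cap D N Y Z k →
      IsDS (k ≫ ψ ≫ s.sig B)) ?_ ?_ ?_
  · intro ψ hr T k hk
    rcases R2.inv hr with ⟨φ1, φ2, hp1, hp2, e⟩ | ⟨φ1, φ2, hp1, hp2, e⟩
    · rw [e]
      have hk2 := hk.toCap2
      clear hk e hr hp
      revert k
      refine hp1.inv .con (fun Y φ1 => ∀ (k : T ⟶ fill Y D.a ⋎ fill Z D.b), Cap2 D Y Z k →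
        IsDS (k ≫ dj φ1 φ2 ≫ s.sig B)) ?_ ?_ ?_
      · intro φ hr
        exact (hr.not (kd := .con) s.ha).elim
      · intro Y φ hp
        refine hp.inv1 s.ha (fun Y φ => ∀ (k : T ⟶ fill (⟨.con, D.b⟩ :: Y) D.a ⋎ fill Z D.b),
          Cap2 D (⟨.con, D.b⟩ :: Y) Z k → IsDS (k ≫ dj (lm Kd.con D.b φ) φ2 ≫ s.sig B)) ?_
        intro k hk
        refine (congrArg IsDS (fghead_aux s k φ2)).mpr ?_
        exact (hk.K s).comp (hp2.isDS (fun _ _ h => h.isDS))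
      · intro Y φ hp
        have := hp.cnt1 s.ha
        omega
    · have := hp1.cnt1 s.ha
      omega
  · intro N ψ hp
    have := hp.cnt2 s.ha
    omega
  · intro N ψ hp
    exfalso
    refine hp.inv .con (fun _ _ => False) ?_ ?_ ?_
    · intro ψ hr; exact hr.not
    · intro N ψ hp; exact hp.not2 s.ha
    · intro N ψ hp; exact hp.not2 s.hb

end Final
end PNL


namespace PNL

open CategoryTheory

section Main1
variable {P : Type}

theorem sigma_nat (p : P) {W W' : Form P} (f : W ⟶ W') :
    dj (𝟙 (Form.pos p ⋏ Form.natom p)) f ≫ cl (Term.sigma p W') = cl (Term.sigma p W) ≫ f := by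
  induction f using cl_ind
  exact (cl_eq (Eqv.sigmaNat p _)).symm

theorem sigma_db (p : P) (B A : Form P) :
    db (Form.pos p ⋏ Form.natom p) B A ≫ cl (Term.sigma p (B ⋎ A)) =
      dj (cl (Term.sigma p B)) (𝟙 A) := cl_eq (Eqv.bSigma p B A)

theorem sigma_st' (p : P) (kd : Kd) (F W : Form P) :
    st' kd F (Form.pos p ⋏ Form.natom p) W ≫ cl (Term.sigma p (op kd F W)) =
      lm kd F (cl (Term.sigma p W)) := by
  cases kd
  · have h : st .con F W (Form.pos p ⋏ Form.natom p) ≫ (dc (F ⋏ W) (Form.pos p ⋏ Form.natom p) ≫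
        cl (Term.sigma p (F ⋏ W))) = lm Kd.con F (dc W (Form.pos p ⋏ Form.natom p) ≫
        cl (Term.sigma p W)) := cl_eq (Eqv.dDeltaDisj p F W)
    unfold st'
    simp only [Category.assoc]
    rw [h, ← lm_comp, (SS Kd.dis).cc_assoc]
  · change (SS Kd.dis).b F (Form.pos p ⋏ Form.natom p) W ≫ cl (Term.sigma p (F ⋎ W)) = _
    have h1 := sigma_db p W F
    have h2 := sigma_nat p (dc W F)
    have h3 : lm Kd.dis F (cl (Term.sigma p W)) = dc F _ ≫ dj (cl (Term.sigma p W)) (𝟙 F) ≫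
        dc W F := by
      have := (SS Kd.dis).c_nat (cl (Term.sigma p W)) (𝟙 F)
      rw [← this, (SS Kd.dis).cc_assoc]
    have h4 := (SS Kd.dis).b_b F (Form.pos p ⋏ Form.natom p) W
    have h5 : (SS Kd.dis).b (Form.pos p ⋏ Form.natom p) F W ≫ dc F ((Form.pos p ⋏ Form.natom p) ⋎ W) ≫
        db (Form.pos p ⋏ Form.natom p) W F ≫ lm Kd.dis (Form.pos p ⋏ Form.natom p) (dc W F) = 𝟙 _ := by
      unfold Sym.b
      simp only [Category.assoc]
      rw [(SS Kd.dis).cc_assoc, (SS Kd.dis).aa'_assoc, ← lm_comp, (SS Kd.dis).cc, lm_id]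
    have h6 : (SS Kd.dis).b F (Form.pos p ⋏ Form.natom p) W = dc F ((Form.pos p ⋏ Form.natom p) ⋎ W) ≫
        db (Form.pos p ⋏ Form.natom p) W F ≫ lm Kd.dis (Form.pos p ⋏ Form.natom p) (dc W F) := by
      have := congrArg (fun z => (SS Kd.dis).b F (Form.pos p ⋏ Form.natom p) W ≫ z) h5
      rw [reassoc_of% h4] at this
      exact (this.trans (Category.comp_id _)).symm
    rw [h6, h3, ← h1]
    simp only [Category.assoc]
    rw [h2]

def dsnake (p : P) : Snake (dcap p) where
  sig W := cl (Term.sigma p W)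
  snat f := sigma_nat p f
  sst kd F W := sigma_st' p kd F W
  sda B W := by
    have h := sigma_db p B W
    have h2 := sigma_st' p .dis B W
    change (SS Kd.dis).b B (Form.pos p ⋏ Form.natom p) W ≫ cl (Term.sigma p (B ⋎ W)) = _ at h2
    rw [Sym.b_eq, Category.assoc, Category.assoc] at h2
    rw [Sym.m_left, ← h]
    exact h2
  snake := (Category.assoc _ _ _).symm.trans (cl_eq (Eqv.sigmaDelta p))
  ha := .natom p
  hb := .pos p

theorem theta_src {p : P} {M M' : Form P} {g : Term P M M'} {i j : ℕ} {π : List Dir}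
    (h : IsThetaDisjTerm p g i j π) : 1 ≤ cnt (Form.natom p) M ∧ M ≠ Form.natom p ∧
      (∀ q, M ≠ Form.pos q) := by
  have h0 : cnt (Form.natom p) (Form.natom p) = 1 := cnt_self (.natom p)
  induction h with
  | sigma B => simp only [cnt] at h0 ⊢; refine ⟨by omega, nofun, nofun⟩
  | sigma' B => simp only [cnt] at h0 ⊢; refine ⟨by omega, nofun, nofun⟩
  | deltaDisj B => simp only [cnt] at h0 ⊢; refine ⟨by omega, nofun, nofun⟩
  | deltaDisj' B => simp only [cnt] at h0 ⊢; refine ⟨by omega, nofun, nofun⟩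
  | conjL A _ ih => refine ⟨by have := ih.1; simp only [cnt]; omega, nofun, nofun⟩
  | conjR A _ ih => refine ⟨by have := ih.1; simp only [cnt]; omega, nofun, nofun⟩
  | disjL A _ ih => refine ⟨by have := ih.1; simp only [cnt]; omega, nofun, nofun⟩
  | disjR A _ ih => refine ⟨by have := ih.1; simp only [cnt]; omega, nofun, nofun⟩

theorem theta_not_crown {p : P} {M M' : Form P} {g : Term P M M'} {i j : ℕ} {π : List Dir}
    (h : IsThetaDisjTerm p g i j π) : M ≠ Form.natom p ⋎ Form.pos p ∧
      M ≠ Form.pos p ⋎ Form.natom p := by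
  cases h with
  | disjL A h =>
    have := theta_src h
    constructor <;> (intro e; injection e with e1 e2)
    · exact this.2.2 _ e2
    · exact this.2.1 e2
  | disjR A h =>
    have := theta_src h
    constructor <;> (intro e; injection e with e1 e2)
    · exact this.2.1 e1
    · exact this.2.2 _ e1
  | _ => constructor <;> nofun

theorem mR_eq (kd : Kd) (A : Form P) {M M' : Form P} (g : M ⟶ M') :
    (SS kd).m g (𝟙 A) = (SS kd).c M A ≫ lm kd A g ≫ (SS kd).c A M' := by
  have := (SS kd).c_nat g (𝟙 A)
  rw [← Category.assoc, this, Category.assoc, (SS kd).cc, Category.comp_id]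

theorem cnt_pn (p : P) : cnt (Form.natom p) (Form.pos p) = 0 := by simp [cnt]

theorem F12.lay (p : P) (kd : Kd) (A : Form P) (hA : cnt (Form.natom p) A = 0)
    {M M' : Form P} {g : Term P M M'} {i j : ℕ} {π : List Dir}
    (h : IsThetaDisjTerm p g i j π) (ih : F1 (dcap p) (cl g) ∧ FG (dcap p) (cl g)) :
    F1 (dcap p) (lm kd A (cl g)) ∧ FG (dcap p) (lm kd A (cl g)) := by
  have h1 := theta_src h
  have h2 := theta_not_crown h
  exact ⟨F1.lay (D := dcap p) (.natom p) kd A hA h1.2.1 ih.1,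
    FG.lay (D := dcap p) (.natom p) kd A hA h2.1 h2.2 ih.1 ih.2⟩

theorem F12.layR (p : P) (kd : Kd) (A : Form P) (hA : cnt (Form.natom p) A = 0)
    {M M' : Form P} {g : Term P M M'} {i j : ℕ} {π : List Dir}
    (h : IsThetaDisjTerm p g i j π) (ih : F1 (dcap p) (cl g) ∧ FG (dcap p) (cl g)) :
    F1 (dcap p) ((SS kd).m (cl g) (𝟙 A)) ∧ FG (dcap p) ((SS kd).m (cl g) (𝟙 A)) := by
  obtain ⟨h1, h2⟩ := F12.lay p kd A hA h ih
  rw [mR_eq]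
  exact ⟨(h1.post (.c _ _ _)).pre (.natom p) (.c _ _ _),
    (h2.post (.c _ _ _)).pre (.natom p) (.pos p) (.c _ _ _)⟩

theorem F12.pre (p : P) {M0 M M' : Form P} {g : M ⟶ M'} (h : F1 (dcap p) g ∧ FG (dcap p) g)
    {u : M0 ⟶ M} (hu : IsDS u) : F1 (dcap p) (u ≫ g) ∧ FG (dcap p) (u ≫ g) :=
  ⟨h.1.pre (.natom p) hu, h.2.pre (.natom p) (.pos p) hu⟩

theorem F12.theta {p : P} {M M' : Form P} {g : Term P M M'} {i j : ℕ} {π : List Dir}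
    (h : IsThetaDisjTerm p g i j π) (hc : cnt (Form.natom p) M ≤ 1) :
    F1 (dcap p) (cl g) ∧ FG (dcap p) (cl g) := by
  have h0 : cnt (Form.natom p) (Form.natom p) = 1 := cnt_self (.natom p)
  have hs : ∀ B, cnt (Form.natom p) B = 0 →
      F1 (dcap p) (cl (Term.sigma p B)) ∧ FG (dcap p) (cl (Term.sigma p B)) := fun B hB =>
    ⟨F1.sig (dsnake p) (cnt_pn p) B hB, FG.sig (dsnake p) (cnt_pn p) B hB⟩
  induction h with
  | sigma B => exact hs B (by simp only [cnt] at h0 hc ⊢; omega)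
  | sigma' B =>
    exact F12.pre p (hs B (by simp only [cnt] at h0 hc ⊢; omega)) (.m .dis (.c .con _ _) (.id _))
  | deltaDisj B =>
    exact F12.pre p (hs B (by simp only [cnt] at h0 hc ⊢; omega)) (.c .dis _ _)
  | deltaDisj' B =>
    exact F12.pre p (F12.pre p (hs B (by simp only [cnt] at h0 hc ⊢; omega))
      (.m .dis (.c .con _ _) (.id _))) (.c .dis _ _)
  | conjL A h ih =>
    have := (theta_src h).1
    simp only [cnt] at hc
    exact F12.lay p .con A (by omega) h (ih (by omega))
  | conjR A h ih =>
    have := (theta_src h).1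
    simp only [cnt] at hc
    exact F12.layR p .con A (by omega) h (ih (by omega))
  | disjL A h ih =>
    have := (theta_src h).1
    simp only [cnt] at hc
    exact F12.lay p .dis A (by omega) h (ih (by omega))
  | disjR A h ih =>
    have := (theta_src h).1
    simp only [cnt] at hc
    exact F12.layR p .dis A (by omega) h (ih (by omega))

/-- The main theorem when the negated letter occurs only once. -/
theorem main_unique {p : P} {A' A B B' : Form P} {g₁ : Term P A' A} {i j : ℕ} {π : List Dir}
    (h₁ : IsXiConjTerm p g₁ i j π) {f : Term P A B} (hf : IsDSTerm f) {g₂ : Term P B B'}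
    {i' j' : ℕ} {ρ : List Dir} (h₂ : IsThetaDisjTerm p g₂ i' j' ρ)
    (hc : cnt (Form.natom p) A ≤ 1) :
    ∃ k : Term P A' B', IsDSTerm k ∧ Eqv (g₂ ⬝ (f ⬝ g₁)) k := by
  obtain ⟨N, Y, Z, k, ψ, hp, hk, e⟩ := (CAP.xi h₁).post ⟨f, hf, rfl⟩
  have hc' : cnt (Form.natom p) B ≤ 1 := (cnt_ds _ f hf) ▸ hc
  have := (F12.theta h₂ hc').2 N Y Z ψ hp _ k hk
  rw [← Category.assoc, ← e] at this
  obtain ⟨t, ht, et⟩ := this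
  exact ⟨t, ht, cl_exact et.symm⟩

end Main1
end PNL


namespace PNL

section Renaming
variable {P Q : Type}

/-- Renaming of letters in a formula. -/
def fren (φ : Q → P) : Form Q → Form P
  | .pos q => .pos (φ q)
  | .natom q => .natom (φ q)
  | .conj A B => .conj (fren φ A) (fren φ B)
  | .disj A B => .disj (fren φ A) (fren φ B)

/-- Renaming of letters in an arrow term. -/
def tren (φ : Q → P) : ∀ {A B : Form Q}, Term Q A B → Term P (fren φ A) (fren φ B)
  | _, _, .id A => .id _
  | _, _, .comp g f => .comp (tren φ g) (tren φ f)
  | _, _, .conj f g => .conj (tren φ f) (tren φ g)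
  | _, _, .disj f g => .disj (tren φ f) (tren φ g)
  | _, _, .bConjTo A B C => .bConjTo _ _ _
  | _, _, .bConjFrom A B C => .bConjFrom _ _ _
  | _, _, .bDisjTo A B C => .bDisjTo _ _ _
  | _, _, .bDisjFrom A B C => .bDisjFrom _ _ _
  | _, _, .cConj A B => .cConj _ _
  | _, _, .cDisj A B => .cDisj _ _
  | _, _, .d A B C => .d _ _ _
  | _, _, .delta p A => .delta _ _
  | _, _, .sigma p A => .sigma _ _

theorem fren_size (φ : Q → P) (A : Form Q) : (fren φ A).size = A.size := by
  induction A with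
  | pos q => rfl
  | natom q => rfl
  | conj A B ihA ihB => simp only [fren, Form.size, ihA, ihB]
  | disj A B ihA ihB => simp only [fren, Form.size, ihA, ihB]

theorem tren_G (φ : Q → P) {A B : Form Q} (t : Term Q A B) : (tren φ t).G = t.G := by
  induction t with
  | comp g f ihg ihf => simp only [tren, Term.G, ihg, ihf]
  | conj f g ihf ihg => simp only [tren, Term.G, ihg, ihf, fren_size]
  | disj f g ihf ihg => simp only [tren, Term.G, ihg, ihf, fren_size]
  | _ => simp only [tren, Term.G, fren_size, fren, Form.size]

theorem tren_ds (φ : Q → P) {A B : Form Q} (t : Term Q A B) (ht : IsDSTerm t) :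
    IsDSTerm (tren φ t) := by
  induction t with
  | comp g f ihg ihf => exact ⟨ihg ht.1, ihf ht.2⟩
  | conj f g ihf ihg => exact ⟨ihf ht.1, ihg ht.2⟩
  | disj f g ihf ihg => exact ⟨ihf ht.1, ihg ht.2⟩
  | delta => exact ht.elim
  | sigma => exact ht.elim
  | _ => trivial

theorem tren_eqv (φ : Q → P) {A B : Form Q} {s t : Term Q A B} (h : Eqv s t) :
    Eqv (tren φ s) (tren φ t) := by
  induction h with
  | refl f => exact .refl _
  | symm _ ih => exact .symm ih
  | trans _ _ ih1 ih2 => exact .trans ih1 ih2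
  | congComp _ _ ih1 ih2 => exact .congComp ih1 ih2
  | congConj _ _ ih1 ih2 => exact .congConj ih1 ih2
  | congDisj _ _ ih1 ih2 => exact .congDisj ih1 ih2
  | catIdR f => exact .catIdR _
  | catIdL f => exact .catIdL _
  | catAssoc f g h => exact .catAssoc _ _ _
  | conjOne A B => exact .conjOne _ _
  | disjOne A B => exact .disjOne _ _
  | conjTwo g₁ f₁ g₂ f₂ => exact .conjTwo _ _ _ _
  | disjTwo g₁ f₁ g₂ f₂ => exact .disjTwo _ _ _ _
  | bConjNat f g h => exact .bConjNat _ _ _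
  | bDisjNat f g h => exact .bDisjNat _ _ _
  | cConjNat f g => exact .cConjNat _ _
  | cDisjNat f g => exact .cDisjNat _ _
  | dNat f g h => exact .dNat _ _ _
  | bConjIso₁ A B C => exact .bConjIso₁ _ _ _
  | bConjIso₂ A B C => exact .bConjIso₂ _ _ _
  | bDisjIso₁ A B C => exact .bDisjIso₁ _ _ _
  | bDisjIso₂ A B C => exact .bDisjIso₂ _ _ _
  | bConjPent A B C D => exact .bConjPent _ _ _ _
  | bDisjPent A B C D => exact .bDisjPent _ _ _ _
  | cConjIso A B => exact .cConjIso _ _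
  | cDisjIso A B => exact .cDisjIso _ _
  | bcConj A B C => exact .bcConj _ _ _
  | bcDisj A B C => exact .bcDisj _ _ _
  | dConj A B C D => exact .dConj _ _ _ _
  | dDisj A B C D => exact .dDisj _ _ _ _
  | dBConj A B C D => exact .dBConj _ _ _ _
  | dBDisj A B C D => exact .dBDisj _ _ _ _
  | deltaNat p f => exact .deltaNat _ _
  | sigmaNat p f => exact .sigmaNat _ _
  | bDelta A B p => exact .bDelta _ _ _
  | bSigma p B A => exact .bSigma _ _ _
  | dSigmaConj p B C => exact .dSigmaConj _ _ _
  | dDeltaDisj p C B => exact .dDeltaDisj _ _ _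
  | sigmaDelta p => exact .sigmaDelta _
  | sigmaDelta' p => exact .sigmaDelta' _

/-! ### Labels are respected by the links of arrow terms of DS -/

def letters : Form P → List (Form P)
  | .pos q => [.pos q]
  | .natom q => [.natom q]
  | .conj A B => letters A ++ letters B
  | .disj A B => letters A ++ letters B

theorem letters_length (A : Form P) : (letters A).length = A.size := by
  induction A with
  | pos q => rfl
  | natom q => rfl
  | conj A B ihA ihB => simp only [letters, Form.size, List.length_append, ihA, ihB]
  | disj A B ihA ihB => simp only [letters, Form.size, List.length_append, ihA, ihB]

theorem letterAt_eq (A : Form P) (n : ℕ) : A.letterAt n = (letters A)[n]? := by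
  induction A generalizing n with
  | pos q => cases n <;> rfl
  | natom q => cases n <;> rfl
  | conj A B ihA ihB =>
    simp only [letters, Form.letterAt, List.getElem?_append, letters_length, ihA, ihB]
  | disj A B ihA ihB =>
    simp only [letters, Form.letterAt, List.getElem?_append, letters_length, ihA, ihB]

def lab (K L : List (Form P)) : ℕ ⊕ ℕ → Option (Form P)
  | .inl n => K[n]?
  | .inr n => L[n]?

/-- The relation `R` links only equally labelled positions. -/
def Resp (K L : List (Form P)) (R : GRel) : Prop :=
  ∀ u v, R u v → ∃ x, lab K L u = some x ∧ lab K L v = some x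

theorem Resp.gFun {K L : List (Form P)} {m : ℕ} (φ : ℕ → ℕ) (hm : m ≤ K.length)
    (h : ∀ i, i < m → L[φ i]? = K[i]?) : Resp K L (_root_.gFun m φ) := by
  rintro u v ⟨i, hi, hu, hv⟩
  obtain ⟨x, h1⟩ : ∃ x, K[i]? = some x := ⟨_, List.getElem?_eq_getElem (by omega)⟩
  have h2 := (h i hi).trans h1
  refine ⟨x, ?_, ?_⟩
  · rcases hu with rfl | rfl
    exacts [h1, h2]
  · rcases hv with rfl | rfl
    exacts [h1, h2]

theorem Resp.gId (K : List (Form P)) {m : ℕ} (hm : m ≤ K.length) : Resp K K (_root_.gId m) :=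
  Resp.gFun (fun i => i) hm (fun _ _ => rfl)

theorem Resp.gSwap (K L : List (Form P)) {a b : ℕ} (ha : a = K.length) (hb : b = L.length) :
    Resp (K ++ L) (L ++ K) (_root_.gSwap a b) := by
  refine Resp.gFun _ (by simp [ha, hb]) ?_
  intro i hi
  subst ha hb
  simp only [List.getElem?_append]
  by_cases h : i < K.length
  · simp [h]
  · have : i - K.length < L.length := by omega
    simp [h, this]

theorem Resp.gComp {K L M : List (Form P)} {R S : GRel} (hR : Resp K L R) (hS : Resp L M S) :
    Resp K M (_root_.gComp S R) := by
  intro u v h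
  let lb : ℕ ⊕ ℕ ⊕ ℕ → Option (Form P) := fun
    | .inl n => K[n]?
    | .inr (.inl n) => L[n]?
    | .inr (.inr n) => M[n]?
  have key : ∀ x y : ℕ ⊕ ℕ ⊕ ℕ, ((∃ x' y', Sum.map id Sum.inl x' = x ∧ Sum.map id Sum.inl y' = y ∧ R x' y') ∨
      (∃ x' y', Sum.inr x' = x ∧ Sum.inr y' = y ∧ S x' y')) →
      ∃ z, lb x = some z ∧ lb y = some z := by
    rintro x y (⟨x', y', rfl, rfl, h⟩ | ⟨x', y', rfl, rfl, h⟩)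
    · obtain ⟨z, h1, h2⟩ := hR _ _ h
      refine ⟨z, ?_, ?_⟩
      · cases x' <;> exact h1
      · cases y' <;> exact h2
    · obtain ⟨z, h1, h2⟩ := hS _ _ h
      refine ⟨z, ?_, ?_⟩
      · cases x' <;> exact h1
      · cases y' <;> exact h2
  have key2 : ∃ z, lb (Sum.map id Sum.inr u) = some z ∧ lb (Sum.map id Sum.inr v) = some z := by
    unfold _root_.gComp at h
    generalize Sum.map id Sum.inr v = y at h ⊢
    induction h with
    | single h => exact key _ _ h
    | tail _ h ih =>
      obtain ⟨z, h1, h2⟩ := ih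
      obtain ⟨w, h3, h4⟩ := key _ _ h
      rw [h2] at h3
      exact ⟨z, h1, h3 ▸ h4⟩
  obtain ⟨z, h1, h2⟩ := key2
  refine ⟨z, ?_, ?_⟩
  · cases u <;> exact h1
  · cases v <;> exact h2

theorem getElem?_app_left {K L : List (Form P)} {n : ℕ} {x : Form P} (h : K[n]? = some x) :
    (K ++ L)[n]? = some x := by
  obtain ⟨hn, _⟩ := List.getElem?_eq_some_iff.mp h
  rw [List.getElem?_append_left hn, h]

theorem lab_left {K L K' L' : List (Form P)} {u : ℕ ⊕ ℕ} {x : Form P} (h : lab K L u = some x) :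
    lab (K ++ K') (L ++ L') u = some x := by
  cases u <;> exact getElem?_app_left h

theorem lab_right {K L K' L' : List (Form P)} {u : ℕ ⊕ ℕ} {x : Form P} (h : lab K' L' u = some x) :
    lab (K ++ K') (L ++ L') (Sum.map (· + K.length) (· + L.length) u) = some x := by
  cases u <;> simpa [lab, List.getElem?_append_right] using h

theorem Resp.gPar {K L K' L' : List (Form P)} {R S : GRel} (hR : Resp K L R) (hS : Resp K' L' S)
    {a d : ℕ} (ha : a = K.length) (hd : d = L.length) :
    Resp (K ++ K') (L ++ L') (_root_.gPar a d R S) := by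
  subst ha hd
  rintro u v (h | ⟨u', v', h, rfl, rfl⟩)
  · obtain ⟨x, h1, h2⟩ := hR _ _ h
    exact ⟨x, lab_left h1, lab_left h2⟩
  · obtain ⟨x, h1, h2⟩ := hS _ _ h
    exact ⟨x, lab_right h1, lab_right h2⟩

theorem resp_G {A B : Form P} (t : Term P A B) (ht : IsDSTerm t) :
    Resp (letters A) (letters B) t.G := by
  have assoc : ∀ A B C : List (Form P), A ++ (B ++ C) = (A ++ B) ++ C :=
    fun _ _ _ => (List.append_assoc _ _ _).symm
  induction t with
  | id A => exact Resp.gId _ (letters_length A).ge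
  | comp g f ihg ihf => exact Resp.gComp (ihf ht.2) (ihg ht.1)
  | conj f g ihf ihg =>
    exact Resp.gPar (ihf ht.1) (ihg ht.2) (letters_length _).symm (letters_length _).symm
  | disj f g ihf ihg =>
    exact Resp.gPar (ihf ht.1) (ihg ht.2) (letters_length _).symm (letters_length _).symm
  | delta => exact ht.elim
  | sigma => exact ht.elim
  | cConj A B => exact Resp.gSwap _ _ (letters_length _).symm (letters_length _).symm
  | cDisj A B => exact Resp.gSwap _ _ (letters_length _).symm (letters_length _).symm
  | _ =>
    simp only [letters, assoc, Term.G]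
    refine Resp.gId _ ?_
    simp only [List.length_append, letters_length]
    omega

theorem Linked.letterAt {A B : Form P} {t : Term P A B} (ht : IsDSTerm t) {n m : ℕ}
    (h : Linked t n m) : A.letterAt n = B.letterAt m := by
  obtain ⟨x, h1, h2⟩ := resp_G t ht _ _ h
  rw [letterAt_eq, letterAt_eq]
  exact h1.trans h2.symm

end Renaming
end PNL


namespace PNL

section Lifting
variable {P : Type}

theorem fren_conj_inv {Q : Type} {φ : Q → P} {M : Form Q} {A B : Form P} (h : fren φ M = A ⋏ B) :
    ∃ M1 M2, M = M1 ⋏ M2 ∧ fren φ M1 = A ∧ fren φ M2 = B := by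
  cases M with
  | pos q => cases h
  | natom q => cases h
  | conj M1 M2 =>
    simp only [fren, Form.conj.injEq] at h
    exact ⟨M1, M2, rfl, h.1, h.2⟩
  | disj M1 M2 => cases h

theorem fren_disj_inv {Q : Type} {φ : Q → P} {M : Form Q} {A B : Form P} (h : fren φ M = A ⋎ B) :
    ∃ M1 M2, M = M1 ⋎ M2 ∧ fren φ M1 = A ∧ fren φ M2 = B := by
  cases M with
  | pos q => cases h
  | natom q => cases h
  | disj M1 M2 =>
    simp only [fren, Form.disj.injEq] at h
    exact ⟨M1, M2, rfl, h.1, h.2⟩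
  | conj M1 M2 => cases h

theorem fren_pos_inv {Q : Type} {φ : Q → P} {M : Form Q} {p : P} (h : fren φ M = Form.pos p) :
    ∃ q, M = Form.pos q ∧ φ q = p := by
  cases M with
  | pos q => exact ⟨q, rfl, by simpa [fren] using h⟩
  | natom q => cases h
  | disj M1 M2 => cases h
  | conj M1 M2 => cases h

theorem fren_natom_inv {Q : Type} {φ : Q → P} {M : Form Q} {p : P} (h : fren φ M = Form.natom p) :
    ∃ q, M = Form.natom q ∧ φ q = p := by
  cases M with
  | natom q => exact ⟨q, rfl, by simpa [fren] using h⟩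
  | pos q => cases h
  | disj M1 M2 => cases h
  | conj M1 M2 => cases h

/-- The projection of the letters `Option P` on the letters `P`. -/
def prj (p : P) : Option P → P := fun q => q.getD p

open Classical in
/-- The lifting of a formula in which no negated letter is the fresh one. -/
noncomputable def mkF (p : P) : Form P → Form (Option P)
  | .pos q => .pos (if q = p then none else some q)
  | .natom q => .natom (some q)
  | .conj A B => .conj (mkF p A) (mkF p B)
  | .disj A B => .disj (mkF p A) (mkF p B)

theorem fren_mkF (p : P) (A : Form P) : fren (prj p) (mkF p A) = A := by
  induction A with
  | pos q =>
    by_cases h : q = p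
    · simp [mkF, fren, prj, h]
    · simp [mkF, fren, prj, h]
  | natom q => rfl
  | conj A B ihA ihB => simp only [mkF, fren, ihA, ihB]
  | disj A B ihA ihB => simp only [mkF, fren, ihA, ihB]

theorem cnt_mkF (p : P) (A : Form P) : cnt (Form.natom none) (mkF p A) = 0 := by
  induction A with
  | pos q => simp [mkF, cnt]
  | natom q => simp [mkF, cnt]
  | conj A B ihA ihB => simp only [mkF, cnt, ihA, ihB]
  | disj A B ihA ihB => simp only [mkF, cnt, ihA, ihB]

/-- No positive letter is `some p`. -/
def good (p : P) : Form (Option P) → Prop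
  | .pos q => q ≠ some p
  | .natom _ => True
  | .conj A B => good p A ∧ good p B
  | .disj A B => good p A ∧ good p B

theorem good_mkF (p : P) (A : Form P) : good p (mkF p A) := by
  induction A with
  | pos q =>
    by_cases h : q = p
    · simp [mkF, good, h]
    · simp [mkF, good, h]
  | natom q => trivial
  | conj A B ihA ihB => exact ⟨ihA, ihB⟩
  | disj A B ihA ihB => exact ⟨ihA, ihB⟩

theorem good_ds (p : P) {A B : Form (Option P)} (f : Term (Option P) A B) (hf : IsDSTerm f)
    (h : good p A) : good p B := by
  induction f with
  | id A => exact h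
  | comp g f ihg ihf => exact ihg hf.1 (ihf hf.2 h)
  | conj f g ihf ihg => exact ⟨ihf hf.1 h.1, ihg hf.2 h.2⟩
  | disj f g ihf ihg => exact ⟨ihf hf.1 h.1, ihg hf.2 h.2⟩
  | delta => exact hf.elim
  | sigma => exact hf.elim
  | _ => simp only [good] at h ⊢; tauto

theorem letterAt_lt {A : Form P} {n : ℕ} {x : Form P} (h : A.letterAt n = some x) : n < A.size := by
  rw [letterAt_eq] at h
  obtain ⟨hn, _⟩ := List.getElem?_eq_some_iff.mp h
  rwa [letters_length] at hn

theorem letterAt_conj_right (A B : Form P) (n : ℕ) :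
    (A ⋏ B).letterAt (A.size + n) = B.letterAt n := by
  simp [Form.letterAt]

theorem letterAt_disj_right (A B : Form P) (n : ℕ) :
    (A ⋎ B).letterAt (A.size + n) = B.letterAt n := by
  simp [Form.letterAt]

theorem letterAt_conj_left {A B : Form P} {n : ℕ} (h : n < A.size) :
    (A ⋏ B).letterAt n = A.letterAt n := by
  simp [Form.letterAt, h]

theorem letterAt_disj_left {A B : Form P} {n : ℕ} (h : n < A.size) :
    (A ⋎ B).letterAt n = A.letterAt n := by
  simp [Form.letterAt, h]

theorem theta_lt {p : P} {A B : Form P} {g : Term P A B} {i j : ℕ} {ρ : List Dir}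
    (h : IsThetaDisjTerm p g i j ρ) : j < A.size := by
  induction h <;> simp only [Form.size] at * <;> omega

theorem lift_ds {Q : Type} (φ : Q → P) {A B : Form P} (f : Term P A B) (hf : IsDSTerm f) :
    ∀ M, fren φ M = A → ∃ (N : Form Q) (f' : Term Q M N), fren φ N = B ∧ IsDSTerm f' ∧
      HEq (tren φ f') f := by
  induction f with
  | id A => rintro M rfl; exact ⟨_, .id M, rfl, trivial, HEq.rfl⟩
  | comp g f ihg ihf =>
    intro M hM
    obtain ⟨N, f', hN, hd, he⟩ := ihf hf.2 M hM
    obtain ⟨N2, g', hN2, hd2, he2⟩ := ihg hf.1 N hN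
    subst hM hN hN2
    cases he
    cases he2
    exact ⟨_, g' ⬝ f', rfl, ⟨hd2, hd⟩, HEq.rfl⟩
  | conj f g ihf ihg =>
    intro M hM
    obtain ⟨M1, M2, rfl, h1, h2⟩ := fren_conj_inv hM
    obtain ⟨N, f', hN, hd, he⟩ := ihf hf.1 M1 h1
    obtain ⟨N2, g', hN2, hd2, he2⟩ := ihg hf.2 M2 h2
    subst h1 h2 hN hN2
    cases he
    cases he2
    exact ⟨_, f' ⊼ g', rfl, ⟨hd, hd2⟩, HEq.rfl⟩
  | disj f g ihf ihg =>
    intro M hM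
    obtain ⟨M1, M2, rfl, h1, h2⟩ := fren_disj_inv hM
    obtain ⟨N, f', hN, hd, he⟩ := ihf hf.1 M1 h1
    obtain ⟨N2, g', hN2, hd2, he2⟩ := ihg hf.2 M2 h2
    subst h1 h2 hN hN2
    cases he
    cases he2
    exact ⟨_, f' ⊽ g', rfl, ⟨hd, hd2⟩, HEq.rfl⟩
  | bConjTo A B C =>
    intro M hM
    obtain ⟨M1, M2, rfl, rfl, h2⟩ := fren_conj_inv hM
    obtain ⟨M2, M3, rfl, rfl, rfl⟩ := fren_conj_inv h2
    exact ⟨_, .bConjTo M1 M2 M3, rfl, trivial, HEq.rfl⟩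
  | bConjFrom A B C =>
    intro M hM
    obtain ⟨M1, M3, rfl, h2, rfl⟩ := fren_conj_inv hM
    obtain ⟨M1, M2, rfl, rfl, rfl⟩ := fren_conj_inv h2
    exact ⟨_, .bConjFrom M1 M2 M3, rfl, trivial, HEq.rfl⟩
  | bDisjTo A B C =>
    intro M hM
    obtain ⟨M1, M2, rfl, rfl, h2⟩ := fren_disj_inv hM
    obtain ⟨M2, M3, rfl, rfl, rfl⟩ := fren_disj_inv h2
    exact ⟨_, .bDisjTo M1 M2 M3, rfl, trivial, HEq.rfl⟩
  | bDisjFrom A B C =>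
    intro M hM
    obtain ⟨M1, M3, rfl, h2, rfl⟩ := fren_disj_inv hM
    obtain ⟨M1, M2, rfl, rfl, rfl⟩ := fren_disj_inv h2
    exact ⟨_, .bDisjFrom M1 M2 M3, rfl, trivial, HEq.rfl⟩
  | cConj A B =>
    intro M hM
    obtain ⟨M1, M2, rfl, rfl, rfl⟩ := fren_conj_inv hM
    exact ⟨_, .cConj M1 M2, rfl, trivial, HEq.rfl⟩
  | cDisj A B =>
    intro M hM
    obtain ⟨M1, M2, rfl, rfl, rfl⟩ := fren_disj_inv hM
    exact ⟨_, .cDisj M2 M1, rfl, trivial, HEq.rfl⟩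
  | d A B C =>
    intro M hM
    obtain ⟨M1, M2, rfl, rfl, h2⟩ := fren_conj_inv hM
    obtain ⟨M2, M3, rfl, rfl, rfl⟩ := fren_disj_inv h2
    exact ⟨_, .d M1 M2 M3, rfl, trivial, HEq.rfl⟩
  | delta => exact hf.elim
  | sigma => exact hf.elim

theorem lift_xi {p : P} {A' A : Form P} {g : Term P A' A} {i j : ℕ} {ρ : List Dir}
    (h : IsXiConjTerm p g i j ρ) :
    ∃ (C' C : Form (Option P)) (g' : Term (Option P) C' C), fren (prj p) C' = A' ∧
      fren (prj p) C = A ∧ HEq (tren (prj p) g') g ∧ IsXiConjTerm none g' i j ρ ∧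
      cnt (Form.natom none) C = 1 ∧ C.letterAt j = some (Form.natom none) ∧ good p C := by
  induction h with
  | delta B =>
    obtain ⟨M, hM, hg, hc⟩ : ∃ M, fren (prj p) M = B ∧ good p M ∧ cnt (Form.natom none) M = 0 :=
      ⟨mkF p B, fren_mkF p B, good_mkF p B, cnt_mkF p B⟩
    subst hM
    rw [fren_size]
    refine ⟨_, _, .delta none M, rfl, rfl, HEq.rfl, .delta M, ?_, ?_, hg, trivial, nofun⟩
    · simp [cnt, hc]
    · simp [Form.letterAt, Form.size]
  | delta' B =>
    obtain ⟨M, hM, hg, hc⟩ : ∃ M, fren (prj p) M = B ∧ good p M ∧ cnt (Form.natom none) M = 0 :=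
      ⟨mkF p B, fren_mkF p B, good_mkF p B, cnt_mkF p B⟩
    subst hM
    rw [fren_size]
    refine ⟨_, _, _root_.delta' none M, rfl, rfl, HEq.rfl, .delta' M, ?_, ?_, hg, nofun, trivial⟩
    · simp [cnt, hc]
    · simp [Form.letterAt, Form.size]
  | sigmaConj B =>
    obtain ⟨M, hM, hg, hc⟩ : ∃ M, fren (prj p) M = B ∧ good p M ∧ cnt (Form.natom none) M = 0 :=
      ⟨mkF p B, fren_mkF p B, good_mkF p B, cnt_mkF p B⟩
    subst hM
    refine ⟨_, _, _root_.sigmaConj none M, rfl, rfl, HEq.rfl, .sigmaConj M, ?_, ?_, ⟨trivial, nofun⟩, hg⟩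
    · simp [cnt, hc]
    · simp [Form.letterAt, Form.size]
  | sigmaConj' B =>
    obtain ⟨M, hM, hg, hc⟩ : ∃ M, fren (prj p) M = B ∧ good p M ∧ cnt (Form.natom none) M = 0 :=
      ⟨mkF p B, fren_mkF p B, good_mkF p B, cnt_mkF p B⟩
    subst hM
    refine ⟨_, _, _root_.sigmaConj' none M, rfl, rfl, HEq.rfl, .sigmaConj' M, ?_, ?_,
      ⟨nofun, trivial⟩, hg⟩
    · simp [cnt, hc]
    · simp [Form.letterAt, Form.size]
  | conjL B _ ih =>
    obtain ⟨M, hM, hg, hc⟩ : ∃ M, fren (prj p) M = B ∧ good p M ∧ cnt (Form.natom none) M = 0 :=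
      ⟨mkF p B, fren_mkF p B, good_mkF p B, cnt_mkF p B⟩
    obtain ⟨C', C, g', h1, h2, h3, h4, h5, h6, h7⟩ := ih
    subst hM h1 h2
    cases h3
    rw [fren_size]
    refine ⟨_, _, .id M ⊼ g', rfl, rfl, HEq.rfl, .conjL M h4, ?_, ?_, hg, h7⟩
    · simp [cnt, hc, h5]
    · rw [letterAt_conj_right, h6]
  | conjR B _ ih =>
    obtain ⟨M, hM, hg, hc⟩ : ∃ M, fren (prj p) M = B ∧ good p M ∧ cnt (Form.natom none) M = 0 :=
      ⟨mkF p B, fren_mkF p B, good_mkF p B, cnt_mkF p B⟩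
    obtain ⟨C', C, g', h1, h2, h3, h4, h5, h6, h7⟩ := ih
    subst hM h1 h2
    cases h3
    refine ⟨_, _, g' ⊼ .id M, rfl, rfl, HEq.rfl, .conjR M h4, ?_, ?_, h7, hg⟩
    · simp [cnt, hc, h5]
    · rw [letterAt_conj_left (letterAt_lt h6), h6]
  | disjL B _ ih =>
    obtain ⟨M, hM, hg, hc⟩ : ∃ M, fren (prj p) M = B ∧ good p M ∧ cnt (Form.natom none) M = 0 :=
      ⟨mkF p B, fren_mkF p B, good_mkF p B, cnt_mkF p B⟩
    obtain ⟨C', C, g', h1, h2, h3, h4, h5, h6, h7⟩ := ih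
    subst hM h1 h2
    cases h3
    rw [fren_size]
    refine ⟨_, _, .id M ⊽ g', rfl, rfl, HEq.rfl, .disjL M h4, ?_, ?_, hg, h7⟩
    · simp [cnt, hc, h5]
    · rw [letterAt_disj_right, h6]
  | disjR B _ ih =>
    obtain ⟨M, hM, hg, hc⟩ : ∃ M, fren (prj p) M = B ∧ good p M ∧ cnt (Form.natom none) M = 0 :=
      ⟨mkF p B, fren_mkF p B, good_mkF p B, cnt_mkF p B⟩
    obtain ⟨C', C, g', h1, h2, h3, h4, h5, h6, h7⟩ := ih
    subst hM h1 h2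
    cases h3
    refine ⟨_, _, g' ⊽ .id M, rfl, rfl, HEq.rfl, .disjR M h4, ?_, ?_, h7, hg⟩
    · simp [cnt, hc, h5]
    · rw [letterAt_disj_left (letterAt_lt h6), h6]

theorem good_pos {p : P} {M : Form (Option P)} (h : fren (prj p) M = Form.pos p) (hg : good p M) :
    M = Form.pos none := by
  obtain ⟨q, rfl, hq⟩ := fren_pos_inv h
  cases q with
  | none => rfl
  | some q =>
    have : q = p := hq
    subst this
    exact absurd rfl hg

theorem lift_theta {p : P} {B B' : Form P} {g : Term P B B'} {i j : ℕ} {ρ : List Dir}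
    (h : IsThetaDisjTerm p g i j ρ) :
    ∀ D, fren (prj p) D = B → good p D → D.letterAt j = some (Form.natom none) →
    ∃ (E : Form (Option P)) (g' : Term (Option P) D E), fren (prj p) E = B' ∧
      HEq (tren (prj p) g') g ∧ IsThetaDisjTerm none g' i j ρ := by
  induction h with
  | sigma B =>
    intro D hD hg hl
    obtain ⟨M1, M2, rfl, h1, rfl⟩ := fren_disj_inv hD
    obtain ⟨M3, M4, rfl, h3, h4⟩ := fren_conj_inv h1
    obtain rfl := good_pos h3 hg.1.1
    obtain ⟨q, rfl, hq⟩ := fren_natom_inv h4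
    obtain rfl : q = none := by simpa [Form.letterAt, Form.size] using hl
    exact ⟨_, .sigma none M2, rfl, HEq.rfl, .sigma M2⟩
  | sigma' B =>
    intro D hD hg hl
    obtain ⟨M1, M2, rfl, h1, rfl⟩ := fren_disj_inv hD
    obtain ⟨M3, M4, rfl, h3, h4⟩ := fren_conj_inv h1
    obtain rfl := good_pos h4 hg.1.2
    obtain ⟨q, rfl, hq⟩ := fren_natom_inv h3
    obtain rfl : q = none := by simpa [Form.letterAt, Form.size] using hl
    exact ⟨_, _root_.sigma' none M2, rfl, HEq.rfl, .sigma' M2⟩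
  | deltaDisj B =>
    intro D hD hg hl
    obtain ⟨M2, M1, rfl, rfl, h1⟩ := fren_disj_inv hD
    obtain ⟨M3, M4, rfl, h3, h4⟩ := fren_conj_inv h1
    obtain rfl := good_pos h3 hg.2.1
    obtain ⟨q, rfl, hq⟩ := fren_natom_inv h4
    rw [fren_size] at hl ⊢
    obtain rfl : q = none := by simpa [Form.letterAt, Form.size] using hl
    exact ⟨_, _root_.deltaDisj none M2, rfl, HEq.rfl, .deltaDisj M2⟩
  | deltaDisj' B =>
    intro D hD hg hl
    obtain ⟨M2, M1, rfl, rfl, h1⟩ := fren_disj_inv hD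
    obtain ⟨M3, M4, rfl, h3, h4⟩ := fren_conj_inv h1
    obtain rfl := good_pos h4 hg.2.2
    obtain ⟨q, rfl, hq⟩ := fren_natom_inv h3
    rw [fren_size] at hl ⊢
    obtain rfl : q = none := by simpa [Form.letterAt, Form.size] using hl
    exact ⟨_, _root_.deltaDisj' none M2, rfl, HEq.rfl, .deltaDisj' M2⟩
  | conjL B h ih =>
    intro D hD hg hl
    obtain ⟨M1, M2, rfl, rfl, h2⟩ := fren_conj_inv hD
    rw [fren_size] at hl ⊢
    rw [letterAt_conj_right] at hl
    obtain ⟨E, g', h3, h4, h5⟩ := ih M2 h2 hg.2 hl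
    subst h2 h3
    cases h4
    exact ⟨_, .id M1 ⊼ g', rfl, HEq.rfl, .conjL M1 h5⟩
  | conjR B h ih =>
    intro D hD hg hl
    obtain ⟨M1, M2, rfl, h2, rfl⟩ := fren_conj_inv hD
    have hlt := theta_lt h
    rw [← h2, fren_size] at hlt
    rw [letterAt_conj_left hlt] at hl
    obtain ⟨E, g', h3, h4, h5⟩ := ih M1 h2 hg.1 hl
    subst h2 h3
    cases h4
    exact ⟨_, g' ⊼ .id M2, rfl, HEq.rfl, .conjR M2 h5⟩
  | disjL B h ih =>
    intro D hD hg hl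
    obtain ⟨M1, M2, rfl, rfl, h2⟩ := fren_disj_inv hD
    rw [fren_size] at hl ⊢
    rw [letterAt_disj_right] at hl
    obtain ⟨E, g', h3, h4, h5⟩ := ih M2 h2 hg.2 hl
    subst h2 h3
    cases h4
    exact ⟨_, .id M1 ⊽ g', rfl, HEq.rfl, .disjL M1 h5⟩
  | disjR B h ih =>
    intro D hD hg hl
    obtain ⟨M1, M2, rfl, h2, rfl⟩ := fren_disj_inv hD
    have hlt := theta_lt h
    rw [← h2, fren_size] at hlt
    rw [letterAt_disj_left hlt] at hl
    obtain ⟨E, g', h3, h4, h5⟩ := ih M1 h2 hg.1 hl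
    subst h2 h3
    cases h4
    exact ⟨_, g' ⊽ .id M2, rfl, HEq.rfl, .disjR M2 h5⟩

theorem main_final {p : P} {A' A B B' : Form P} {g₁ : Term P A' A} {i j : ℕ} {π : List Dir}
    (h₁ : IsXiConjTerm p g₁ i j π) {f : Term P A B} (hf : IsDSTerm f) {g₂ : Term P B B'}
    {i' j' : ℕ} {ρ : List Dir} (h₂ : IsThetaDisjTerm p g₂ i' j' ρ) (hl : Linked f j j') :
    ∃ k : Term P A' B', IsDSTerm k ∧ Eqv (g₂ ⬝ (f ⬝ g₁)) k := by
  obtain ⟨C', C, g₁', hC', hC, hg₁, hx, hc, hn, hgood⟩ := lift_xi h₁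
  obtain ⟨D, f', hD, hd, hf'⟩ := lift_ds (prj p) f hf C hC
  subst hC' hC hD
  cases hg₁
  cases hf'
  have hl' : Linked f' j j' := by
    unfold Linked at hl ⊢
    rwa [tren_G] at hl
  have hn' : D.letterAt j' = some (Form.natom none) := by
    rw [← Linked.letterAt hd hl', hn]
  obtain ⟨E, g₂', hE, hg₂, ht⟩ := lift_theta h₂ D rfl (good_ds p f' hd hgood) hn'
  subst hE
  cases hg₂
  obtain ⟨k, hk, he⟩ := main_unique hx hd ht hc.le
  exact ⟨tren _ k, tren_ds _ k hk, tren_eqv _ he⟩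

end Lifting
end PNL

/-- **p-¬p-p Lemma**: let `x₁, ¬x₂, x₃` be occurrences of `p, ¬p, p` respectively
in a formula `A` of L∧,∨^{¬p}, and `y₁, ¬y₂, y₃` occurrences of `p, ¬p, p`
respectively in a formula `B` of L∧,∨^{¬p}, with `¬x₂ ∨ x₃` or `x₃ ∨ ¬x₂` a
subformula occurrence of `A` and `y₁ ∧ ¬y₂` or `¬y₂ ∧ y₁` a subformula
occurrence of `B`.  Let `g₁ : A′ ⊢ A` be a `Ξ̂∧_{p,C}`-term of PN whose head's
crown is `¬x₂ ∨ x₃` or `x₃ ∨ ¬x₂`, let `g₂ : B ⊢ B′` be a `Θ̂∨_{p,D}`-term of PN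
whose head's crown is `y₁ ∧ ¬y₂` or `¬y₂ ∧ y₁`, and let `f : A ⊢ B` be an arrow
term of DS^{¬p} such that `x_i` and `y_i` are linked in `f` for `i ∈ {1,2,3}`.
Then `g₂ ∘ f ∘ g₁` is equal in PN to an arrow term of DS^{¬p}. -/
theorem p_negp_p_lemma {P : Type} (p : P) {A B A' B' : Form P}
    (a₁ a₂ a₃ b₁ b₂ b₃ : ℕ)
    (hA₁ : A.letterAt a₁ = some (Form.pos p)) (hA₂ : A.letterAt a₂ = some (Form.natom p))
    (hA₃ : A.letterAt a₃ = some (Form.pos p))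
    (hB₁ : B.letterAt b₁ = some (Form.pos p)) (hB₂ : B.letterAt b₂ = some (Form.natom p))
    (hB₃ : B.letterAt b₃ = some (Form.pos p))
    (g₁ : Term P A' A) (π : List Dir) (hg₁ : IsXiConjTerm p g₁ a₃ a₂ π)
    (g₂ : Term P B B') (ρ : List Dir) (hg₂ : IsThetaDisjTerm p g₂ b₁ b₂ ρ)
    (f : Term P A B) (hf : IsDSTerm f)
    (hl₁ : Linked f a₁ b₁) (hl₂ : Linked f a₂ b₂) (hl₃ : Linked f a₃ b₃) :
    ∃ k : Term P A' B', IsDSTerm k ∧ Eqv (g₂ ⬝ (f ⬝ g₁)) k := by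
  exact PNL.main_final hg₁ hf hg₂ hl₂
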